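/- Assume that the singular locus V_sing of the projective complete intersection V is finite, that V_sing ∩ H = ∅, and that d < d_j for every j = 1, …, k. Let s be an integer with 1 ≤ s ≤ n − 1 and assume that the global Milnor fiber F_h = {x ∈ ℂ^{N+1} : h(x) = 1} is s-connected. Let M = V ∖ W = {[x] ∈ ℙ^N(ℂ) : f_1(x) = ⋯ = f_k(x) = 0, h(x) ≠ 0}. Then M is path-connected, its fundamental group π_1(M) is cyclic of order d (isomorphic to the group μ_d of d-th roots of unity), and π_i(M, m₀) is trivial for all 2 ≤ i ≤ s and every basepoint m₀. -/

import Mathlib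

open MvPolynomial

/-- The gradient (vector of partial derivatives) of a polynomial `f` evaluated at `x`. -/
noncomputable def pgrad {N : ℕ} (f : MvPolynomial (Fin (N + 1)) ℂ) (x : Fin (N + 1) → ℂ) :
    Fin (N + 1) → ℂ :=
  fun i => eval x (pderiv i f)

/-- The quotient (euclidean) topology on projective space. -/
noncomputable instance projectivizationTopology {K V : Type*} [DivisionRing K] [AddCommGroup V]
    [Module K V] [TopologicalSpace V] : TopologicalSpace (Projectivization K V) :=
  instTopologicalSpaceQuotient

open Filter Topology

/-! ### Maps from cubes into higher-dimensional Euclidean spaces -/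

/-- Every map from `D` to `ℝ^m` can be moved off the origin by an arbitrarily small
perturbation. -/
def AvoidsZero (D : Type*) [TopologicalSpace D] (m : ℕ) : Prop :=
  ∀ a : C(D, EuclideanSpace ℝ (Fin m)), ∀ τ > 0, ∃ b : C(D, EuclideanSpace ℝ (Fin m)),
    ∀ u, ‖b u - a u‖ ≤ τ ∧ b u ≠ 0

theorem AvoidsZero.of_homeomorph {D D' : Type*} [TopologicalSpace D] [TopologicalSpace D'] {m : ℕ}
    (H : AvoidsZero D m) (e : D ≃ₜ D') : AvoidsZero D' m := by
  intro a τ hτ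
  obtain ⟨b, hb⟩ := H (a.comp (e : C(D, D'))) τ hτ
  refine ⟨b.comp (e.symm : C(D', D)), fun u => ?_⟩
  simpa using hb (e.symm u)

theorem avoidsZero_cube {i m : ℕ} (him : i < m) : AvoidsZero (Fin i → unitInterval) m := by
  intro a τ hτ
  let q : (Fin i → ℝ) → (Fin i → unitInterval) := fun x j => Set.projIcc 0 1 zero_le_one (x j)
  have hq : Continuous q := by
    refine continuous_pi fun j => ?_
    exact continuous_projIcc.comp (continuous_apply j)
  have hc : Continuous fun x => a (q x) := a.continuous.comp hq
  obtain ⟨g, hg, hga, -⟩ := hc.exists_contDiff_approx 1 (ε := fun _ => τ / 2)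
    continuous_const (fun _ => by positivity)
  have hdense := hg.dense_compl_range_of_finrank_lt_finrank (by simpa using him)
  obtain ⟨w, hw, hw'⟩ := Metric.dense_iff.1 hdense 0 (τ / 2) (by positivity)
  have hgc : Continuous g := hg.continuous
  refine ⟨⟨fun u => g (fun j => (u j : ℝ)) - w, by fun_prop⟩, fun u => ⟨?_, ?_⟩⟩
  · have h1 := hga (fun j => (u j : ℝ))
    have h2 : q (fun j => (u j : ℝ)) = u := by
      funext j
      simp [q]
    simp only [h2, dist_eq_norm] at h1
    have h3 : ‖w‖ < τ / 2 := by simpa using hw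
    calc _ = ‖(g (fun j => (u j : ℝ)) - a u) - w‖ := by
          congr 1
          simp only [ContinuousMap.coe_mk]
          abel
      _ ≤ ‖g (fun j => (u j : ℝ)) - a u‖ + ‖w‖ := norm_sub_le _ _
      _ ≤ τ := by linarith
  · intro h0
    exact hw' ⟨_, sub_eq_zero.1 h0⟩

/-- Splitting off the first coordinate of a cube. -/
def cubeConsHomeomorph (i : ℕ) :
    (Fin (i + 1) → unitInterval) ≃ₜ unitInterval × (Fin i → unitInterval) where
  toFun u := (u 0, fun j => u j.succ)
  invFun p := Fin.cons p.1 p.2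
  left_inv u := Fin.cons_self_tail u
  right_inv p := by simp
  continuous_toFun := by fun_prop
  continuous_invFun := by
    refine continuous_pi fun j => ?_
    refine Fin.cases ?_ (fun j => ?_) j
    · simpa using continuous_fst
    · simp only [Fin.cons_succ]
      fun_prop

theorem avoidsZero_interval_prod_cube {i m : ℕ} (him : i + 1 < m) :
    AvoidsZero (unitInterval × (Fin i → unitInterval)) m :=
  (avoidsZero_cube him).of_homeomorph (cubeConsHomeomorph i)

/-! ### Pushing maps down along a function -/

section Push

variable {E : Type*} [NormedAddCommGroup E] {D : Type*} [TopologicalSpace D]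

/-- Near `x₀`, every map `G : D → S` can be moved continuously inside `S` so that `Θ` decreases
(up to an arbitrarily small error `τ`) and the bound `Λ ≤ β` is preserved. -/
def LocalStep (D : Type*) [TopologicalSpace D] (S : Set E) (Θ Λ : E → ℝ) (B β : ℝ) (x₀ : E) :
    Prop :=
  ∃ ε > 0, ∃ s₁ > 0, ∃ c > 0, ∃ K > 0, ∀ τ > 0, ∀ G : C(D, E), (∀ u, G u ∈ S) → ∃ Ψ : D × ℝ → E,
    ContinuousOn Ψ {p | G p.1 ∈ Metric.ball x₀ ε ∧ p.2 ∈ Set.Icc 0 s₁} ∧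
    ∀ u, G u ∈ Metric.ball x₀ ε → ∀ σ ∈ Set.Icc 0 s₁,
      Ψ (u, σ) ∈ S ∧ dist (Ψ (u, σ)) (G u) ≤ K * σ ∧ Θ (Ψ (u, σ)) ≤ Θ (G u) + τ - c * σ ^ 2 ∧
      (Λ (G u) ≤ β → Θ (G u) + τ ≤ B → Λ (Ψ (u, σ)) ≤ β)

/-- The relation between a map `G` and a map `G'` obtained from it by a push with mask `κ`,
step size `s`, and error `τ`. -/
structure IsPush (κ : D → ℝ) (S U : Set E) (Θ Λ : E → ℝ) (B β s τ : ℝ) (G G' : C(D, E)) :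
    Prop where
  mem : ∀ u, G' u ∈ S
  dist_le : ∀ u, dist (G' u) (G u) ≤ s
  eq_of_notMem : ∀ u, G u ∉ U → G' u = G u
  eq_of_mask : ∀ u, κ u = 0 → G' u = G u
  le_add : ∀ u, Θ (G' u) ≤ Θ (G u) + τ
  bound : ∀ u, Λ (G u) ≤ β → Θ (G u) + τ ≤ B → Λ (G' u) ≤ β

theorem LocalStep.exists_isPush {S U : Set E} {Θ Λ : E → ℝ} {B β : ℝ} {x₀ : E}
    (H : LocalStep D S Θ Λ B β x₀) (hU : U ∈ nhds x₀) {κ : D → ℝ} (hκ : Continuous κ)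
    (hκ01 : ∀ u, κ u ∈ Set.Icc (0 : ℝ) 1) :
    ∃ l > 0, ∃ s₁ > 0, ∀ s, 0 < s → s ≤ s₁ → ∃ ω > 0, ∀ τ > 0, ∀ G : C(D, E), (∀ u, G u ∈ S) →
      ∃ G', IsPush κ S U Θ Λ B β s τ G G' ∧
        ∀ u, dist (G u) x₀ < l → κ u = 1 → Θ (G' u) ≤ Θ (G u) + τ - ω := by
  obtain ⟨ε, hε, s₁, hs₁, c, hc, K, hK, H⟩ := H
  obtain ⟨η, hη, hηU⟩ := Metric.mem_nhds_iff.1 hU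
  set l := min ε η / 3 with hl
  have hmin : 0 < min ε η := lt_min hε hη
  have hl0 : 0 < l := by positivity
  have hlε : 2 * l < ε := by
    have := min_le_left ε η
    linarith
  have hlη : 2 * l < η := by
    have := min_le_right ε η
    linarith
  refine ⟨l, hl0, K * s₁, by positivity, fun s' hs' hss' => ?_⟩
  obtain ⟨s, rfl⟩ : ∃ s, s' = K * s := ⟨s' / K, by field_simp⟩
  have hs : 0 < s := pos_of_mul_pos_right hs' hK.le
  have hss : s ≤ s₁ := le_of_mul_le_mul_left hss' hK
  refine ⟨c * s ^ 2, by positivity, fun τ hτ G hG => ?_⟩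
  obtain ⟨Ψ, hΨc, hΨ⟩ := H τ hτ G hG
  let χ : D → ℝ := fun u => max 0 (min 1 (2 - dist (G u) x₀ / l))
  have hχc : Continuous χ := by fun_prop
  have hχ0 : ∀ u, 0 ≤ χ u := fun u => le_max_left _ _
  have hχ1 : ∀ u, χ u ≤ 1 := fun u => max_le zero_le_one (min_le_left _ _)
  have hχout : ∀ u, 2 * l ≤ dist (G u) x₀ → χ u = 0 := by
    intro u hu
    refine max_eq_left ((min_le_right _ _).trans ?_)
    have : 2 ≤ dist (G u) x₀ / l := by rwa [le_div_iff₀ hl0]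
    linarith
  have hχin : ∀ u, dist (G u) x₀ < l → χ u = 1 := by
    intro u hu
    have : dist (G u) x₀ / l ≤ 1 := by
      rw [div_le_one hl0]
      exact hu.le
    have h2 : min 1 (2 - dist (G u) x₀ / l) = 1 := min_eq_left (by linarith)
    simp only [χ, h2]
    exact max_eq_right zero_le_one
  let σ : D → ℝ := fun u => κ u * χ u * s
  have hσc : Continuous σ := by fun_prop
  have hσ : ∀ u, σ u ∈ Set.Icc 0 s := by
    intro u
    have h1 := hκ01 u
    have h2 : 0 ≤ κ u * χ u := mul_nonneg h1.1 (hχ0 u)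
    have h3 : κ u * χ u ≤ 1 := mul_le_one₀ h1.2 (hχ0 u) (hχ1 u)
    exact ⟨mul_nonneg h2 hs.le, by simpa using mul_le_mul_of_nonneg_right h3 hs.le⟩
  have hσ' : ∀ u, σ u ∈ Set.Icc 0 s₁ := fun u => ⟨(hσ u).1, (hσ u).2.trans hss⟩
  classical
  let g : D → E := fun u => if dist (G u) x₀ < ε then Ψ (u, σ u) else G u
  have hgin : ∀ u, dist (G u) x₀ < ε → g u = Ψ (u, σ u) := fun u hu => if_pos hu
  have hgσ : ∀ u, σ u = 0 → g u = G u := by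
    intro u hu
    by_cases h : dist (G u) x₀ < ε
    · have := (hΨ u h (σ u) (hσ' u)).2.1
      rw [hgin u h]
      rw [hu, mul_zero] at this
      rw [hu]
      exact dist_le_zero.1 this
    · exact if_neg h
  have hgout : ∀ u, 2 * l ≤ dist (G u) x₀ → g u = G u := fun u hu =>
    hgσ u (by simp [σ, hχout u hu])
  have hgc : Continuous g := by
    rw [continuous_iff_continuousAt]
    intro u
    by_cases h : dist (G u) x₀ < ε
    · have hopen : IsOpen {u | dist (G u) x₀ < ε} :=
        isOpen_lt (by fun_prop) continuous_const
      have hcont : ContinuousOn (fun u => Ψ (u, σ u)) {u | dist (G u) x₀ < ε} := by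
        refine hΨc.comp (f := fun u => (u, σ u)) (by fun_prop) ?_
        intro v hv
        exact ⟨hv, hσ' v⟩
      refine (hcont.continuousAt (hopen.mem_nhds h)).congr ?_
      filter_upwards [hopen.mem_nhds h] with v hv using (hgin v hv).symm
    · have hopen : IsOpen {u | 2 * l < dist (G u) x₀} :=
        isOpen_lt continuous_const (by fun_prop)
      have hmem : u ∈ {u | 2 * l < dist (G u) x₀} := lt_of_lt_of_le hlε (not_lt.1 h)
      refine G.continuous.continuousAt.congr ?_
      filter_upwards [hopen.mem_nhds hmem] with v hv using (hgout v hv.le).symm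
  have key : ∀ u, g u ∈ S ∧ dist (g u) (G u) ≤ K * s ∧ Θ (g u) ≤ Θ (G u) + τ ∧
      (Λ (G u) ≤ β → Θ (G u) + τ ≤ B → Λ (g u) ≤ β) := by
    intro u
    by_cases h : dist (G u) x₀ < ε
    · obtain ⟨h1, h2, h3, h4⟩ := hΨ u h (σ u) (hσ' u)
      rw [hgin u h]
      refine ⟨h1, h2.trans (mul_le_mul_of_nonneg_left (hσ u).2 hK.le), h3.trans ?_, h4⟩
      have : 0 ≤ c * σ u ^ 2 := by positivity
      linarith
    · rw [hgout u (hlε.le.trans (not_lt.1 h))]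
      exact ⟨hG u, by simpa using hs'.le, by linarith, fun h _ => h⟩
  refine ⟨⟨g, hgc⟩, ⟨fun u => (key u).1, fun u => (key u).2.1, fun u hu => ?_, fun u hu => ?_,
    fun u => (key u).2.2.1, fun u => (key u).2.2.2⟩, fun u hu hκu => ?_⟩
  · refine hgout u (not_lt.1 fun h => hu (hηU ?_))
    exact h.trans hlη
  · exact hgσ u (by simp [σ, hu])
  · have hlt : dist (G u) x₀ < ε := by linarith
    have hσu : σ u = s := by simp [σ, hχin u hu, hκu]
    have := (hΨ u hlt (σ u) (hσ' u)).2.2.1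
    rw [← hgin u hlt] at this
    simpa [hσu] using this

theorem exists_isPush_finset {S U : Set E} {Θ Λ : E → ℝ} {B β s ω : ℝ} {κ : D → ℝ} (hs : 0 ≤ s)
    (l : E → ℝ) (t : Finset E)
    (H : ∀ x ∈ t, ∀ τ > 0, ∀ G : C(D, E), (∀ u, G u ∈ S) →
      ∃ G', IsPush κ S U Θ Λ B β s τ G G' ∧
        ∀ u, dist (G u) x < l x → κ u = 1 → Θ (G' u) ≤ Θ (G u) + τ - ω)
    {τ : ℝ} (hτ : 0 < τ) (G : C(D, E)) (hG : ∀ u, G u ∈ S) :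
    ∃ G', IsPush κ S U Θ Λ B β (t.card * s) (t.card * τ) G G' ∧
      ∀ x ∈ t, ∀ u, dist (G u) x < l x - t.card * s → κ u = 1 →
        Θ (G' u) ≤ Θ (G u) + t.card * τ - ω := by
  classical
  induction t using Finset.induction_on generalizing G with
  | empty =>
    exact ⟨G, ⟨hG, by simp, fun _ _ => rfl, fun _ _ => rfl, by simp, fun _ h _ => h⟩, by simp⟩
  | insert x t hx ih =>
    obtain ⟨G₁, P₁, h₁⟩ := H x (Finset.mem_insert_self x t) τ hτ G hG
    obtain ⟨G₂, P₂, h₂⟩ := ih (fun y hy => H y (Finset.mem_insert_of_mem hy)) G₁ P₁.mem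
    have hcard : ((insert x t).card : ℝ) = t.card + 1 := by
      rw [Finset.card_insert_of_notMem hx]
      push_cast
      ring
    have htτ : 0 ≤ (t.card : ℝ) * τ := by positivity
    have hts : 0 ≤ (t.card : ℝ) * s := by positivity
    rw [hcard]
    refine ⟨G₂, ⟨P₂.mem, fun u => ?_, fun u hu => ?_, fun u hu => ?_, fun u => ?_,
      fun u hu hB => ?_⟩, fun y hy u hu hκ => ?_⟩
    · have := dist_triangle (G₂ u) (G₁ u) (G u)
      have := P₁.dist_le u
      have := P₂.dist_le u
      linarith
    · have := P₁.eq_of_notMem u hu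
      rw [P₂.eq_of_notMem u (by rwa [this]), this]
    · rw [P₂.eq_of_mask u hu, P₁.eq_of_mask u hu]
    · have := P₁.le_add u
      have := P₂.le_add u
      linarith
    · have := P₁.le_add u
      exact P₂.bound u (P₁.bound u hu (by linarith)) (by linarith)
    · rcases Finset.mem_insert.1 hy with rfl | hy
      · have := h₁ u (by linarith) hκ
        have := P₂.le_add u
        linarith
      · have h3 := dist_triangle (G₁ u) (G u) y
        have := P₁.dist_le u
        have := h₂ y hy u (by linarith) hκ
        have := P₁.le_add u
        linarith

theorem exists_isPush_compact {S U C : Set E} {Θ Λ : E → ℝ} {B β : ℝ} (hU : IsOpen U)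
    (hC : IsCompact C) (hCU : C ⊆ U) (H : ∀ x ∈ C, LocalStep D S Θ Λ B β x)
    {κ : D → ℝ} (hκ : Continuous κ) (hκ01 : ∀ u, κ u ∈ Set.Icc (0 : ℝ) 1) :
    ∃ r, ∃ ω > 0, ∀ τ > 0, ∀ G : C(D, E), (∀ u, G u ∈ S) →
      ∃ G', IsPush κ S U Θ Λ B β r τ G G' ∧
        ∀ u, G u ∈ C → κ u = 1 → Θ (G' u) ≤ Θ (G u) + τ - ω := by
  classical
  have H' := fun x (hx : x ∈ C) => (H x hx).exists_isPush (hU.mem_nhds (hCU hx)) hκ hκ01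
  choose! l hl s₁ hs₁ H' using H'
  obtain ⟨t, htC, htcov⟩ := hC.elim_nhds_subcover (fun x => Metric.ball x (l x / 2))
    (fun x hx => Metric.ball_mem_nhds x (half_pos (hl x hx)))
  obtain ⟨s, hs, hss⟩ : ∃ s > 0, ∀ x ∈ t, s ≤ s₁ x ∧ s ≤ l x / (2 * (t.card + 1)) := by
    have : ∀ᶠ s in nhdsWithin (0 : ℝ) (Set.Ioi 0), ∀ x ∈ t,
        s ≤ s₁ x ∧ s ≤ l x / (2 * (t.card + 1)) := by
      rw [Filter.eventually_all_finset]
      intro x hx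
      have h1 := hs₁ x (htC x hx)
      have h2 : 0 < l x / (2 * (t.card + 1)) := div_pos (hl x (htC x hx)) (by positivity)
      exact nhdsWithin_le_nhds (Filter.inter_mem (Iic_mem_nhds h1) (Iic_mem_nhds h2))
    obtain ⟨s, hs⟩ := (this.and self_mem_nhdsWithin).exists
    exact ⟨s, hs.2, hs.1⟩
  have H'' := fun x (hx : x ∈ t) => H' x (htC x hx) s hs (hss x hx).1
  choose! w hw H'' using H''
  obtain ⟨ω, hω, hωw⟩ : ∃ ω > 0, ∀ x ∈ t, ω ≤ w x := by
    have : ∀ᶠ s in nhdsWithin (0 : ℝ) (Set.Ioi 0), ∀ x ∈ t, s ≤ w x := by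
      rw [Filter.eventually_all_finset]
      intro x hx
      exact nhdsWithin_le_nhds (Iic_mem_nhds (hw x hx))
    obtain ⟨s, hs⟩ := (this.and self_mem_nhdsWithin).exists
    exact ⟨s, hs.2, hs.1⟩
  refine ⟨t.card * s, ω, hω, fun τ hτ G hG => ?_⟩
  have hτ' : 0 < τ / (t.card + 1) := by positivity
  have hτle : t.card * (τ / (t.card + 1)) ≤ τ := by
    rw [mul_div_assoc', div_le_iff₀ (by positivity)]
    nlinarith
  obtain ⟨G', P, h⟩ := exists_isPush_finset (ω := ω) hs.le l t (fun x hx τ hτ G hG => by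
    obtain ⟨G', P, h⟩ := H'' x hx τ hτ G hG
    exact ⟨G', P, fun u hu hκ => (h u hu hκ).trans (by linarith [hωw x hx])⟩) hτ' G hG
  refine ⟨G', ⟨P.mem, P.dist_le, P.eq_of_notMem, P.eq_of_mask, fun u => (P.le_add u).trans
    (by linarith), fun u hu hB => P.bound u hu (by linarith)⟩, fun u hu hκ => ?_⟩
  obtain ⟨x, hx, hux⟩ := Set.mem_iUnion₂.1 (htcov hu)
  have h1 : t.card * s ≤ l x / 2 := by
    have h2 := (hss x hx).2
    rw [le_div_iff₀ (by positivity)] at h2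
    nlinarith
  have hux' : dist (G u) x < l x / 2 := hux
  have := h x hx u (by linarith) hκ
  linarith

/-- Iterated pushing: a map into `{Θ ≤ b, Λ ≤ β}` is moved into `{Θ ≤ a}` where the mask is `1`. -/
theorem exists_push_below {S U C : Set E} {Θ Λ : E → ℝ} {a b B β δ : ℝ} (hU : IsOpen U)
    (hC : IsCompact C) (hCU : C ⊆ U) (H : ∀ x ∈ C, LocalStep D S Θ Λ B β x)
    (hCS : ∀ x ∈ S, a ≤ Θ x → Θ x ≤ b + δ → Λ x ≤ β → x ∈ C) (hδ : 0 < δ) (hB : b + δ ≤ B)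
    {κ : D → ℝ} (hκ : Continuous κ) (hκ01 : ∀ u, κ u ∈ Set.Icc (0 : ℝ) 1)
    (G : C(D, E)) (hG : ∀ u, G u ∈ S) (hGb : ∀ u, Θ (G u) ≤ b) (hGβ : ∀ u, Λ (G u) ≤ β) :
    ∃ G' : C(D, E), (∀ u, G' u ∈ S) ∧ (∀ u, G u ∉ U → G' u = G u) ∧
      (∀ u, κ u = 0 → G' u = G u) ∧ (∀ u, Θ (G' u) ≤ Θ (G u) + δ) ∧
      (∀ u, κ u = 1 → Θ (G' u) ≤ a + δ) ∧ ∀ u, Λ (G' u) ≤ β := by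
  obtain ⟨r, ω, hω, H⟩ := exists_isPush_compact hU hC hCU H hκ hκ01
  obtain ⟨J, hJ⟩ := exists_nat_gt ((b - a) / ω)
  have hJ0 : (0 : ℝ) < J + 1 := by positivity
  set τ := δ / (J + 1) with hτdef
  have hτ : 0 < τ := by positivity
  have hJτ : (J : ℝ) * τ ≤ δ := by
    rw [hτdef, mul_div_assoc', div_le_iff₀ hJ0]
    nlinarith
  have main : ∀ j : ℕ, j ≤ J → ∃ G' : C(D, E), (∀ u, G' u ∈ S) ∧ (∀ u, G u ∉ U → G' u = G u) ∧
      (∀ u, κ u = 0 → G' u = G u) ∧ (∀ u, Θ (G' u) ≤ Θ (G u) + j * τ) ∧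
      (∀ u, κ u = 1 → Θ (G' u) ≤ max (b - j * ω) a + j * τ) ∧ ∀ u, Λ (G' u) ≤ β := by
    intro j
    induction j with
    | zero => exact fun _ => ⟨G, hG, fun _ _ => rfl, fun _ _ => rfl, by simp,
        fun u _ => by simpa using Or.inl (hGb u), hGβ⟩
    | succ j ih =>
      intro hj
      obtain ⟨G₁, h1, h2, h3, h4, h5, h6⟩ := ih (by omega)
      obtain ⟨G₂, P, h⟩ := H τ hτ G₁ h1
      have hjJ : ((j : ℝ) + 1) * τ ≤ δ := by
        have : ((j + 1 : ℕ) : ℝ) ≤ J := by exact_mod_cast hj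
        push_cast at this
        nlinarith
      have hjb : ∀ u, Θ (G₁ u) + τ ≤ b + δ := fun u => by
        have := h4 u
        have := hGb u
        linarith
      refine ⟨G₂, P.mem, fun u hu => ?_, fun u hu => ?_, fun u => ?_, fun u hu => ?_, fun u => ?_⟩
      · rw [P.eq_of_notMem u (by rwa [h2 u hu]), h2 u hu]
      · rw [P.eq_of_mask u hu, h3 u hu]
      · have := P.le_add u
        have := h4 u
        push_cast
        linarith
      · push_cast
        by_cases ha : a ≤ Θ (G₁ u)
        · have h7 := h u (hCS _ (h1 u) ha (by linarith [hjb u]) (h6 u)) hu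
          have h8 := h5 u hu
          rcases le_total (b - j * ω) a with h9 | h9
          · rw [max_eq_right h9] at h8
            have := le_max_right (b - (j + 1) * ω) a
            linarith
          · rw [max_eq_left h9] at h8
            have := le_max_left (b - (j + 1) * ω) a
            linarith
        · have h7 := P.le_add u
          have := le_max_right (b - (j + 1) * ω) a
          have : 0 ≤ j * τ := by positivity
          linarith
      · exact P.bound u (h6 u) ((hjb u).trans hB)
  obtain ⟨G', h1, h2, h3, h4, h5, h6⟩ := main J le_rfl
  refine ⟨G', h1, h2, h3, fun u => ?_, fun u hu => ?_, h6⟩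
  · have := h4 u
    linarith
  · have h7 := h5 u hu
    rw [max_eq_right] at h7
    · linarith
    · rw [div_lt_iff₀ hω] at hJ
      linarith

end Push

/-! ### Local steps from first and second order information -/

section Steps

variable {E : Type*} [NormedAddCommGroup E] [NormedSpace ℝ E]

/-- `r` is a retraction onto `S` near `x₀`, with strict derivative `R` at `x₀`. -/
structure IsLocalRetraction (S : Set E) (r : E → E) (R : E →L[ℝ] E) (x₀ : E) : Prop where
  hasStrictFDerivAt : HasStrictFDerivAt r R x₀
  continuousAt : ∀ᶠ y in 𝓝 x₀, ContinuousAt r y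
  mem : ∀ᶠ y in 𝓝 x₀, r y ∈ S
  eq_self : ∀ᶠ y in 𝓝 x₀, y ∈ S → r y = y

theorem HasStrictFDerivAt.exists_descent {g : E → ℝ} {T : E →L[ℝ] ℝ} {x₀ v : E}
    (hg : HasStrictFDerivAt g T x₀) (hv : T v < 0) :
    ∃ c > 0, ∃ ε > 0, ∃ s > 0, ∀ y ∈ Metric.ball x₀ ε, ∀ σ ∈ Set.Icc 0 s,
      g (y + σ • v) ≤ g y - c * σ := by
  have hc : 0 < -T v / (2 * (‖v‖ + 1)) := by
    have := norm_nonneg v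
    apply div_pos <;> linarith
  have h1 := hg.isLittleO.def hc
  have h2 : Tendsto (fun p : E × ℝ => (p.1 + p.2 • v, p.1)) (𝓝 (x₀, 0)) (𝓝 (x₀, x₀)) := by
    have : Continuous fun p : E × ℝ => (p.1 + p.2 • v, p.1) := by fun_prop
    simpa using this.tendsto (x₀, 0)
  obtain ⟨ε, hε, h3⟩ := Metric.eventually_nhds_iff.1 (h2.eventually h1)
  refine ⟨-T v / 2, by linarith, ε, hε, ε / 2, by positivity, fun y hy σ hσ => ?_⟩
  have h4 := @h3 (y, σ) (by
    rw [Prod.dist_eq, max_lt_iff]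
    refine ⟨hy, ?_⟩
    rw [Real.dist_eq, sub_zero, abs_of_nonneg hσ.1]
    linarith [hσ.2])
  simp only [add_sub_cancel_left, map_smul, smul_eq_mul, norm_smul, Real.norm_eq_abs,
    abs_of_nonneg hσ.1] at h4
  have h5 : -T v / (2 * (‖v‖ + 1)) * (σ * ‖v‖) ≤ -T v / 2 * σ := by
    have h6 : -T v / (2 * (‖v‖ + 1)) * (σ * ‖v‖) =
        -T v / 2 * σ * (‖v‖ / (‖v‖ + 1)) := by
      field_simp
    rw [h6]
    refine mul_le_of_le_one_right (mul_nonneg (by linarith) hσ.1) ?_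
    rw [div_le_one (by positivity)]
    linarith
  have h7 := (abs_le.1 (h4.trans h5)).2
  linarith

theorem IsLocalRetraction.exists_lipschitz {S : Set E} {r : E → E} {R : E →L[ℝ] E} {x₀ : E}
    (hr : IsLocalRetraction S r R x₀) : ∃ K > 0, ∃ ε > 0, ∀ y ∈ Metric.ball x₀ ε, y ∈ S →
      ∀ w, ‖w‖ < ε → ContinuousAt r (y + w) ∧ r (y + w) ∈ S ∧ r y = y ∧
        dist (r (y + w)) y ≤ K * ‖w‖ := by
  obtain ⟨K, s, hs, hK⟩ := hr.hasStrictFDerivAt.exists_lipschitzOnWith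
  have hev : ∀ᶠ y in 𝓝 x₀, ContinuousAt r y ∧ r y ∈ S ∧ (y ∈ S → r y = y) ∧ y ∈ s :=
    hr.continuousAt.and (hr.mem.and (hr.eq_self.and hs))
  obtain ⟨ε, hε, h⟩ := Metric.eventually_nhds_iff.1 hev
  refine ⟨K + 1, by positivity, ε / 2, by positivity, fun y hy hyS w hw => ?_⟩
  rw [Metric.mem_ball] at hy
  have hyw : dist (y + w) x₀ < ε := by
    have := dist_triangle (y + w) y x₀
    have : dist (y + w) y = ‖w‖ := by simp [dist_eq_norm]
    linarith
  obtain ⟨h1, h2, -, h4⟩ := h hyw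
  obtain ⟨-, -, h5, h6⟩ := @h y (by linarith)
  refine ⟨h1, h2, h5 hyS, ?_⟩
  have h7 := hK.dist_le_mul _ h4 _ h6
  rw [h5 hyS] at h7
  have h8 : dist (y + w) y = ‖w‖ := by simp [dist_eq_norm]
  rw [h8] at h7
  have := norm_nonneg w
  linarith

theorem localStep_of_deriv_neg {D : Type*} [TopologicalSpace D] {S : Set E} {Θ Λ : E → ℝ}
    {x₀ v : E} {r : E → E} {R : E →L[ℝ] E} (hr : IsLocalRetraction S r R x₀)
    {T T' : E →L[ℝ] ℝ} (hT : HasStrictFDerivAt (Θ ∘ r) T x₀)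
    (hT' : HasStrictFDerivAt (Λ ∘ r) T' x₀) (hv : T v < 0) (hv' : T' v < 0) (B β : ℝ) :
    LocalStep D S Θ Λ B β x₀ := by
  obtain ⟨K, hK, ε₁, hε₁, h1⟩ := hr.exists_lipschitz
  obtain ⟨c, hc, ε₂, hε₂, s₂, hs₂, h2⟩ := hT.exists_descent hv
  obtain ⟨c', hc', ε₃, hε₃, s₃, hs₃, h3⟩ := hT'.exists_descent hv'
  set s := min (min s₂ s₃) (min 1 (ε₁ / (2 * (‖v‖ + 1)))) with hs
  have hs0 : 0 < s := by positivity
  refine ⟨min ε₁ (min ε₂ ε₃), by positivity, s, hs0, c, hc, K * (‖v‖ + 1), by positivity,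
    fun τ hτ G hG => ?_⟩
  have hsub : ∀ u, G u ∈ Metric.ball x₀ (min ε₁ (min ε₂ ε₃)) → ∀ σ ∈ Set.Icc 0 s,
      G u ∈ Metric.ball x₀ ε₁ ∧ G u ∈ Metric.ball x₀ ε₂ ∧ G u ∈ Metric.ball x₀ ε₃ ∧
      σ ∈ Set.Icc 0 s₂ ∧ σ ∈ Set.Icc 0 s₃ ∧ σ ≤ 1 ∧ ‖σ • v‖ < ε₁ := by
    intro u hu σ hσ
    simp only [Metric.mem_ball, lt_min_iff] at hu
    have h4 := hσ.2
    simp only [hs, le_min_iff] at h4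
    refine ⟨hu.1, hu.2.1, hu.2.2, ⟨hσ.1, h4.1.1⟩, ⟨hσ.1, h4.1.2⟩, h4.2.1, ?_⟩
    rw [norm_smul, Real.norm_eq_abs, abs_of_nonneg hσ.1]
    have h5 := h4.2.2
    rw [le_div_iff₀ (by positivity)] at h5
    nlinarith [norm_nonneg v, hσ.1]
  refine ⟨fun p => r (G p.1 + p.2 • v), ?_, fun u hu σ hσ => ?_⟩
  · intro p hp
    obtain ⟨h4, -, -, -, -, -, h5⟩ := hsub p.1 hp.1 p.2 hp.2
    have h6 := (h1 _ h4 (hG _) _ h5).1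
    have h7 : ContinuousAt (fun p : D × ℝ => G p.1 + p.2 • v) p := by fun_prop
    exact (ContinuousAt.comp_of_eq h6 h7 rfl).continuousWithinAt
  · obtain ⟨h4, h5, h6, h7, h8, h9, h10⟩ := hsub u hu σ hσ
    obtain ⟨-, h11, h12, h13⟩ := h1 _ h4 (hG u) _ h10
    refine ⟨h11, h13.trans ?_, ?_, fun hβ _ => ?_⟩
    · rw [norm_smul, Real.norm_eq_abs, abs_of_nonneg hσ.1]
      nlinarith [norm_nonneg v, hσ.1, mul_nonneg hK.le hσ.1]
    · have h14 := h2 _ h5 σ h7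
      simp only [Function.comp_apply, h12] at h14
      have : c * σ ^ 2 ≤ c * σ := by
        refine mul_le_mul_of_nonneg_left ?_ hc.le
        nlinarith [hσ.1]
      linarith
    · have h14 := h3 _ h6 σ h8
      simp only [Function.comp_apply, h12] at h14
      have := mul_nonneg hc'.le hσ.1
      linarith

theorem exp_step_le {M t c σ τ : ℝ} (hM : 0 ≤ M) (hc : 0 ≤ c) (hc1 : c ≤ 1) (hσ : 0 ≤ σ)
    (hσ1 : σ ≤ 1) (ht : t ≤ σ * τ - c * σ ^ 2) (hτ : 0 ≤ τ) (hτ1 : τ ≤ 1) :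
    M * Real.exp t ≤ M + 2 * M * τ - M * (c / 2) * σ ^ 2 := by
  have h1 : Real.exp t ≤ Real.exp τ * Real.exp (-(c * σ ^ 2)) := by
    rw [← Real.exp_add]
    exact Real.exp_le_exp.2 (by nlinarith)
  have h2 : Real.exp τ ≤ 1 + 2 * τ := by
    have := Real.abs_exp_sub_one_le (x := τ) (by rwa [abs_of_nonneg hτ])
    rw [abs_of_nonneg hτ] at this
    linarith [(abs_le.1 this).2]
  have hσ2 : σ ^ 2 ≤ 1 := by nlinarith
  have hx0 : 0 ≤ c * σ ^ 2 := by positivity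
  have hx1 : c * σ ^ 2 ≤ 1 := by nlinarith [sq_nonneg σ]
  have h3 : Real.exp (-(c * σ ^ 2)) ≤ 1 - c * σ ^ 2 / 2 := by
    have h5 : (1 - c * σ ^ 2 / 2) * Real.exp (c * σ ^ 2) ≥ 1 := by
      have := Real.add_one_le_exp (c * σ ^ 2)
      nlinarith
    rw [Real.exp_neg]
    rwa [inv_le_iff_one_le_mul₀ (Real.exp_pos _)]
  have h4 : Real.exp t ≤ (1 + 2 * τ) * (1 - c * σ ^ 2 / 2) :=
    h1.trans (mul_le_mul h2 h3 (Real.exp_pos _).le (by linarith))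
  have h6 : (1 + 2 * τ) * (1 - c * σ ^ 2 / 2) ≤ 1 + 2 * τ - c * σ ^ 2 / 2 := by
    nlinarith [mul_nonneg hτ hx0]
  have h7 := mul_le_mul_of_nonneg_left (h4.trans h6) hM
  linarith

theorem localStep_of_concave {D : Type*} [TopologicalSpace D] [NormalSpace D] {m : ℕ}
    (hD : AvoidsZero D m) {S : Set E} {Θ Λ ψ : E → ℝ} {B β : ℝ}
    {x₀ : E} {r : E → E} {R : E →L[ℝ] E} (hr : IsLocalRetraction S r R x₀)
    (L : EuclideanSpace ℝ (Fin m) →L[ℝ] E) (A : E → E →L[ℝ] ℝ)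
    (hA : ∀ᶠ y in 𝓝 x₀, ContinuousAt A y) (hψ : ContinuousAt ψ x₀)
    (hΘ : ∀ᶠ y in 𝓝 x₀, y ∈ S → Θ y = Real.exp (ψ y))
    (hΛ : ∀ᶠ y in 𝓝 x₀, y ∈ S → Θ y ≤ B → Λ y ≤ β) {c s₁ : ℝ} (hc : 0 < c) (hs₁ : 0 < s₁)
    (hcon : ∀ᶠ y in 𝓝 x₀, y ∈ S → ∀ e : EuclideanSpace ℝ (Fin m), ‖e‖ = 1 → ∀ σ ∈ Set.Icc 0 s₁,
      ψ (r (y + σ • L e)) ≤ ψ y + σ * A y (L e) - c * σ ^ 2) :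
    LocalStep D S Θ Λ B β x₀ := by
  obtain ⟨K, hK, ε₁, hε₁, h1⟩ := hr.exists_lipschitz
  have hψb : ∀ᶠ y in 𝓝 x₀, ψ y < ψ x₀ + 1 ∧ ψ x₀ - 1 < ψ y :=
    (hψ.eventually_lt_const (by linarith)).and (hψ.eventually_const_lt (by linarith))
  obtain ⟨ε₂, hε₂, h2⟩ := Metric.eventually_nhds_iff.1
    (hA.and (hψb.and (hΘ.and (hΛ.and hcon))))
  set ε := min ε₁ (ε₂ / 2) with hε
  have hε0 : 0 < ε := by positivity
  set ν := ‖L‖ + 1 with hν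
  have hν0 : 0 < ν := by positivity
  set s := min (min s₁ 1) (min (ε₁ / (2 * ν)) (ε₂ / (4 * (K * ν)))) with hs
  have hs0 : 0 < s := by positivity
  set c₁ := min c 1 with hc₁
  have hc₁0 : 0 < c₁ := by positivity
  refine ⟨ε, hε0, s, hs0, Real.exp (ψ x₀ - 1) * (c₁ / 2), by positivity, K * ν, by positivity,
    fun τ hτ G hG => ?_⟩
  -- the gradient along `L`
  let a₀ : E → EuclideanSpace ℝ (Fin m) := fun y =>
    (InnerProductSpace.toDual ℝ (EuclideanSpace ℝ (Fin m))).symm ((A y).comp L)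
  have ha₀ : ∀ y e, inner ℝ (a₀ y) e = A y (L e) := fun y e => by simp [a₀]
  have ha₀c : ∀ y, dist y x₀ < ε₂ → ContinuousAt a₀ y := by
    intro y hy
    have h3 : ContinuousAt A y := (h2 hy).1
    have h4 : ContinuousAt (fun y => (A y).comp L) y := by fun_prop
    exact (LinearIsometryEquiv.continuous _).continuousAt.comp h4
  obtain ⟨a, ha⟩ : ∃ a : C(D, EuclideanSpace ℝ (Fin m)), ∀ u, dist (G u) x₀ ≤ ε →
      a u = a₀ (G u) := by
    let Z : Set D := {u | dist (G u) x₀ ≤ ε}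
    have hZ : IsClosed Z := isClosed_le (by fun_prop) continuous_const
    let a₁ : C(Z, EuclideanSpace ℝ (Fin m)) := ⟨fun u => a₀ (G u), by
      rw [continuous_iff_continuousAt]
      intro u
      have h3 : dist (G u) x₀ < ε₂ := by
        have h4 : dist (G u) x₀ ≤ ε := u.2
        have := min_le_right ε₁ (ε₂ / 2)
        linarith
      have h4 : ContinuousAt (fun u : Z => G u) u := by fun_prop
      exact ContinuousAt.comp (g := a₀) (ha₀c _ h3) h4⟩
    obtain ⟨a, ha⟩ := a₁.exists_restrict_eq hZ
    refine ⟨a, fun u hu => ?_⟩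
    exact DFunLike.congr_fun ha ⟨u, hu⟩
  set M := Real.exp (ψ x₀ + 1) with hM
  have hM0 : 0 < M := Real.exp_pos _
  set τ' := min 1 (τ / (2 * M)) with hτ'
  have hτ'0 : 0 < τ' := by positivity
  have hτ'M : 2 * M * τ' ≤ τ := by
    have := min_le_right 1 (τ / (2 * M))
    rw [← hτ', le_div_iff₀ (by positivity)] at this
    linarith
  obtain ⟨b, hb⟩ := hD a τ' hτ'0
  let e : D → EuclideanSpace ℝ (Fin m) := fun u => -(‖b u‖⁻¹ • b u)
  have hec : Continuous e := by
    have : ∀ u, ‖b u‖ ≠ 0 := fun u => norm_ne_zero_iff.2 (hb u).2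
    fun_prop (disch := assumption)
  have he1 : ∀ u, ‖e u‖ = 1 := by
    intro u
    have : ‖b u‖ ≠ 0 := norm_ne_zero_iff.2 (hb u).2
    simp [e, norm_smul, this]
  have hea : ∀ u, inner ℝ (a u) (e u) ≤ τ' := by
    intro u
    have h3 : inner ℝ (b u) (e u) = -‖b u‖ := by
      have : ‖b u‖ ≠ 0 := norm_ne_zero_iff.2 (hb u).2
      simp only [e, inner_neg_right, inner_smul_right, real_inner_self_eq_norm_sq]
      field_simp
    have h4 : inner ℝ (a u - b u) (e u) ≤ τ' := by
      refine (real_inner_le_norm _ _).trans ?_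
      rw [he1, mul_one, norm_sub_rev]
      exact (hb u).1
    rw [inner_sub_left] at h4
    have := norm_nonneg (b u)
    linarith
  have hsub : ∀ u, G u ∈ Metric.ball x₀ ε → ∀ σ ∈ Set.Icc 0 s,
      G u ∈ Metric.ball x₀ ε₁ ∧ dist (G u) x₀ < ε₂ / 2 ∧ σ ≤ s₁ ∧ σ ≤ 1 ∧
      ‖σ • L (e u)‖ ≤ σ * ν ∧ ‖σ • L (e u)‖ < ε₁ ∧ K * ‖σ • L (e u)‖ < ε₂ / 2 := by
    intro u hu σ hσ
    simp only [Metric.mem_ball, hε, lt_min_iff] at hu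
    have h4 := hσ.2
    simp only [hs, le_min_iff] at h4
    have h6 : ‖σ • L (e u)‖ ≤ σ * ν := by
      rw [norm_smul, Real.norm_eq_abs, abs_of_nonneg hσ.1]
      refine mul_le_mul_of_nonneg_left ?_ hσ.1
      have := L.le_opNorm (e u)
      rw [he1, mul_one] at this
      linarith
    have h7 := h4.2.1
    have h8 := h4.2.2
    rw [le_div_iff₀ (by positivity)] at h7 h8
    refine ⟨hu.1, hu.2, h4.1.1, h4.1.2, h6, by linarith, ?_⟩
    have := mul_le_mul_of_nonneg_left h6 hK.le
    nlinarith
  refine ⟨fun p => r (G p.1 + p.2 • L (e p.1)), ?_, fun u hu σ hσ => ?_⟩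
  · intro p hp
    obtain ⟨h4, -, -, -, -, h5, -⟩ := hsub p.1 hp.1 p.2 hp.2
    have h6 := (h1 _ h4 (hG _) _ h5).1
    have h7 : ContinuousAt (fun p : D × ℝ => G p.1 + p.2 • L (e p.1)) p := by fun_prop
    exact (ContinuousAt.comp_of_eq h6 h7 rfl).continuousWithinAt
  · obtain ⟨h4, h5, h6, h7, h8, h9, h10⟩ := hsub u hu σ hσ
    obtain ⟨-, h11, h12, h13⟩ := h1 _ h4 (hG u) _ h9
    obtain ⟨-, ⟨h14, h15⟩, h16, -, h17⟩ := @h2 (G u) (by linarith)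
    obtain ⟨-, -, h18, h19, -⟩ := @h2 (r (G u + σ • L (e u))) (by
      have := dist_triangle (r (G u + σ • L (e u))) (G u) x₀
      linarith)
    have h20 := h17 (hG u) (e u) (he1 u) σ ⟨hσ.1, h6⟩
    have h21 : A (G u) (L (e u)) ≤ τ' := by
      rw [← ha₀, ← ha u (Metric.mem_ball.1 hu).le]
      exact hea u
    have hΘle : Θ (r (G u + σ • L (e u))) ≤
        Θ (G u) + τ - Real.exp (ψ x₀ - 1) * (c₁ / 2) * σ ^ 2 := by
      rw [h18 h11, h16 (hG u)]
      have h22 : ψ (r (G u + σ • L (e u))) - ψ (G u) ≤ σ * τ' - c₁ * σ ^ 2 := by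
        have h23 := mul_le_mul_of_nonneg_left h21 hσ.1
        have h24 := mul_le_mul_of_nonneg_right (min_le_left c 1) (sq_nonneg σ)
        linarith
      have h25 := exp_step_le (M := Real.exp (ψ (G u))) (Real.exp_pos _).le hc₁0.le
        (min_le_right c 1) hσ.1 h7 h22 hτ'0.le (min_le_left 1 _)
      rw [← Real.exp_add, add_sub_cancel] at h25
      have h26 : Real.exp (ψ (G u)) ≤ M := Real.exp_le_exp.2 h14.le
      have h27 : Real.exp (ψ x₀ - 1) ≤ Real.exp (ψ (G u)) := Real.exp_le_exp.2 h15.le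
      have h28 := mul_le_mul_of_nonneg_right h27 (by positivity : 0 ≤ c₁ / 2 * σ ^ 2)
      have h29 := mul_le_mul_of_nonneg_right h26 hτ'0.le
      linarith
    refine ⟨h11, h13.trans ?_, hΘle, fun _ hB => h19 h11 ?_⟩
    · have := mul_le_mul_of_nonneg_left h8 hK.le
      linarith
    · have : 0 ≤ Real.exp (ψ x₀ - 1) * (c₁ / 2) * σ ^ 2 := by positivity
      linarith

end Steps

/-! ### The complex Hessian of `log (‖P‖² + a)` -/

section Hessian

attribute [local instance] InnerProductSpace.complexToReal

variable {E G : Type*} [NormedAddCommGroup E] [InnerProductSpace ℂ E]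
  [NormedAddCommGroup G] [InnerProductSpace ℂ G]

theorem contDiffAt_log_normSq {P : E → G} {x₀ : E} (hP : ContDiffAt ℂ 2 P x₀) {a : ℝ}
    (ha : 0 < ‖P x₀‖ ^ 2 + a) : ContDiffAt ℝ 2 (fun y => Real.log (‖P y‖ ^ 2 + a)) x₀ := by
  have h1 : ContDiffAt ℝ 2 P x₀ := hP.restrict_scalars ℝ
  exact ((h1.norm_sq ℝ).add contDiffAt_const).log ha.ne'

theorem hasFDerivAt_log_normSq {P : E → G} {y : E} (hP : DifferentiableAt ℂ P y) {a : ℝ}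
    (ha : 0 < ‖P y‖ ^ 2 + a) (v : E) :
    fderiv ℝ (fun y => Real.log (‖P y‖ ^ 2 + a)) y v =
      2 * inner ℝ (P y) (fderiv ℂ P y v) / (‖P y‖ ^ 2 + a) := by
  have h1 := hP.hasFDerivAt.restrictScalars ℝ
  have h2 := ((h1.norm_sq).add_const a).log ha.ne'
  rw [h2.fderiv]
  simp
  field_simp

theorem hessian_log_normSq {P : E → G} {x₀ : E} (hP : ContDiffAt ℂ 2 P x₀) {a : ℝ}
    (ha : 0 < ‖P x₀‖ ^ 2 + a) (v : E) :
    fderiv ℝ (fderiv ℝ (fun y => Real.log (‖P y‖ ^ 2 + a))) x₀ v v =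
      (2 * (‖fderiv ℂ P x₀ v‖ ^ 2 + inner ℝ (P x₀) (fderiv ℂ (fderiv ℂ P) x₀ v v)) *
        (‖P x₀‖ ^ 2 + a) - (2 * inner ℝ (P x₀) (fderiv ℂ P x₀ v)) ^ 2) /
        (‖P x₀‖ ^ 2 + a) ^ 2 := by
  have hline : HasDerivAt (fun t : ℝ => x₀ + t • v) v 0 := by
    simpa using ((hasDerivAt_id (0 : ℝ)).smul_const v).const_add x₀
  have hx : x₀ + (0 : ℝ) • v = x₀ := by simp
  have h1 : HasDerivAt (fun t : ℝ => P (x₀ + t • v)) (fderiv ℂ P x₀ v) 0 := by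
    have h := (hP.differentiableAt (by norm_num)).hasFDerivAt.restrictScalars ℝ
    rw [← hx] at h
    simpa [Function.comp_def] using h.comp_hasDerivAt (0 : ℝ) hline
  have h2 : HasDerivAt (fun t : ℝ => fderiv ℂ P (x₀ + t • v) v)
      (fderiv ℂ (fderiv ℂ P) x₀ v v) 0 := by
    have h := ((hP.fderiv_right (m := 1) (by norm_num)).differentiableAt
      (by norm_num)).hasFDerivAt.restrictScalars ℝ
    rw [← hx] at h
    have h3 := h.comp_hasDerivAt (0 : ℝ) hline
    have h4 := (ContinuousLinearMap.apply ℂ G v).restrictScalars ℝ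
    have h5 := ((ContinuousLinearMap.apply ℂ G v).restrictScalars ℝ).hasFDerivAt.comp_hasDerivAt
      (0 : ℝ) h3
    simpa [Function.comp_def] using h5
  have h3 : HasDerivAt (fun t : ℝ => 2 * inner ℝ (P (x₀ + t • v)) (fderiv ℂ P (x₀ + t • v) v) /
      (‖P (x₀ + t • v)‖ ^ 2 + a)) ((2 * (‖fderiv ℂ P x₀ v‖ ^ 2 +
        inner ℝ (P x₀) (fderiv ℂ (fderiv ℂ P) x₀ v v)) *
        (‖P x₀‖ ^ 2 + a) - (2 * inner ℝ (P x₀) (fderiv ℂ P x₀ v)) ^ 2) /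
        (‖P x₀‖ ^ 2 + a) ^ 2) 0 := by
    have h4 := ((h1.inner ℝ h2).const_mul 2).div (h1.norm_sq.add_const a) (by simpa using ha.ne')
    refine h4.congr_deriv ?_
    simp only [zero_smul, add_zero, real_inner_self_eq_norm_sq]
    ring
  have h4 : HasDerivAt (fun t : ℝ => fderiv ℝ (fun y => Real.log (‖P y‖ ^ 2 + a)) (x₀ + t • v) v)
      (fderiv ℝ (fderiv ℝ (fun y => Real.log (‖P y‖ ^ 2 + a))) x₀ v v) 0 := by
    have h := (((contDiffAt_log_normSq hP ha).fderiv_right (m := 1) (by norm_num)).differentiableAt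
      (by norm_num)).hasFDerivAt
    rw [← hx] at h
    have h5 := (ContinuousLinearMap.apply ℝ ℝ v).hasFDerivAt.comp_hasDerivAt
      (0 : ℝ) (h.comp_hasDerivAt (0 : ℝ) hline)
    simpa [Function.comp_def] using h5
  refine h4.unique (h3.congr_of_eventuallyEq ?_)
  have h5 : ∀ᶠ y in 𝓝 x₀, DifferentiableAt ℂ P y ∧ 0 < ‖P y‖ ^ 2 + a := by
    refine ((hP.eventually (by simp)).mono fun y hy => hy.differentiableAt (by norm_num)).and ?_
    have : ContinuousAt (fun y => ‖P y‖ ^ 2 + a) x₀ := by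
      have := hP.continuousAt
      fun_prop
    exact this.eventually_const_lt ha
  have h6 : Tendsto (fun t : ℝ => x₀ + t • v) (𝓝 0) (𝓝 x₀) := by
    simpa using hline.continuousAt.tendsto
  filter_upwards [h6.eventually h5] with t ht using hasFDerivAt_log_normSq ht.1 ht.2 v

theorem hessian_log_normSq_add {P : E → G} {x₀ : E} (hP : ContDiffAt ℂ 2 P x₀) {a : ℝ}
    (ha : 0 < ‖P x₀‖ ^ 2 + a) (v : E) :
    fderiv ℝ (fderiv ℝ (fun y => Real.log (‖P y‖ ^ 2 + a))) x₀ v v +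
      fderiv ℝ (fderiv ℝ (fun y => Real.log (‖P y‖ ^ 2 + a))) x₀ (Complex.I • v) (Complex.I • v) =
      4 * ((‖P x₀‖ ^ 2 + a) * ‖fderiv ℂ P x₀ v‖ ^ 2 -
        ‖inner ℂ (P x₀) (fderiv ℂ P x₀ v)‖ ^ 2) / (‖P x₀‖ ^ 2 + a) ^ 2 := by
  rw [hessian_log_normSq hP ha, hessian_log_normSq hP ha, ← add_div]
  congr 1
  have h1 : fderiv ℂ (fderiv ℂ P) x₀ (Complex.I • v) (Complex.I • v) =
      -fderiv ℂ (fderiv ℂ P) x₀ v v := by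
    simp [smul_smul]
  rw [h1, map_smul, norm_smul, inner_neg_right]
  simp only [real_inner_eq_re_inner ℂ, inner_smul_right, Complex.norm_I, one_mul]
  have h2 : ‖inner ℂ (P x₀) (fderiv ℂ P x₀ v)‖ ^ 2 =
      (inner ℂ (P x₀) (fderiv ℂ P x₀ v)).re ^ 2 + (inner ℂ (P x₀) (fderiv ℂ P x₀ v)).im ^ 2 := by
    rw [Complex.sq_norm, Complex.normSq_apply]
    ring
  rw [h2]
  simp
  ring

end Hessian

/-! ### Negative subspaces of real quadratic forms on complex spaces -/

section Negative

theorem bilin_sum_of_ortho {V ι : Type*} [AddCommGroup V] [Module ℝ V] [Fintype ι]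
    (B : LinearMap.BilinForm ℝ V) (b : ι → V) (hb : ∀ i j, i ≠ j → B (b i) (b j) = 0)
    (a : ι → ℝ) : B (∑ i, a i • b i) (∑ i, a i • b i) = ∑ i, a i ^ 2 * B (b i) (b i) := by
  classical
  simp only [map_sum, LinearMap.sum_apply, map_smul, LinearMap.smul_apply, smul_eq_mul]
  refine Finset.sum_congr rfl fun i _ => ?_
  rw [Finset.sum_eq_single i]
  · ring
  · intro j _ hj
    rw [hb j i hj]
    ring
  · simp

theorem exists_negative_subspace {E : Type*} [NormedAddCommGroup E] [NormedSpace ℂ E]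
    [FiniteDimensional ℂ E] (W : Submodule ℂ E) (B : E →L[ℝ] E →L[ℝ] ℝ)
    (hsymm : ∀ v w, B v w = B w v)
    (hneg : ∀ v ∈ W, v ≠ 0 → B v v + B (Complex.I • v) (Complex.I • v) < 0) {m : ℕ}
    (hm : m ≤ Module.finrank ℂ W) :
    ∃ L : EuclideanSpace ℝ (Fin m) →L[ℝ] E, ∃ c > 0, ∀ e, B (L e) (L e) ≤ -c * ‖e‖ ^ 2 := by
  classical
  have : FiniteDimensional ℝ E := FiniteDimensional.complexToReal E
  let B' : LinearMap.BilinForm ℝ W := LinearMap.mk₂ ℝ (fun v w : W => B v w)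
    (by simp) (by simp) (by simp) (by simp)
  have hB' : ∀ v w : W, B' v w = B v w := fun v w => rfl
  obtain ⟨b, hb⟩ := LinearMap.BilinForm.exists_orthogonal_basis (B := B')
    ⟨fun v w => by simpa [hB'] using hsymm v w⟩
  have hb' : ∀ i j, i ≠ j → B' (b i) (b j) = 0 := fun i j hij => hb hij
  let J : Finset (Fin (Module.finrank ℝ W)) := Finset.univ.filter fun i => B' (b i) (b i) < 0
  have hJ : m ≤ J.card := by
    by_contra hlt
    let P : Submodule ℝ W := Submodule.span ℝ (b '' (Jᶜ : Finset _))
    have hP : ∀ x ∈ P, 0 ≤ B' x x := by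
      intro x hx
      rw [Module.Basis.mem_span_image] at hx
      rw [← b.sum_repr x, bilin_sum_of_ortho B' b hb']
      refine Finset.sum_nonneg fun i _ => ?_
      by_cases hi : i ∈ J
      · have : b.repr x i = 0 := by
          by_contra h
          exact (Finset.mem_compl.1 (Finset.mem_coe.1 (hx (Finsupp.mem_support_iff.2 h)))) hi
        simp [this]
      · have : ¬ B' (b i) (b i) < 0 := fun h => hi (by simp [J, h])
        exact mul_nonneg (sq_nonneg _) (not_lt.1 this)
    have hPdim : Module.finrank ℝ P = (Jᶜ : Finset _).card := by
      have h1 : LinearIndependent ℝ fun i : (Jᶜ : Finset _) => b i :=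
        b.linearIndependent.comp _ Subtype.val_injective
      have h2 := finrank_span_eq_card h1
      rw [Fintype.card_coe] at h2
      have h3 : (Set.range fun i : (Jᶜ : Finset _) => b i) = b '' (Jᶜ : Finset _) := by
        ext x
        simp
      rw [← h2, h3]
    let I' : W ≃ₗ[ℝ] W :=
      (LinearEquiv.smulOfNeZero ℂ W Complex.I Complex.I_ne_zero).restrictScalars ℝ
    have hI' : ∀ x, I' x = Complex.I • x := fun x => rfl
    have hQdim : Module.finrank ℝ (P.map (I' : W →ₗ[ℝ] W)) = Module.finrank ℝ P :=
      LinearEquiv.finrank_map_eq I' P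
    have hdisj : Disjoint P (P.map (I' : W →ₗ[ℝ] W)) := by
      rw [Submodule.disjoint_def]
      rintro x hx ⟨y, hy, rfl⟩
      by_contra h0
      have hy0 : (y : E) ≠ 0 := by
        intro h
        have : y = 0 := Subtype.ext h
        simp [this] at h0
      have h1 := hneg y y.2 hy0
      have h2 := hP y hy
      have h3 := hP _ hx
      simp only [LinearEquiv.coe_coe, hI', hB', Submodule.coe_smul] at h2 h3
      linarith
    have h1 := Submodule.finrank_add_finrank_le_of_disjoint hdisj
    rw [hQdim, hPdim, Finset.card_compl, Fintype.card_fin] at h1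
    have h2 := finrank_real_of_complex W
    omega
  obtain ⟨σ⟩ : Nonempty (Fin m ↪ J) := by
    apply Function.Embedding.nonempty_of_card_le
    simpa using hJ
  let w : Fin m → W := fun j => b (σ j)
  have hw : ∀ i j, i ≠ j → B' (w i) (w j) = 0 := fun i j hij =>
    hb' _ _ fun h => hij (σ.injective (Subtype.ext h))
  have hwneg : ∀ j, B' (w j) (w j) < 0 := fun j => (Finset.mem_filter.1 (σ j).2).2
  obtain ⟨c, hc, hcw⟩ : ∃ c > 0, ∀ j, B' (w j) (w j) ≤ -c := by
    have : ∀ᶠ s in nhdsWithin (0 : ℝ) (Set.Ioi 0), ∀ j, s ≤ -B' (w j) (w j) := by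
      rw [Filter.eventually_all]
      intro j
      exact nhdsWithin_le_nhds (Iic_mem_nhds (by linarith [hwneg j]))
    obtain ⟨s, hs⟩ := (this.and self_mem_nhdsWithin).exists
    exact ⟨s, hs.2, fun j => by linarith [hs.1 j]⟩
  let L₀ : EuclideanSpace ℝ (Fin m) →ₗ[ℝ] E :=
    { toFun := fun e => ∑ j, e j • (w j : E)
      map_add' := fun x y => by simp [add_smul, Finset.sum_add_distrib]
      map_smul' := fun t x => by simp [Finset.smul_sum, smul_smul] }
  refine ⟨LinearMap.toContinuousLinearMap L₀, c, hc, fun e => ?_⟩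
  have h1 : (LinearMap.toContinuousLinearMap L₀ e : E) = ((∑ j, e j • w j : W) : E) := by
    simp [L₀]
  rw [h1, ← hB', bilin_sum_of_ortho B' w hw, EuclideanSpace.norm_sq_eq, Finset.mul_sum]
  refine Finset.sum_le_sum fun j _ => ?_
  rw [Real.norm_eq_abs, sq_abs]
  nlinarith [hcw j, sq_nonneg (e j)]

theorem concave_step {g g₁ g₂ : ℝ → ℝ} {c s : ℝ}
    (h1 : ∀ t ∈ Set.Icc 0 s, HasDerivAt g (g₁ t) t)
    (h2 : ∀ t ∈ Set.Icc 0 s, HasDerivAt g₁ (g₂ t) t)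
    (h3 : ∀ t ∈ Set.Icc 0 s, g₂ t ≤ -(2 * c)) {σ : ℝ} (hσ : σ ∈ Set.Icc 0 s) :
    g σ ≤ g 0 + σ * g₁ 0 - c * σ ^ 2 := by
  have h0 : (0 : ℝ) ∈ Set.Icc 0 s := ⟨le_rfl, hσ.1.trans hσ.2⟩
  have anti1 : AntitoneOn (fun t => g₁ t + 2 * c * t) (Set.Icc 0 s) := by
    have hd : ∀ t ∈ Set.Icc 0 s, HasDerivAt (fun t => g₁ t + 2 * c * t) (g₂ t + 2 * c) t := by
      intro t ht
      refine ((h2 t ht).add ((hasDerivAt_id t).const_mul (2 * c))).congr_deriv ?_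
      simp
    refine antitoneOn_of_deriv_nonpos (convex_Icc 0 s)
      (fun t ht => (hd t ht).continuousAt.continuousWithinAt)
      (fun t ht => (hd t (interior_subset ht)).differentiableAt.differentiableWithinAt)
      fun t ht => ?_
    rw [(hd t (interior_subset ht)).deriv]
    linarith [h3 t (interior_subset ht)]
  have anti0 : AntitoneOn (fun t => g t - t * g₁ 0 + c * t ^ 2) (Set.Icc 0 s) := by
    have hd : ∀ t ∈ Set.Icc 0 s, HasDerivAt (fun t => g t - t * g₁ 0 + c * t ^ 2)
        (g₁ t - g₁ 0 + 2 * c * t) t := by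
      intro t ht
      refine (((h1 t ht).sub ((hasDerivAt_id t).mul_const (g₁ 0))).add
        (((hasDerivAt_id t).pow 2).const_mul c)).congr_deriv ?_
      simp
      ring
    refine antitoneOn_of_deriv_nonpos (convex_Icc 0 s)
      (fun t ht => (hd t ht).continuousAt.continuousWithinAt)
      (fun t ht => (hd t (interior_subset ht)).differentiableAt.differentiableWithinAt)
      fun t ht => ?_
    rw [(hd t (interior_subset ht)).deriv]
    have := anti1 h0 (interior_subset ht) (interior_subset ht).1
    simp only [mul_zero, add_zero] at this
    linarith
  have := anti0 h0 hσ hσ.1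
  simp only [zero_mul, sub_zero] at this
  nlinarith

theorem eventually_norm_sub_apply_lt {X G : Type*} [TopologicalSpace X] [NormedAddCommGroup G]
    {g : X → G} {x₀ : X} (hg : ContinuousAt g x₀) {ρ : ℝ} (hρ : 0 < ρ) :
    ∀ᶠ y in 𝓝 x₀, ‖g y - g x₀‖ < ρ := by
  simpa only [dist_eq_norm] using Metric.tendsto_nhds.1 hg ρ hρ

/-- A `C²` function with negative definite Hessian along a subspace decreases quadratically. -/
theorem exists_concave_step {E : Type*} [NormedAddCommGroup E] [NormedSpace ℝ E] {Ψ : E → ℝ}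
    {x₀ : E} (hΨ : ContDiffAt ℝ 2 Ψ x₀) {m : ℕ} (L : EuclideanSpace ℝ (Fin m) →L[ℝ] E) {c : ℝ}
    (hc : 0 < c) (hL : ∀ e, fderiv ℝ (fderiv ℝ Ψ) x₀ (L e) (L e) ≤ -c * ‖e‖ ^ 2) :
    ∃ s > 0, ∀ᶠ y in 𝓝 x₀, ∀ e : EuclideanSpace ℝ (Fin m), ‖e‖ = 1 → ∀ σ ∈ Set.Icc 0 s,
      Ψ (y + σ • L e) ≤ Ψ y + σ * fderiv ℝ Ψ y (L e) - c / 4 * σ ^ 2 := by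
  have hcont :=
    ((hΨ.fderiv_right (m := 1) (by norm_num)).fderiv_right (m := 0) (by norm_num)).continuousAt
  have hν : 0 < ‖L‖ + 1 := by positivity
  have h1 := eventually_norm_sub_apply_lt hcont
    (by positivity : 0 < c / (2 * (‖L‖ + 1) ^ 2))
  have h2 : ∀ᶠ y in 𝓝 x₀, ContDiffAt ℝ 2 Ψ y := hΨ.eventually (by simp)
  obtain ⟨ε, hε, h⟩ := Metric.eventually_nhds_iff.1 (h1.and h2)
  refine ⟨ε / (2 * (‖L‖ + 1)), by positivity, ?_⟩
  filter_upwards [Metric.ball_mem_nhds x₀ (half_pos hε)] with y hy e he σ hσ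
  have hLe : ‖L e‖ ≤ ‖L‖ + 1 := by
    have := L.le_opNorm e
    rw [he, mul_one] at this
    linarith
  have hnear : ∀ t ∈ Set.Icc 0 (ε / (2 * (‖L‖ + 1))), dist (y + t • L e) x₀ < ε := by
    intro t ht
    have h3 := dist_triangle (y + t • L e) y x₀
    have h4 : dist (y + t • L e) y ≤ ε / 2 := by
      rw [dist_eq_norm, add_sub_cancel_left, norm_smul, Real.norm_eq_abs, abs_of_nonneg ht.1]
      have h5 := ht.2
      rw [le_div_iff₀ (by positivity)] at h5
      nlinarith [ht.1]
    rw [Metric.mem_ball] at hy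
    linarith
  have hline : ∀ t : ℝ, HasDerivAt (fun t : ℝ => y + t • L e) (L e) t := fun t => by
    simpa using ((hasDerivAt_id t).smul_const (L e)).const_add y
  have key := concave_step (g := fun t => Ψ (y + t • L e))
    (g₁ := fun t => fderiv ℝ Ψ (y + t • L e) (L e))
    (g₂ := fun t => fderiv ℝ (fderiv ℝ Ψ) (y + t • L e) (L e) (L e)) (c := c / 4)
    (s := ε / (2 * (‖L‖ + 1))) ?_ ?_ ?_ hσ
  · simpa using key
  · intro t ht
    have h3 := ((h (hnear t ht)).2.differentiableAt (by norm_num)).hasFDerivAt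
    exact h3.comp_hasDerivAt t (hline t)
  · intro t ht
    have h3 := (((h (hnear t ht)).2.fderiv_right (m := 1) (by norm_num)).differentiableAt
      (by norm_num)).hasFDerivAt
    exact (ContinuousLinearMap.apply ℝ ℝ (L e)).hasFDerivAt.comp_hasDerivAt t
      (h3.comp_hasDerivAt t (hline t))
  · intro t ht
    have h3 := (h (hnear t ht)).1
    have h4 := ((fderiv ℝ (fderiv ℝ Ψ) (y + t • L e) - fderiv ℝ (fderiv ℝ Ψ) x₀)).le_opNorm₂
      (L e) (L e)
    have h5 := hL e
    rw [he] at h5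
    simp only [sub_apply, Real.norm_eq_abs] at h4
    have h6 := (abs_le.1 h4).2
    have h7 : ‖fderiv ℝ (fderiv ℝ Ψ) (y + t • L e) - fderiv ℝ (fderiv ℝ Ψ) x₀‖ * ‖L e‖ * ‖L e‖ ≤
        c / 2 := by
      rw [lt_div_iff₀ (by positivity)] at h3
      have h8 : ‖L e‖ * ‖L e‖ ≤ (‖L‖ + 1) ^ 2 := by nlinarith [norm_nonneg (L e)]
      have h9 := mul_le_mul_of_nonneg_left h8 (norm_nonneg
        (fderiv ℝ (fderiv ℝ Ψ) (y + t • L e) - fderiv ℝ (fderiv ℝ Ψ) x₀))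
      nlinarith
    linarith

end Negative

/-! ### Retracting onto the level set `h = 1` and pushing by concavity -/

section Level

attribute [local instance] InnerProductSpace.complexToReal

variable {E F : Type*} [NormedAddCommGroup E] [InnerProductSpace ℂ E]
  [NormedAddCommGroup F] [InnerProductSpace ℂ F]

/-- The radial retraction onto the level set `h = 1` of a function homogeneous of degree `d`. -/
noncomputable def levelRetraction (h : E → ℂ) (d : ℕ) (x : E) : E :=
  Complex.exp (-(Complex.log (h x) / d)) • x

theorem apply_levelRetraction {h : E → ℂ} {d : ℕ} (hd : d ≠ 0)
    (hom : ∀ (c : ℂ) x, h (c • x) = c ^ d * h x) {x : E} (hx : h x ≠ 0) :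
    h (levelRetraction h d x) = 1 := by
  have hd' : (d : ℂ) ≠ 0 := by exact_mod_cast hd
  rw [levelRetraction, hom, ← Complex.exp_nat_mul, mul_neg, mul_div_cancel₀ _ hd', Complex.exp_neg,
    Complex.exp_log hx, inv_mul_cancel₀ hx]

theorem levelRetraction_eq_self {h : E → ℂ} (d : ℕ) {x : E} (hx : h x = 1) :
    levelRetraction h d x = x := by
  simp [levelRetraction, hx]

theorem contDiffAt_levelRetraction {h : E → ℂ} (hh : ContDiff ℂ 2 h) (d : ℕ) {x : E}
    (hx : h x ∈ Complex.slitPlane) : ContDiffAt ℂ 2 (levelRetraction h d) x := by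
  have h1 : ContDiffAt ℂ 2 (fun x => Complex.log (h x)) x :=
    (Complex.contDiffAt_log hx).comp x hh.contDiffAt
  exact (h1.div_const _).neg.cexp.smul contDiffAt_id

theorem fderiv_levelRetraction {h : E → ℂ} (hh : ContDiff ℂ 2 h) (d : ℕ) {x v : E}
    (hx : h x = 1) (hv : fderiv ℂ h x v = 0) : fderiv ℂ (levelRetraction h d) x v = v := by
  have h0 := (hh.differentiable (by norm_num) x).hasFDerivAt
  have h1 : HasFDerivAt (fun x => Complex.log (h x)) ((h x)⁻¹ • fderiv ℂ h x) x :=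
    h0.clog (by simp [hx])
  have h2 : HasFDerivAt (fun x => Complex.exp (-(Complex.log (h x) * (d : ℂ)⁻¹))) _ x :=
    (h1.mul_const ((d : ℂ)⁻¹)).neg.cexp
  have h3 : levelRetraction h d =
      fun x => Complex.exp (-(Complex.log (h x) * (d : ℂ)⁻¹)) • id x := by
    funext x
    simp only [levelRetraction, div_eq_mul_inv, id]
  have h4 : HasFDerivAt (fun x => Complex.exp (-(Complex.log (h x) * (d : ℂ)⁻¹)) • id x) _ x :=
    h2.smul (hasFDerivAt_id x)
  rw [h3, h4.fderiv]
  simp [hv, hx]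

theorem isLocalRetraction_levelRetraction {h : E → ℂ} (hh : ContDiff ℂ 2 h) {d : ℕ} (hd : d ≠ 0)
    (hom : ∀ (c : ℂ) x, h (c • x) = c ^ d * h x) {x₀ : E} (hx₀ : h x₀ = 1) :
    IsLocalRetraction {x | h x = 1} (levelRetraction h d)
      ((fderiv ℂ (levelRetraction h d) x₀).restrictScalars ℝ) x₀ := by
  have h1 : ∀ᶠ y in 𝓝 x₀, h y ∈ Complex.slitPlane :=
    hh.continuous.continuousAt.eventually (Complex.isOpen_slitPlane.mem_nhds (by simp [hx₀]))
  refine ⟨?_, ?_, ?_, Eventually.of_forall fun y hy => levelRetraction_eq_self d hy⟩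
  · exact ((contDiffAt_levelRetraction hh d (by simp [hx₀])).hasStrictFDerivAt
      (by norm_num)).restrictScalars ℝ
  · exact h1.mono fun y hy => (contDiffAt_levelRetraction hh d hy).continuousAt
  · exact h1.mono fun y hy => apply_levelRetraction hd hom (Complex.slitPlane_ne_zero hy)

/-- The directions in the kernel of `dh` along which `f` only varies radially. -/
theorem exists_radial_submodule [FiniteDimensional ℂ E] [FiniteDimensional ℂ F] {n : ℕ}
    (hdim : Module.finrank ℂ E = Module.finrank ℂ F + n + 1) (A : E →L[ℂ] F) (b : E →L[ℂ] ℂ)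
    {w : F} (hw : w ≠ 0) :
    ∃ W : Submodule ℂ E, n + 1 ≤ Module.finrank ℂ W ∧ ∀ v ∈ W, b v = 0 ∧ ∃ c : ℂ, A v = c • w := by
  let T : E →ₗ[ℂ] ℂ × (F ⧸ (ℂ ∙ w)) :=
    (b : E →ₗ[ℂ] ℂ).prod ((ℂ ∙ w).mkQ ∘ₗ (A : E →ₗ[ℂ] F))
  refine ⟨LinearMap.ker T, ?_, fun v hv => ?_⟩
  · have h1 := T.finrank_range_add_finrank_ker
    have h2 := (LinearMap.range T).finrank_le
    have h3 := Submodule.finrank_quotient_add_finrank (ℂ ∙ w)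
    rw [finrank_span_singleton hw] at h3
    rw [Module.finrank_prod, Module.finrank_self] at h2
    omega
  · have h1 : T v = 0 := hv
    have h2 : b v = 0 := congrArg Prod.fst h1
    have h3 : (ℂ ∙ w).mkQ (A v) = 0 := congrArg Prod.snd h1
    rw [Submodule.mkQ_apply, Submodule.Quotient.mk_eq_zero, Submodule.mem_span_singleton] at h3
    obtain ⟨c, hc⟩ := h3
    exact ⟨h2, c, hc.symm⟩

/-- The weighted height function `‖f‖² (R / (1 + ‖x‖²)) ^ ε`. -/
noncomputable def heightFn (f : E → F) (R ε : ℝ) (x : E) : ℝ :=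
  ‖f x‖ ^ 2 * (R / (1 + ‖x‖ ^ 2)) ^ ε

theorem localStep_heightFn_of_concave [FiniteDimensional ℂ E] [FiniteDimensional ℂ F]
    {D : Type*} [TopologicalSpace D] [NormalSpace D] {n : ℕ} (hD : AvoidsZero D (n + 1))
    (hdim : Module.finrank ℂ E = Module.finrank ℂ F + n + 1)
    {f : E → F} {h : E → ℂ} (hf : ContDiff ℂ 2 f) (hh : ContDiff ℂ 2 h) {d : ℕ} (hd : d ≠ 0)
    (hom : ∀ (c : ℂ) x, h (c • x) = c ^ d * h x) {R ε : ℝ} (hR : 0 < R) (hε : 0 < ε)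
    {Λ : E → ℝ} {B β : ℝ} {x₀ : E} (hx₀ : h x₀ = 1) (hfx₀ : f x₀ ≠ 0)
    (hΛ : ∀ᶠ y in 𝓝 x₀, h y = 1 → heightFn f R ε y ≤ B → Λ y ≤ β) :
    LocalStep D {x | h x = 1} (heightFn f R ε) Λ B β x₀ := by
  set r := levelRetraction h d with hr
  have hr0 : r x₀ = x₀ := levelRetraction_eq_self d hx₀
  have hrC : ContDiffAt ℂ 2 r x₀ := contDiffAt_levelRetraction hh d (by simp [hx₀])
  have hfr : ContDiffAt ℂ 2 (f ∘ r) x₀ := hf.contDiffAt.comp x₀ hrC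
  obtain ⟨W, hW, hWv⟩ := exists_radial_submodule hdim (fderiv ℂ f x₀) (fderiv ℂ h x₀) hfx₀
  let u₁ : E → ℝ := fun y => Real.log (‖(f ∘ r) y‖ ^ 2 + 0)
  let u₂ : E → ℝ := fun y => Real.log (‖r y‖ ^ 2 + 1)
  have ha₁ : 0 < ‖(f ∘ r) x₀‖ ^ 2 + 0 := by
    have : 0 < ‖f x₀‖ := norm_pos_iff.2 hfx₀
    simp only [Function.comp_apply, hr0]
    positivity
  have ha₂ : 0 < ‖r x₀‖ ^ 2 + 1 := by positivity
  have hu₁ : ContDiffAt ℝ 2 u₁ x₀ := contDiffAt_log_normSq hfr ha₁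
  have hu₂ : ContDiffAt ℝ 2 u₂ x₀ := contDiffAt_log_normSq hrC ha₂
  let ψ : E → ℝ := fun y => Real.log (‖f y‖ ^ 2) - ε * Real.log (‖y‖ ^ 2 + 1) + ε * Real.log R
  let Ψ : E → ℝ := fun y => u₁ y - ε * u₂ y + ε * Real.log R
  have hΨψ : ∀ y, Ψ y = ψ (r y) := fun y => by simp [Ψ, ψ, u₁, u₂]
  have hΨ : ContDiffAt ℝ 2 Ψ x₀ := (hu₁.sub (contDiffAt_const.mul hu₂)).add contDiffAt_const
  have hHess : ∀ v, fderiv ℝ (fderiv ℝ Ψ) x₀ v v =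
      fderiv ℝ (fderiv ℝ u₁) x₀ v v - ε * fderiv ℝ (fderiv ℝ u₂) x₀ v v := by
    intro v
    have h1 : fderiv ℝ Ψ =ᶠ[𝓝 x₀] fun y => fderiv ℝ u₁ y - ε • fderiv ℝ u₂ y := by
      filter_upwards [hu₁.eventually (by simp), hu₂.eventually (by simp)] with y hy₁ hy₂
      have h2 := (hy₁.differentiableAt (by norm_num)).hasFDerivAt
      have h3 := (hy₂.differentiableAt (by norm_num)).hasFDerivAt
      exact ((h2.sub (h3.const_mul ε)).add_const (ε * Real.log R)).fderiv
    rw [h1.fderiv_eq]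
    have h2 := ((hu₁.fderiv_right (m := 1) (by norm_num)).differentiableAt
      (by norm_num)).hasFDerivAt
    have h3 := ((hu₂.fderiv_right (m := 1) (by norm_num)).differentiableAt
      (by norm_num)).hasFDerivAt
    have h4 : HasFDerivAt (fun y => fderiv ℝ u₁ y - ε • fderiv ℝ u₂ y) _ x₀ :=
      h2.sub (h3.const_smul ε)
    rw [h4.fderiv]
    simp
  have hneg : ∀ v ∈ W, v ≠ 0 → fderiv ℝ (fderiv ℝ Ψ) x₀ v v +
      fderiv ℝ (fderiv ℝ Ψ) x₀ (Complex.I • v) (Complex.I • v) < 0 := by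
    intro v hv hv0
    obtain ⟨h1, c, hc⟩ := hWv v hv
    have h2 := hessian_log_normSq_add hfr ha₁ v
    have h3 := hessian_log_normSq_add hrC ha₂ v
    have hrv : fderiv ℂ r x₀ v = v := fderiv_levelRetraction hh d hx₀ h1
    have hfrv : fderiv ℂ (f ∘ r) x₀ v = c • f x₀ := by
      rw [fderiv_comp x₀ (hf.differentiable (by norm_num) _)
        (hrC.differentiableAt (by norm_num)), ContinuousLinearMap.comp_apply, hrv, hr0, hc]
    have h4 : fderiv ℝ (fderiv ℝ u₁) x₀ v v +
        fderiv ℝ (fderiv ℝ u₁) x₀ (Complex.I • v) (Complex.I • v) = 0 := by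
      refine h2.trans ?_
      have h5 : (‖f x₀‖ ^ 2 + 0) * ‖c • f x₀‖ ^ 2 - ‖inner ℂ (f x₀) (c • f x₀)‖ ^ 2 = 0 := by
        rw [inner_smul_right, norm_mul, norm_smul, inner_self_eq_norm_sq_to_K]
        simp
        ring
      simp only [Function.comp_apply, hr0, hfrv, h5]
      simp
    have h5 : 0 < fderiv ℝ (fderiv ℝ u₂) x₀ v v +
        fderiv ℝ (fderiv ℝ u₂) x₀ (Complex.I • v) (Complex.I • v) := by
      refine lt_of_lt_of_eq ?_ h3.symm
      rw [hrv, hr0]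
      have h6 := norm_inner_le_norm (𝕜 := ℂ) x₀ v
      have h7 : 0 < ‖v‖ := norm_pos_iff.2 hv0
      have h8 : ‖inner ℂ x₀ v‖ ^ 2 ≤ (‖x₀‖ * ‖v‖) ^ 2 := by gcongr
      have h9 : 0 < ‖v‖ ^ 2 := by positivity
      apply div_pos _ (by positivity)
      nlinarith
    rw [hHess, hHess]
    nlinarith
  have hsymm : ∀ v w, fderiv ℝ (fderiv ℝ Ψ) x₀ v w = fderiv ℝ (fderiv ℝ Ψ) x₀ w v :=
    fun v w => (hΨ.isSymmSndFDerivAt (by simp)).eq v w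
  obtain ⟨L, c, hc, hL⟩ := exists_negative_subspace W _ hsymm hneg hW
  obtain ⟨s, hs, hcon⟩ := exists_concave_step hΨ L hc hL
  refine localStep_of_concave (ψ := ψ) hD (isLocalRetraction_levelRetraction hh hd hom hx₀) L
    (fderiv ℝ Ψ) ?_ ?_ ?_ hΛ (by positivity : 0 < c / 4) hs ?_
  · filter_upwards [hΨ.eventually (by simp)] with y hy
    exact (hy.fderiv_right (m := 1) (by norm_num)).continuousAt
  · have h1 : ContinuousAt f x₀ := hf.continuous.continuousAt
    have h2 : ‖f x₀‖ ^ 2 ≠ 0 := by simpa using hfx₀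
    have h3 : ‖x₀‖ ^ 2 + 1 ≠ 0 := by positivity
    fun_prop (disch := assumption)
  · filter_upwards [hf.continuous.continuousAt.eventually_ne hfx₀] with y hy _
    have h1 : 0 < ‖f y‖ := norm_pos_iff.2 hy
    have h2 : 0 < ‖f y‖ ^ 2 := by positivity
    have h3 : 0 < 1 + ‖y‖ ^ 2 := by positivity
    simp only [heightFn, ψ]
    rw [Real.rpow_def_of_pos (by positivity), Real.log_div hR.ne' h3.ne']
    conv_lhs => rw [← Real.exp_log h2]
    rw [← Real.exp_add]
    congr 1
    rw [add_comm (1 : ℝ)]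
    ring
  · filter_upwards [hcon] with y hy hyS e he σ hσ
    have h1 := hy e he σ hσ
    rwa [hΨψ, hΨψ, show r y = y from levelRetraction_eq_self d hyS] at h1

end Level

/-! ### Pushing compact families in `h = 1` towards `f = 0` -/

section Barrier

variable {E F : Type*} [NormedAddCommGroup E] [NormedAddCommGroup F]

/-- The barrier function controlling `‖f‖` and `‖x‖` simultaneously. -/
noncomputable def barrierFn (f : E → F) (R : ℝ) (x : E) : ℝ :=
  ‖f x‖ + 1 / 4 * Real.log ((1 + ‖x‖ ^ 2) / R)

theorem continuous_heightFn {f : E → F} (hf : Continuous f) {R ε : ℝ} (hR : 0 < R) :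
    Continuous (heightFn f R ε) := by
  refine (hf.norm.pow 2).mul ?_
  refine Continuous.rpow_const (continuous_const.div (by fun_prop) fun x => by positivity)
    fun x => Or.inl (by positivity)

theorem continuous_barrierFn {f : E → F} (hf : Continuous f) {R : ℝ} (hR : 0 < R) :
    Continuous (barrierFn f R) := by
  refine hf.norm.add (continuous_const.mul (Continuous.log (by fun_prop) fun x => ?_))
  positivity

theorem le_heightFn {f : E → F} {R ε : ℝ} (hε : 0 ≤ ε) {x : E} (hx : 1 + ‖x‖ ^ 2 ≤ R) :
    ‖f x‖ ^ 2 ≤ heightFn f R ε x := by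
  have h1 : 1 ≤ R / (1 + ‖x‖ ^ 2) := (one_le_div (by positivity)).2 hx
  exact le_mul_of_one_le_right (by positivity) (Real.one_le_rpow h1 hε)

theorem barrierFn_le {f : E → F} {R : ℝ} (hR : 0 < R) {x : E} (hx : 1 + ‖x‖ ^ 2 ≤ R) :
    barrierFn f R x ≤ ‖f x‖ := by
  have h1 : Real.log ((1 + ‖x‖ ^ 2) / R) ≤ 0 :=
    Real.log_nonpos (by positivity) ((div_le_one hR).2 hx)
  unfold barrierFn
  linarith

theorem le_barrierFn {f : E → F} {R : ℝ} (hR : 0 < R) {x : E} (hx : R ≤ 1 + ‖x‖ ^ 2) :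
    ‖f x‖ ≤ barrierFn f R x := by
  have h1 : 0 ≤ Real.log ((1 + ‖x‖ ^ 2) / R) := Real.log_nonneg ((one_le_div hR).2 hx)
  unfold barrierFn
  linarith

theorem weight_le_of_barrierFn_le {f : E → F} {R β : ℝ} (hR : 0 < R) {x : E}
    (hx : barrierFn f R x ≤ β) : 1 + ‖x‖ ^ 2 ≤ R * Real.exp (4 * β) := by
  have h1 : Real.log ((1 + ‖x‖ ^ 2) / R) ≤ 4 * β := by
    unfold barrierFn at hx
    linarith [norm_nonneg (f x)]
  rw [Real.log_le_iff_le_exp (by positivity), div_le_iff₀ hR] at h1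
  linarith

theorem normSq_le_of_barrierFn_le {f : E → F} {R ε β : ℝ} (hR : 0 < R) (hε : 0 ≤ ε) (hε1 : ε ≤ 1)
    (hβ : 0 ≤ β) {x : E} (hx : barrierFn f R x ≤ β) :
    ‖f x‖ ^ 2 ≤ heightFn f R ε x * Real.exp (4 * β) := by
  have h1 := weight_le_of_barrierFn_le hR hx
  have h2 : 1 ≤ (R / (1 + ‖x‖ ^ 2)) ^ ε * Real.exp (4 * β) := by
    have h3 : Real.exp (-(4 * β)) ≤ R / (1 + ‖x‖ ^ 2) := by
      rw [Real.exp_neg, le_div_iff₀ (by positivity), inv_mul_le_iff₀ (Real.exp_pos _)]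
      linarith
    have h4 : Real.exp (-(4 * β)) ≤ Real.exp (-(4 * β)) ^ ε := by
      conv_lhs => rw [← Real.rpow_one (Real.exp (-(4 * β)))]
      exact Real.rpow_le_rpow_of_exponent_ge (Real.exp_pos _)
        (Real.exp_le_one_iff.2 (by linarith)) hε1
    have h5 : Real.exp (-(4 * β)) ≤ (R / (1 + ‖x‖ ^ 2)) ^ ε :=
      h4.trans (Real.rpow_le_rpow (Real.exp_pos _).le h3 hε)
    calc (1 : ℝ) = Real.exp (-(4 * β)) * Real.exp (4 * β) := by
          rw [← Real.exp_add]; simp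
      _ ≤ _ := by gcongr
  unfold heightFn
  nlinarith [sq_nonneg ‖f x‖]

end Barrier

section PushToZero

attribute [local instance] InnerProductSpace.complexToReal

variable {E F : Type*} [NormedAddCommGroup E] [InnerProductSpace ℂ E]
  [NormedAddCommGroup F] [InnerProductSpace ℂ F]

theorem hasStrictFDerivAt_normSq_comp {g : E → F} {g' : E →L[ℝ] F} {x : E}
    (hg : HasStrictFDerivAt g g' x) :
    ∃ T : E →L[ℝ] ℝ, HasStrictFDerivAt (fun x => ‖g x‖ ^ 2) T x ∧
      ∀ v, T v = 2 * (inner ℂ (g x) (g' v)).re :=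
  ⟨_, (hasStrictFDerivAt_norm_sq (g x)).comp x hg, fun v => by
    simp [real_inner_eq_re_inner ℂ]⟩

/-- The outer estimate: far away, some direction tangent to `h = 1` decreases `‖f‖` quickly. -/
def OuterDecrease (f : E → F) (h : E → ℂ) : Prop :=
  ∀ r : ℝ, ∃ R₀ : ℝ, ∀ x, h x = 1 → R₀ ≤ ‖x‖ → f x ≠ 0 → ‖f x‖ ≤ r → ∃ v, v ≠ 0 ∧
    fderiv ℂ h x v = 0 ∧ (inner ℂ (f x) (fderiv ℂ f x v)).re / ‖f x‖ ≤ -(‖v‖ / ‖x‖)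

theorem localStep_heightFn_of_outer {D : Type*} [TopologicalSpace D] {f : E → F} {h : E → ℂ}
    (hf : ContDiff ℂ 2 f) (hh : ContDiff ℂ 2 h) {d : ℕ} (hd : d ≠ 0)
    (hom : ∀ (c : ℂ) x, h (c • x) = c ^ d * h x) {R ε : ℝ} (hR : 0 < R) (hε : 0 < ε)
    {B β ρ : ℝ} {x₀ v : E} (hx₀ : h x₀ = 1) (hfx₀ : f x₀ ≠ 0) (hfρ : ‖f x₀‖ ≤ ρ) (hερ : ε * ρ ≤ 1)
    (hv : v ≠ 0) (hhv : fderiv ℂ h x₀ v = 0)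
    (hA : (inner ℂ (f x₀) (fderiv ℂ f x₀ v)).re / ‖f x₀‖ ≤ -(‖v‖ / ‖x₀‖)) :
    LocalStep D {x | h x = 1} (heightFn f R ε) (barrierFn f R) B β x₀ := by
  set r := levelRetraction h d with hr
  have hr0 : r x₀ = x₀ := levelRetraction_eq_self d hx₀
  have hret := isLocalRetraction_levelRetraction hh hd hom hx₀
  have hx₀0 : 0 < ‖x₀‖ := by
    rw [norm_pos_iff]
    rintro rfl
    have := hom 0 0
    rw [zero_pow hd, zero_mul, zero_smul, hx₀] at this
    exact one_ne_zero this
  have hfp : 0 < ‖f x₀‖ := norm_pos_iff.2 hfx₀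
  have hvp : 0 < ‖v‖ := norm_pos_iff.2 hv
  have hrv : fderiv ℂ r x₀ v = v := fderiv_levelRetraction hh d hx₀ hhv
  have hfr : HasStrictFDerivAt (f ∘ r)
      (((fderiv ℂ f x₀).restrictScalars ℝ).comp ((fderiv ℂ r x₀).restrictScalars ℝ)) x₀ := by
    have h1 : HasStrictFDerivAt f ((fderiv ℂ f x₀).restrictScalars ℝ) (r x₀) := by
      rw [hr0]
      exact (hf.contDiffAt.hasStrictFDerivAt (by norm_num)).restrictScalars ℝ
    exact h1.comp x₀ hret.hasStrictFDerivAt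
  obtain ⟨P, hP, hPv⟩ := hasStrictFDerivAt_normSq_comp hfr
  obtain ⟨Q, hQ, hQv⟩ := hasStrictFDerivAt_normSq_comp hret.hasStrictFDerivAt
  have hPv := hPv v
  have hQv := hQv v
  simp only [ContinuousLinearMap.comp_apply, ContinuousLinearMap.coe_restrictScalars',
    Function.comp_apply, ← hr, hrv, hr0] at hPv hQv
  rw [← hr] at hQ
  have hq : 0 < 1 + ‖x₀‖ ^ 2 := by positivity
  have hinner : |(inner ℂ x₀ v).re| ≤ ‖x₀‖ * ‖v‖ :=
    (Complex.abs_re_le_norm _).trans (norm_inner_le_norm _ _)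
  -- the weight `(R / (1 + ‖x‖²)) ^ ε`
  have hw : HasStrictFDerivAt (fun x => (R / (1 + ‖r x‖ ^ 2)) ^ ε)
      (((R / (1 + ‖x₀‖ ^ 2)) ^ ε * (-ε / (1 + ‖x₀‖ ^ 2))) • Q) x₀ := by
    have h1 : HasStrictFDerivAt (fun x => 1 + ‖r x‖ ^ 2) Q x₀ := hQ.const_add 1
    have h2 : HasStrictDerivAt (fun t : ℝ => (R / t) ^ ε)
        ((R / (1 + ‖x₀‖ ^ 2)) ^ ε * (-ε / (1 + ‖x₀‖ ^ 2))) (1 + ‖r x₀‖ ^ 2) := by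
      rw [hr0]
      have h3 : HasStrictDerivAt (fun t : ℝ => R / t) _ (1 + ‖x₀‖ ^ 2) :=
        (hasStrictDerivAt_const (1 + ‖x₀‖ ^ 2) R).fun_div (hasStrictDerivAt_id _) hq.ne'
      have h4 := (Real.hasStrictDerivAt_rpow_const_of_ne
        (x := R / (1 + ‖x₀‖ ^ 2)) (by positivity) ε).comp (1 + ‖x₀‖ ^ 2) h3
      refine h4.congr_deriv ?_
      rw [Real.rpow_sub_one (by positivity)]
      field_simp
      try ring
    exact h2.comp_hasStrictFDerivAt x₀ h1
  have hΘ : HasStrictFDerivAt (heightFn f R ε ∘ r) _ x₀ := hP.mul hw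
  have hΛ : HasStrictFDerivAt (barrierFn f R ∘ r)
      ((1 / (2 * ‖f x₀‖)) • P + (1 / 4 * (1 + ‖x₀‖ ^ 2)⁻¹) • Q) x₀ := by
    have h1 : HasStrictFDerivAt (fun x => √(‖(f ∘ r) x‖ ^ 2)) _ x₀ :=
      hP.sqrt (by simpa [hr0] using hfx₀)
    have h2 : HasStrictFDerivAt (fun x => 1 + ‖r x‖ ^ 2) Q x₀ := hQ.const_add 1
    have h3 : HasStrictFDerivAt (fun x => (1 + ‖r x‖ ^ 2) * R⁻¹) _ x₀ := h2.mul_const R⁻¹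
    have h4 : HasStrictFDerivAt (fun x => 1 / 4 * Real.log ((1 + ‖r x‖ ^ 2) * R⁻¹)) _ x₀ :=
      (h3.log (by positivity)).const_mul (1 / 4)
    have h5 : HasStrictFDerivAt
      (fun x => √(‖(f ∘ r) x‖ ^ 2) + 1 / 4 * Real.log ((1 + ‖r x‖ ^ 2) * R⁻¹)) _ x₀ := h1.add h4
    have h6 : (fun x => √(‖(f ∘ r) x‖ ^ 2) + 1 / 4 * Real.log ((1 + ‖r x‖ ^ 2) * R⁻¹)) =
        barrierFn f R ∘ r := by
      funext x
      simp [barrierFn, div_eq_mul_inv, Real.sqrt_sq (norm_nonneg _)]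
    rw [h6] at h5
    refine h5.congr_fderiv ?_
    ext w
    simp only [Function.comp_apply, hr0, Real.sqrt_sq (norm_nonneg _), add_apply,
      smul_apply, smul_eq_mul]
    field_simp
  refine localStep_of_deriv_neg (v := v) hret hΘ hΛ ?_ ?_ B β
  · simp only [Function.comp_apply, hr0, add_apply,
      smul_apply, smul_eq_mul, hPv, hQv]
    have h1 : 0 < (R / (1 + ‖x₀‖ ^ 2)) ^ ε := by positivity
    rw [div_le_iff₀ hfp] at hA
    have h2 : -(2 * ε * (inner ℂ x₀ v).re / (1 + ‖x₀‖ ^ 2)) < 2 * ε * (‖v‖ / ‖x₀‖) := by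
      rw [← neg_div, div_lt_iff₀ hq]
      have h3 := neg_abs_le (inner ℂ x₀ v).re
      have h4 : ‖v‖ / ‖x₀‖ * (1 + ‖x₀‖ ^ 2) = ‖v‖ / ‖x₀‖ + ‖x₀‖ * ‖v‖ := by
        field_simp
      have h5 : 0 < ‖v‖ / ‖x₀‖ := by positivity
      nlinarith
    have h3 : 0 < ‖v‖ / ‖x₀‖ := by positivity
    have h4 : ε * ‖f x₀‖ ≤ 1 := le_trans (by gcongr) hερ
    have h5 : ‖f x₀‖ * (‖f x₀‖ * (-(2 * ε * (inner ℂ x₀ v).re / (1 + ‖x₀‖ ^ 2)))) <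
        ‖f x₀‖ * (‖f x₀‖ * (2 * ε * (‖v‖ / ‖x₀‖))) := by gcongr
    have h6 : ‖f x₀‖ * (‖f x₀‖ * (2 * ε * (‖v‖ / ‖x₀‖))) ≤ 2 * (‖v‖ / ‖x₀‖ * ‖f x₀‖) := by
      nlinarith [mul_pos h3 hfp]
    have h7 : ‖f x₀‖ ^ 2 * ((R / (1 + ‖x₀‖ ^ 2)) ^ ε * (-ε / (1 + ‖x₀‖ ^ 2)) *
        (2 * (inner ℂ x₀ v).re)) + (R / (1 + ‖x₀‖ ^ 2)) ^ ε *
        (2 * (inner ℂ (f x₀) (fderiv ℂ f x₀ v)).re) = (R / (1 + ‖x₀‖ ^ 2)) ^ ε *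
        (‖f x₀‖ * (‖f x₀‖ * (-(2 * ε * (inner ℂ x₀ v).re / (1 + ‖x₀‖ ^ 2)))) +
        2 * (inner ℂ (f x₀) (fderiv ℂ f x₀ v)).re) := by ring
    rw [h7]
    exact mul_neg_of_pos_of_neg h1 (by linarith)
  · simp only [add_apply, smul_apply, smul_eq_mul, hPv, hQv]
    have h1 : 1 / (2 * ‖f x₀‖) * (2 * (inner ℂ (f x₀) (fderiv ℂ f x₀ v)).re) =
        (inner ℂ (f x₀) (fderiv ℂ f x₀ v)).re / ‖f x₀‖ := by field_simp
    have h2 : 1 / 4 * (1 + ‖x₀‖ ^ 2)⁻¹ * (2 * (inner ℂ x₀ v).re) ≤ 1 / 2 * (‖v‖ / ‖x₀‖) := by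
      have h3 : 1 / 4 * (1 + ‖x₀‖ ^ 2)⁻¹ * (2 * (inner ℂ x₀ v).re) =
          1 / 2 * ((inner ℂ x₀ v).re / (1 + ‖x₀‖ ^ 2)) := by ring
      rw [h3]
      refine mul_le_mul_of_nonneg_left ?_ (by norm_num)
      rw [div_le_div_iff₀ hq hx₀0]
      nlinarith [le_abs_self (inner ℂ x₀ v).re]
    have h3 : 0 < ‖v‖ / ‖x₀‖ := by positivity
    rw [h1]
    linarith

/-- A compact family in `h = 1` can be pushed arbitrarily close to `f = 0`, within a fixed
compact set and without moving the points already in `f = 0`. -/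
theorem exists_push_to_zero [FiniteDimensional ℂ E] [FiniteDimensional ℂ F]
    {D : Type*} [TopologicalSpace D] [CompactSpace D] [NormalSpace D] {n : ℕ}
    (hD : AvoidsZero D (n + 1)) (hdim : Module.finrank ℂ E = Module.finrank ℂ F + n + 1)
    {f : E → F} {h : E → ℂ} (hf : ContDiff ℂ 2 f) (hh : ContDiff ℂ 2 h) {d : ℕ} (hd : d ≠ 0)
    (hom : ∀ (c : ℂ) x, h (c • x) = c ^ d * h x) (hout : OuterDecrease f h)
    (G : C(D, E)) (hG : ∀ u, h (G u) = 1) :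
    ∃ ρ : ℝ, ∀ a > 0, ∃ G' : C(D, E), ∀ u, h (G' u) = 1 ∧ ‖f (G' u)‖ ≤ a ∧ ‖G' u‖ ≤ ρ ∧
      (f (G u) = 0 → G' u = G u) := by
  have : ProperSpace E := FiniteDimensional.proper ℂ E
  obtain ⟨b₀, hb₀⟩ := (isCompact_range ((hf.continuous.comp G.continuous).norm.pow 2)).bddAbove
  obtain ⟨ρG, hρG⟩ := (isCompact_range G.continuous.norm).bddAbove
  replace hb₀ : ∀ u, ‖f (G u)‖ ^ 2 ≤ max b₀ 0 := fun u =>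
    (hb₀ ⟨u, rfl⟩).trans (le_max_left _ _)
  replace hρG : ∀ u, ‖G u‖ ≤ ρG := fun u => hρG ⟨u, rfl⟩
  set b := max b₀ 0 with hbdef
  have hb0 : 0 ≤ b := le_max_right _ _
  set B := b + 2 with hB
  set β := √B with hβ
  have hβ1 : 0 < β := Real.sqrt_pos.2 (by linarith)
  obtain ⟨R₀', hR₀'⟩ := hout β
  set R₀ := max (max R₀' ρG) 0 with hR₀
  have hR₀0 : 0 ≤ R₀ := le_max_right _ _
  have hR₀R : R₀' ≤ R₀ := (le_max_left _ _).trans (le_max_left _ _)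
  have hρR : ρG ≤ R₀ := (le_max_right _ _).trans (le_max_left _ _)
  set R := 1 + R₀ ^ 2 with hRdef
  have hR : 0 < R := by positivity
  obtain ⟨ε, ⟨hε1, hε2, hε3⟩, hε⟩ : ∃ ε : ℝ, (R ^ ε * b < b + 1 ∧ ε * β < 1 ∧ ε < 1) ∧ 0 < ε := by
    have h1 : Tendsto (fun ε : ℝ => R ^ ε * b) (𝓝[>] 0) (𝓝 (R ^ (0 : ℝ) * b)) :=
      (((Real.continuous_const_rpow hR.ne').mul continuous_const).tendsto 0).mono_left
        nhdsWithin_le_nhds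
    have h2 : Tendsto (fun ε : ℝ => ε * β) (𝓝[>] 0) (𝓝 (0 * β)) :=
      ((continuous_id.mul continuous_const).tendsto (0 : ℝ)).mono_left nhdsWithin_le_nhds
    have h3 : Tendsto (fun ε : ℝ => ε) (𝓝[>] 0) (𝓝 0) := tendsto_id.mono_left nhdsWithin_le_nhds
    exact (((h1.eventually_lt_const (by simp)).and ((h2.eventually_lt_const (by simp)).and
      (h3.eventually_lt_const one_pos))).and self_mem_nhdsWithin).exists
  refine ⟨R * Real.exp (4 * β), fun a ha => ?_⟩
  have hc : 0 < Real.exp (4 * β) := Real.exp_pos _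
  obtain ⟨δ, hδ, hδ1, hδa⟩ : ∃ δ : ℝ, 0 < δ ∧ δ ≤ 1 ∧ (δ + δ) * Real.exp (4 * β) ≤ a ^ 2 := by
    refine ⟨min 1 (a ^ 2 / (2 * Real.exp (4 * β))), by positivity, min_le_left _ _, ?_⟩
    have h1 := min_le_right 1 (a ^ 2 / (2 * Real.exp (4 * β)))
    rw [le_div_iff₀ (by positivity)] at h1
    linarith
  have hΘc := continuous_heightFn hf.continuous hR (ε := ε)
  have hΛc := continuous_barrierFn hf.continuous hR
  set C := {x | h x = 1 ∧ δ ≤ heightFn f R ε x ∧ heightFn f R ε x ≤ b + 1 + δ ∧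
    barrierFn f R x ≤ β} with hCdef
  have hCc : IsCompact C := by
    refine Metric.isCompact_of_isClosed_isBounded ?_ ?_
    · exact (isClosed_eq hh.continuous continuous_const).inter
        ((isClosed_le continuous_const hΘc).inter ((isClosed_le hΘc continuous_const).inter
          (isClosed_le hΛc continuous_const)))
    · refine (Metric.isBounded_closedBall (x := (0 : E)) (r := R * Real.exp (4 * β))).subset ?_
      intro x hx
      have h1 := weight_le_of_barrierFn_le hR hx.2.2.2
      rw [mem_closedBall_zero_iff]
      nlinarith [sq_nonneg (‖x‖ - 1)]
  have hzero : ∀ x, f x = 0 → heightFn f R ε x = 0 := fun x hx => by simp [heightFn, hx]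
  have hstep : ∀ x ∈ C, LocalStep D {x | h x = 1} (heightFn f R ε) (barrierFn f R) B β x := by
    rintro x ⟨hx1, hx2, hx3, hx4⟩
    have hfx : f x ≠ 0 := fun h0 => by
      rw [hzero x h0] at hx2
      linarith
    rcases lt_or_ge ‖x‖ R₀ with hlt | hge
    · refine localStep_heightFn_of_concave hD hdim hf hh hd hom hR hε hx1 hfx ?_
      filter_upwards [continuous_norm.continuousAt.eventually_lt_const hlt] with y hy _ hyB
      have hyR : 1 + ‖y‖ ^ 2 ≤ R := by
        rw [hRdef]
        gcongr
      exact (barrierFn_le hR hyR).trans (Real.le_sqrt_of_sq_le ((le_heightFn hε.le hyR).trans hyB))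
    · have hxR : R ≤ 1 + ‖x‖ ^ 2 := by
        rw [hRdef]
        gcongr
      have hfβ : ‖f x‖ ≤ β := (le_barrierFn hR hxR).trans hx4
      obtain ⟨v, hv, hhv, hA⟩ := hR₀' x hx1 (hR₀R.trans hge) hfx hfβ
      exact localStep_heightFn_of_outer hf hh hd hom hR hε hx1 hfx hfβ hε2.le hv hhv hA
  have hGb : ∀ u, heightFn f R ε (G u) ≤ b + 1 := by
    intro u
    have h5 : R / (1 + ‖G u‖ ^ 2) ≤ R := div_le_self hR.le (by nlinarith [sq_nonneg ‖G u‖])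
    have h6 : heightFn f R ε (G u) ≤ b * R ^ ε := by
      unfold heightFn
      gcongr
      exact hb₀ u
    linarith
  have hGβ : ∀ u, barrierFn f R (G u) ≤ β := by
    intro u
    have h5 : 1 + ‖G u‖ ^ 2 ≤ R := by
      rw [hRdef]
      have := (hρG u).trans hρR
      gcongr
    exact (barrierFn_le hR h5).trans (Real.le_sqrt_of_sq_le (by linarith [hb₀ u]))
  obtain ⟨G', h1, h2, -, -, h3, h4⟩ := exists_push_below (S := {x | h x = 1})
    (U := {x | δ / 2 < heightFn f R ε x}) (C := C) (Θ := heightFn f R ε) (Λ := barrierFn f R)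
    (a := δ) (b := b + 1) (B := B) (β := β) (δ := δ) (κ := fun _ : D => 1)
    (isOpen_lt continuous_const hΘc) hCc (fun x hx => lt_of_lt_of_le (by linarith) hx.2.1) hstep
    (fun x hx h1 h2 h3 => ⟨hx, h1, h2, h3⟩) hδ (by linarith) continuous_const
    (fun _ => ⟨zero_le_one, le_rfl⟩) G hG hGb hGβ
  refine ⟨G', fun u => ⟨h1 u, ?_, ?_, fun hu => h2 u ?_⟩⟩
  · have h5 := normSq_le_of_barrierFn_le hR hε.le hε3.le hβ1.le (h4 u)
    have h6 : heightFn f R ε (G' u) * Real.exp (4 * β) ≤ (δ + δ) * Real.exp (4 * β) := by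
      gcongr
      exact h3 u rfl
    exact abs_le_of_sq_le_sq' (by linarith) ha.le |>.2
  · have h5 := weight_le_of_barrierFn_le hR (h4 u)
    nlinarith [sq_nonneg (‖G' u‖ - 1)]
  · rw [Set.mem_ofPred_eq, hzero _ hu]
    linarith

end PushToZero

/-! ### The outer estimate for homogeneous maps -/

section Outer

theorem fderiv_apply_self_of_homogeneous {E : Type*} [NormedAddCommGroup E] [NormedSpace ℂ E]
    {g : E → ℂ} (hg : Differentiable ℂ g) {D : ℕ} (hom : ∀ (c : ℂ) x, g (c • x) = c ^ D * g x)
    (x : E) : fderiv ℂ g x x = D * g x := by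
  have h1 : HasDerivAt (fun t : ℂ => g (t • x)) (fderiv ℂ g x x) 1 := by
    have h2 : HasDerivAt (fun t : ℂ => t • x) x 1 := by
      simpa using (hasDerivAt_id (1 : ℂ)).smul_const x
    have h3 : HasFDerivAt g (fderiv ℂ g x) ((1 : ℂ) • x) := by
      rw [one_smul]
      exact (hg x).hasFDerivAt
    exact h3.comp_hasDerivAt 1 h2
  have h2 : HasDerivAt (fun t : ℂ => g (t • x)) (D * g x) 1 := by
    simp only [hom]
    simpa using (hasDerivAt_pow D (1 : ℂ)).mul_const (g x)
  exact h1.unique h2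

theorem fderiv_smul_apply_of_homogeneous {E : Type*} [NormedAddCommGroup E] [NormedSpace ℂ E]
    {g : E → ℂ} (hg : Differentiable ℂ g) {D : ℕ} (hom : ∀ (c : ℂ) x, g (c • x) = c ^ D * g x)
    (c : ℂ) (x v : E) : fderiv ℂ g (c • x) (c • v) = c ^ D * fderiv ℂ g x v := by
  have h1 : HasFDerivAt (fun y => g (c • y)) ((fderiv ℂ g (c • x)).comp
      (c • ContinuousLinearMap.id ℂ E)) x :=
    (hg (c • x)).hasFDerivAt.comp x ((hasFDerivAt_id x).const_smul c)
  have h2 : HasFDerivAt (fun y => g (c • y)) (c ^ D • fderiv ℂ g x) x := by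
    simp only [hom]
    exact (hg x).hasFDerivAt.const_mul _
  simpa using congrArg (fun T : E →L[ℂ] ℂ => T v) (h1.unique h2)

theorem exists_eq_smul_add_of_norm_le {E : Type*} [NormedAddCommGroup E] [NormedSpace ℂ E]
    (a b : E →L[ℂ] ℂ) {c : ℝ} (hc : 0 ≤ c) (h : ∀ v, b v = 0 → ‖a v‖ ≤ c * ‖v‖) :
    ∃ (l : ℂ) (w : E →L[ℂ] ℂ), a = l • b + w ∧ ‖w‖ ≤ c := by
  obtain ⟨w, hw, hwn⟩ := exists_extension_norm_eq (LinearMap.ker (b : E →ₗ[ℂ] ℂ))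
    (a.comp (LinearMap.ker (b : E →ₗ[ℂ] ℂ)).subtypeL)
  have hker : LinearMap.ker (b : E →ₗ[ℂ] ℂ) ≤ LinearMap.ker ((a - w : E →L[ℂ] ℂ) : E →ₗ[ℂ] ℂ) := by
    intro v hv
    have := hw ⟨v, hv⟩
    simp only [ContinuousLinearMap.comp_apply, Submodule.subtypeL_apply] at this
    simp [this]
  have hspan := mem_span_of_iInf_ker_le_ker (L := fun _ : Unit => (b : E →ₗ[ℂ] ℂ)) (by
    simpa using hker)
  rw [Set.range_const, Submodule.mem_span_singleton] at hspan
  obtain ⟨l, hl⟩ := hspan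
  refine ⟨l, w, ?_, ?_⟩
  · ext v
    have := LinearMap.congr_fun hl v
    simp at this
    simp [this]
  · rw [hwn]
    exact ContinuousLinearMap.opNorm_le_bound _ hc fun v => h v v.2

theorem outerDecrease_of_homogeneous {E : Type*} [NormedAddCommGroup E] [InnerProductSpace ℂ E]
    [FiniteDimensional ℂ E] {k : ℕ} {f : E → EuclideanSpace ℂ (Fin k)} {h : E → ℂ}
    (hf : ContDiff ℂ 2 f) (hh : ContDiff ℂ 2 h) {d : ℕ} (hd : d ≠ 0) {dd : Fin k → ℕ}
    (hdeg : ∀ j, d < dd j) (homf : ∀ j (c : ℂ) x, f (c • x) j = c ^ dd j * f x j)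
    (hom : ∀ (c : ℂ) x, h (c • x) = c ^ d * h x)
    (hns : ∀ x, x ≠ 0 → f x = 0 → h x = 0 → Function.Surjective (fderiv ℂ f x)) :
    OuterDecrease f h := by
  have : ProperSpace E := FiniteDimensional.proper ℂ E
  have hfj : ∀ j, Differentiable ℂ fun x => f x j := fun j => by
    have := hf.differentiable (by norm_num)
    fun_prop
  have hfd : ∀ x v j, fderiv ℂ (fun x => f x j) x v = fderiv ℂ f x v j := by
    intro x v j
    have h1 := ((EuclideanSpace.proj (𝕜 := ℂ) j).hasFDerivAt (x := f x)).comp x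
      (hf.differentiable (by norm_num) x).hasFDerivAt
    exact congrArg (fun T : E →L[ℂ] ℂ => T v) (HasFDerivAt.fderiv h1)
  let a : E → EuclideanSpace ℂ (Fin k) → E →L[ℂ] ℂ := fun x w =>
    (innerSL ℂ w).comp (fderiv ℂ f x)
  have ha : Continuous fun p : E × EuclideanSpace ℂ (Fin k) => a p.1 p.2 :=
    ((innerSL ℂ).continuous.comp continuous_snd).clm_comp
      ((hf.continuous_fderiv (by norm_num)).comp continuous_fst)
  let g : E × EuclideanSpace ℂ (Fin k) → ℝ := fun p => max ‖f p.1‖ (max ‖h p.1‖ ‖a p.1 p.2‖)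
  have hg : Continuous g := (hf.continuous.comp continuous_fst).norm.max
    ((hh.continuous.comp continuous_fst).norm.max ha.norm)
  obtain ⟨m, hm, hmg⟩ := IsCompact.exists_forall_le'
    ((isCompact_sphere (0 : E) 1).prod (isCompact_sphere (0 : EuclideanSpace ℂ (Fin k)) 1))
    hg.continuousOn (a := 0) (by
      rintro ⟨u, w⟩ ⟨hu, hw⟩
      rw [mem_sphere_zero_iff_norm] at hu hw
      have hu0 : u ≠ 0 := by
        rintro rfl
        simp at hu
      have hw0 : w ≠ 0 := by
        rintro rfl
        simp at hw
      simp only [g, lt_max_iff, norm_pos_iff]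
      by_contra! hcon
      obtain ⟨v, hv⟩ := hns u hu0 hcon.1 hcon.2.1 w
      have h1 : a u w v = 0 := by rw [hcon.2.2]; rfl
      simp only [a, ContinuousLinearMap.comp_apply, innerSL_apply_apply, hv] at h1
      exact hw0 (inner_self_eq_zero.1 h1))
  obtain ⟨Ch, hCh⟩ := (isCompact_sphere (0 : E) 1).bddAbove_image
    (hh.continuous_fderiv (by norm_num)).norm.continuousOn
  replace hCh : ∀ u : E, ‖u‖ = 1 → ‖fderiv ℂ h u‖ ≤ max Ch 0 := fun u hu =>
    (hCh ⟨u, by simpa using hu, rfl⟩).trans (le_max_left _ _)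
  set C := max Ch 0
  have hC : 0 ≤ C := le_max_right _ _
  intro r
  set D : ℝ := ∑ j, (dd j : ℝ)
  have hD : 0 ≤ D := Finset.sum_nonneg fun j _ => by positivity
  refine ⟨1 + (|r| + 1) / m + ((D * |r| + 1) * C + 1) / m, fun x hx hR hfx hfr => ?_⟩
  by_contra! hcon
  set R := ‖x‖ with hRdef
  have hR1 : 1 ≤ R := by
    have : 0 ≤ (|r| + 1) / m := by positivity
    have : 0 ≤ ((D * |r| + 1) * C + 1) / m := by positivity
    linarith
  have hR2 : |r| + 1 < R * m := by
    rw [← div_lt_iff₀ hm]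
    have : 0 ≤ ((D * |r| + 1) * C + 1) / m := by positivity
    linarith
  have hR3 : (D * |r| + 1) * C + 1 < R * m := by
    rw [← div_lt_iff₀ hm]
    have : 0 ≤ (|r| + 1) / m := by positivity
    linarith
  have hR0 : 0 < R := by linarith
  have hRc : (R : ℂ) ≠ 0 := by exact_mod_cast hR0.ne'
  have hfp : 0 < ‖f x‖ := norm_pos_iff.2 hfx
  have hfr' : ‖f x‖ ≤ |r| := hfr.trans (le_abs_self r)
  set u : E := ((R : ℂ)⁻¹) • x with hu
  have hxu : x = (R : ℂ) • u := by rw [hu, smul_inv_smul₀ hRc]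
  have hun : ‖u‖ = 1 := by
    rw [hu, norm_smul, norm_inv, Complex.norm_real, norm_norm, inv_mul_cancel₀ hR0.ne']
  -- the unit functional in the direction of `f x`
  set w : EuclideanSpace ℂ (Fin k) := ((‖f x‖ : ℂ)⁻¹) • f x with hw
  have hwn : ‖w‖ = 1 := by
    rw [hw, norm_smul, norm_inv, Complex.norm_real, norm_norm, inv_mul_cancel₀ hfp.ne']
  have haw : ∀ v, (inner ℂ (f x) (fderiv ℂ f x v)).re / ‖f x‖ = (a x w v).re := by
    intro v
    simp only [a, hw, ContinuousLinearMap.comp_apply, innerSL_apply_apply, inner_smul_left,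
      map_inv₀,
      Complex.conj_ofReal]
    rw [← Complex.ofReal_inv, Complex.re_ofReal_mul, div_eq_inv_mul]
  have hbound : ∀ v, fderiv ℂ h x v = 0 → ‖a x w v‖ ≤ 1 / R * ‖v‖ := by
    intro v hv
    by_contra! hlt
    have hpos : 0 < ‖a x w v‖ := lt_of_le_of_lt (by positivity) hlt
    have hv0 : v ≠ 0 := by
      rintro rfl
      simp at hpos
    set c : ℂ := -(starRingEnd ℂ (a x w v)) / ‖a x w v‖ with hc
    have hne : (‖a x w v‖ : ℂ) ≠ 0 := by exact_mod_cast hpos.ne'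
    have hcn : ‖c‖ = 1 := by
      rw [hc, norm_div, norm_neg, RCLike.norm_conj, Complex.norm_real, norm_norm, div_self hpos.ne']
    have hc0 : c ≠ 0 := by
      intro h0
      simp [h0] at hcn
    have h1 := hcon (c • v) (smul_ne_zero hc0 hv0) (by rw [map_smul, hv, smul_zero])
    rw [haw, map_smul, smul_eq_mul, norm_smul, hcn, one_mul] at h1
    have h2 : c * a x w v = -(‖a x w v‖ : ℂ) := by
      rw [hc, neg_div, neg_mul, div_mul_eq_mul_div, Complex.conj_mul', neg_inj, sq,
        mul_div_cancel_right₀ _ hne]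
    rw [h2, Complex.neg_re, Complex.ofReal_re] at h1
    rw [one_div, inv_mul_eq_div] at hlt
    linarith
  obtain ⟨l, w', hl, hw'⟩ := exists_eq_smul_add_of_norm_le _ _ (by positivity) hbound
  have hwR : ‖w'‖ ≤ 1 := hw'.trans ((div_le_one hR0).2 hR1)
  -- the bound on the multiplier from Euler's identity
  have hlb : ‖l‖ ≤ D * |r| + 1 := by
    have h1 : a x w x = l * d + w' x := by
      conv_lhs => rw [hl]
      simp [fderiv_apply_self_of_homogeneous (hh.differentiable (by norm_num)) hom, hx]
    have h2 : ‖a x w x‖ ≤ D * |r| := by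
      simp only [a, ContinuousLinearMap.comp_apply, innerSL_apply_apply]
      refine (norm_inner_le_norm _ _).trans ?_
      rw [hwn, one_mul]
      have h3 : fderiv ℂ f x x = ∑ j, EuclideanSpace.single j ((dd j : ℂ) * f x j) := by
        ext i
        rw [← hfd, fderiv_apply_self_of_homogeneous (hfj i) (homf i)]
        simp [Finset.sum_apply]
      rw [h3, Finset.sum_mul]
      refine (norm_sum_le _ _).trans (Finset.sum_le_sum fun j _ => ?_)
      rw [PiLp.norm_single, norm_mul, Complex.norm_natCast]
      gcongr
      exact (PiLp.norm_apply_le _ _).trans hfr'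
    have h3 : ‖w' x‖ ≤ 1 := by
      refine (w'.le_opNorm x).trans ?_
      calc ‖w'‖ * ‖x‖ ≤ 1 / R * R := by gcongr
        _ = 1 := by field_simp
    have h4 : ‖l * d‖ ≤ D * |r| + 1 := by
      rw [show l * d = a x w x - w' x by rw [h1]; ring]
      exact (norm_sub_le _ _).trans (add_le_add h2 h3)
    rw [norm_mul, Complex.norm_natCast] at h4
    have h5 : (1 : ℝ) ≤ d := by exact_mod_cast Nat.one_le_iff_ne_zero.2 hd
    nlinarith [norm_nonneg l]
  obtain ⟨e, he⟩ : ∃ e, d = e + 1 := Nat.exists_eq_succ_of_ne_zero hd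
  -- scaling back to the unit sphere
  have hb : ‖fderiv ℂ h x‖ ≤ R ^ e * C := by
    refine ContinuousLinearMap.opNorm_le_bound _ (by positivity) fun v => ?_
    have h1 := fderiv_smul_apply_of_homogeneous (hh.differentiable (by norm_num)) hom (R : ℂ) u
      ((R : ℂ)⁻¹ • v)
    rw [← hxu, smul_inv_smul₀ hRc] at h1
    rw [h1, map_smul, smul_eq_mul, norm_mul, norm_mul, norm_pow, norm_inv, Complex.norm_real,
      Real.norm_of_nonneg hR0.le, he]
    have h2 := (fderiv ℂ h u).le_opNorm v
    calc R ^ (e + 1) * (R⁻¹ * ‖fderiv ℂ h u v‖) = R ^ e * ‖fderiv ℂ h u v‖ := by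
          field_simp
          ring
      _ ≤ R ^ e * (C * ‖v‖) := by
          gcongr
          exact h2.trans (by gcongr; exact hCh u hun)
      _ = R ^ e * C * ‖v‖ := by ring
  set w₁ : EuclideanSpace ℂ (Fin k) := WithLp.toLp 2 fun j => (R : ℂ) ^ (dd j - 1) * w j with hw₁
  have ha₁ : a x w = a u w₁ := by
    ext v
    simp only [a, ContinuousLinearMap.comp_apply, innerSL_apply_apply, PiLp.inner_apply,
      RCLike.inner_apply, hw₁]
    refine Finset.sum_congr rfl fun j _ => ?_
    have h1 := fderiv_smul_apply_of_homogeneous (hfj j) (homf j) (R : ℂ) u ((R : ℂ)⁻¹ • v)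
    rw [← hxu, smul_inv_smul₀ hRc, hfd, hfd, map_smul] at h1
    obtain ⟨q, hq⟩ : ∃ q, dd j = q + 1 := Nat.exists_eq_succ_of_ne_zero (by have := hdeg j; omega)
    rw [h1, hq]
    simp only [PiLp.smul_apply, smul_eq_mul, map_mul, map_pow, Complex.conj_ofReal,
      Nat.add_sub_cancel, pow_succ]
    field_simp
  have hw₁n : R ^ d ≤ ‖w₁‖ := by
    refine le_of_sq_le_sq ?_ (norm_nonneg _)
    have h1 : (R ^ d) ^ 2 = ∑ j, (R ^ d) ^ 2 * ‖w j‖ ^ 2 := by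
      rw [← Finset.mul_sum, ← EuclideanSpace.norm_sq_eq, hwn]
      ring
    rw [h1, EuclideanSpace.norm_sq_eq]
    refine Finset.sum_le_sum fun j _ => ?_
    simp only [hw₁, norm_mul, norm_pow, Complex.norm_real, Real.norm_of_nonneg hR0.le, mul_pow]
    have h2 : d ≤ dd j - 1 := by have := hdeg j; omega
    gcongr
  have hw₁p : 0 < ‖w₁‖ := lt_of_lt_of_le (by positivity) hw₁n
  have hma : m * ‖w₁‖ ≤ ‖a u w₁‖ := by
    have h1 := hmg (u, ((‖w₁‖ : ℂ)⁻¹) • w₁) ⟨by simpa using hun, by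
      simp [norm_smul, inv_mul_cancel₀ hw₁p.ne']⟩
    have h2 : ‖f u‖ < m := by
      have h3 : ‖f u‖ ≤ R⁻¹ * |r| := by
        have h4 : ‖f u‖ ≤ ‖(((R : ℂ)⁻¹) • f x : EuclideanSpace ℂ (Fin k))‖ := by
          refine le_of_sq_le_sq ?_ (norm_nonneg _)
          rw [EuclideanSpace.norm_sq_eq, EuclideanSpace.norm_sq_eq]
          refine Finset.sum_le_sum fun j _ => ?_
          rw [hu, homf, PiLp.smul_apply, smul_eq_mul, norm_mul, norm_mul, norm_pow, norm_inv,
            Complex.norm_real, Real.norm_of_nonneg hR0.le]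
          have h5 : R⁻¹ ^ dd j ≤ R⁻¹ :=
            pow_le_of_le_one (by positivity) (inv_le_one_of_one_le₀ hR1)
              (by have := hdeg j; omega)
          gcongr
        refine h4.trans ?_
        rw [norm_smul, norm_inv, Complex.norm_real, Real.norm_of_nonneg hR0.le]
        gcongr
      refine h3.trans_lt ?_
      rw [inv_mul_lt_iff₀ hR0]
      linarith
    have h3 : ‖h u‖ < m := by
      rw [hu, hom, hx, mul_one, norm_pow, norm_inv, Complex.norm_real, Real.norm_of_nonneg hR0.le]
      refine (pow_le_of_le_one (by positivity) (inv_le_one_of_one_le₀ hR1) hd).trans_lt ?_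
      rw [inv_lt_iff_one_lt_mul₀ hR0]
      linarith [abs_nonneg r]
    simp only [g, le_max_iff] at h1
    have h4 := (h1.resolve_left h2.not_ge).resolve_left h3.not_ge
    have h5 : ‖a u (((‖w₁‖ : ℂ)⁻¹) • w₁)‖ ≤ ‖w₁‖⁻¹ * ‖a u w₁‖ := by
      refine ContinuousLinearMap.opNorm_le_bound _ (by positivity) fun v => ?_
      simp only [a, ContinuousLinearMap.comp_apply, innerSL_apply_apply, inner_smul_left, norm_mul,
        RCLike.norm_conj, norm_inv, Complex.norm_real, norm_norm]
      have := (a u w₁).le_opNorm v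
      simp only [a, ContinuousLinearMap.comp_apply, innerSL_apply_apply] at this
      rw [mul_assoc]
      gcongr
    have h6 := h4.trans h5
    rw [le_inv_mul_iff₀ hw₁p] at h6
    linarith
  have hup : ‖a u w₁‖ ≤ (D * |r| + 1) * (R ^ e * C) + 1 := by
    rw [← ha₁, hl]
    refine (norm_add_le _ _).trans (add_le_add ?_ hwR)
    rw [norm_smul]
    gcongr
  have hRe : 1 ≤ R ^ e := one_le_pow₀ hR1
  have hfin : m * R ^ (e + 1) ≤ ((D * |r| + 1) * C + 1) * R ^ e := by
    rw [he] at hw₁n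
    nlinarith
  rw [pow_succ] at hfin
  nlinarith

end Outer

/-! ### Local retractions onto regular level sets, and gluing of retractions -/

section Regular

variable {E F : Type*} [NormedAddCommGroup E] [NormedSpace ℝ E] [CompleteSpace E]
  [NormedAddCommGroup F] [NormedSpace ℝ F] [FiniteDimensional ℝ F]

/-- Near a regular point of a level set there is a local retraction onto the level set, whose
derivative is a projection onto the kernel. -/
theorem exists_isLocalRetraction_of_surjective {Φ : E → F} {Φ' : E →L[ℝ] F} {x₀ : E}
    (hΦ : HasStrictFDerivAt Φ Φ' x₀) (hs : Function.Surjective Φ') :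
    ∃ r R, IsLocalRetraction {x | Φ x = Φ x₀} r R x₀ ∧ r x₀ = x₀ ∧ ∀ v, Φ' v = 0 → R v = v := by
  obtain ⟨σ, hσ⟩ := Φ'.exists_rightInverse_of_surjective (LinearMap.range_eq_top.2 hs)
  have hσ' : ∀ w, Φ' (σ w) = w := fun w => by
    simpa using DFunLike.congr_fun hσ w
  set A : E → E := fun x => x - σ (Φ' (x - x₀)) with hA
  set g : E → E := fun x => A x + σ (Φ x - Φ x₀) with hg
  have hA' : ∀ x, HasStrictFDerivAt A (ContinuousLinearMap.id ℝ E - σ ∘L Φ') x := fun x =>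
    (hasStrictFDerivAt_id x).sub ((σ ∘L Φ').hasStrictFDerivAt.comp x
      ((hasStrictFDerivAt_id x).sub_const x₀))
  have hg' : HasStrictFDerivAt g ((ContinuousLinearEquiv.refl ℝ E : E ≃L[ℝ] E) : E →L[ℝ] E) x₀ := by
    have h1 := (hA' x₀).add (σ.hasStrictFDerivAt.comp x₀ (hΦ.sub_const (Φ x₀)))
    have h2 : ContinuousLinearMap.id ℝ E - σ ∘L Φ' + σ ∘L Φ' =
        ((ContinuousLinearEquiv.refl ℝ E : E ≃L[ℝ] E) : E →L[ℝ] E) := by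
      ext; simp
    rw [h2] at h1
    exact h1
  have hA0 : A x₀ = x₀ := by simp [hA]
  have hg0 : g x₀ = x₀ := by simp [hg, hA0]
  set q := hg'.localInverse g _ x₀ with hq
  have hAt : Tendsto A (𝓝 x₀) (𝓝 (g x₀)) := by
    have := (hA' x₀).continuousAt
    rw [ContinuousAt, hA0, ← hg0] at this
    rwa [hg0] at this ⊢
  refine ⟨q ∘ A, ContinuousLinearMap.id ℝ E - σ ∘L Φ', ⟨?_, ?_, ?_, ?_⟩, ?_, ?_⟩
  · have h1 : HasStrictFDerivAt q (ContinuousLinearMap.id ℝ E) (A x₀) := by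
      have h2 := hg'.to_localInverse
      rw [hg0] at h2
      rw [hA0]
      exact h2
    have h3 := h1.comp x₀ (hA' x₀)
    rw [ContinuousLinearMap.id_comp] at h3
    exact h3
  · have h1 : ∀ᶠ z in 𝓝 (g x₀), ContinuousAt q z := by
      have := (hg'.toOpenPartialHomeomorph g).open_target.mem_nhds
        hg'.image_mem_toOpenPartialHomeomorph_target
      filter_upwards [this] with z hz
      exact (hg'.toOpenPartialHomeomorph g).continuousAt_symm hz
    filter_upwards [hAt.eventually h1] with y hy
    exact ContinuousAt.comp (f := A) hy (hA' y).continuousAt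
  · filter_upwards [hAt.eventually hg'.eventually_right_inverse] with y hy
    change g (q (A y)) = A y at hy
    have h1 : Φ' (g (q (A y)) - x₀) = Φ (q (A y)) - Φ x₀ := by
      simp [hg, hA, hσ']
    rw [hy] at h1
    have h2 : Φ' (A y - x₀) = 0 := by simp [hA, hσ']
    rw [h2] at h1
    exact (sub_eq_zero.1 h1.symm)
  · filter_upwards [hg'.eventually_left_inverse] with y hy hyS
    change q (g y) = y at hy
    have : g y = A y := by
      have h1 : Φ y = Φ x₀ := hyS
      simp only [hg, h1, sub_self, map_zero, add_zero]
    rwa [this] at hy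
  · change q (A x₀) = x₀
    rw [hA0]
    nth_rewrite 1 [← hg0]
    exact hg'.localInverse_apply_image
  · intro v hv
    simp [hv]

end Regular

section Gluing

variable {E : Type*} [NormedAddCommGroup E]

/-- There is a retraction onto `S` defined near `K`. -/
def HasNhdRetraction (S K : Set E) : Prop :=
  ∃ O r, IsOpen O ∧ K ⊆ O ∧ ContinuousOn r O ∧ (∀ x ∈ O, r x ∈ S) ∧ ∀ x ∈ O, x ∈ S → r x = x

theorem HasNhdRetraction.mono {S K K' : Set E} (h : HasNhdRetraction S K) (hK : K' ⊆ K) :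
    HasNhdRetraction S K' := by
  obtain ⟨O, r, hO, hKO, h1⟩ := h
  exact ⟨O, r, hO, hK.trans hKO, h1⟩

variable [NormedSpace ℝ E]

theorem HasNhdRetraction.union {S K₁ K₂ : Set E} (h₁ : HasNhdRetraction S K₁)
    (h₂ : HasNhdRetraction S K₂) (hS₁ : K₁ ⊆ S) (hK₂ : IsClosed K₂) :
    HasNhdRetraction S (K₁ ∪ K₂) := by
  obtain ⟨O₁, r₁, hO₁, hKO₁, hc₁, hm₁, he₁⟩ := h₁
  obtain ⟨O₂, r₂, hO₂, hKO₂, hc₂, hm₂, he₂⟩ := h₂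
  obtain ⟨W, hW, hKW, hWO⟩ := normal_exists_closure_subset hK₂ hO₂ hKO₂
  obtain ⟨V, hV, hKV, hVW⟩ := normal_exists_closure_subset hK₂ hW hKW
  obtain ⟨χ, hχ0, hχ1, hχ⟩ := exists_continuous_zero_one_of_isClosed
    (isClosed_compl_iff.2 hW) (isClosed_closure (s := V))
    (Set.disjoint_left.2 fun x hx hx' => hx (hVW hx'))
  set s : E → E := fun x => x + χ x • (r₂ x - x) with hs
  have hsc : Continuous s := by
    rw [continuous_iff_continuousAt]
    intro x
    by_cases hx : x ∈ closure W
    · have := (hc₂.continuousAt (hO₂.mem_nhds (hWO hx)))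
      exact continuousAt_id.add (χ.continuous.continuousAt.smul (this.sub continuousAt_id))
    · have : s =ᶠ[𝓝 x] id := by
        filter_upwards [isClosed_closure.isOpen_compl.mem_nhds hx] with y hy
        have : χ y = 0 := hχ0 fun hy' => hy (subset_closure hy')
        simp [hs, this]
      exact continuousAt_id.congr this.symm
  have hsV : ∀ x ∈ V, s x = r₂ x := fun x hx => by
    have : χ x = 1 := hχ1 (subset_closure hx)
    simp [hs, this]
  have hsS : ∀ x ∈ S, s x = x := fun x hx => by
    by_cases hx' : x ∈ W
    · simp [hs, he₂ x (hWO (subset_closure hx')) hx]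
    · have : χ x = 0 := hχ0 hx'
      simp [hs, this]
  have hVO : V ⊆ O₂ := subset_closure.trans (hVW.trans (subset_closure.trans hWO))
  classical
  set r : E → E := fun x => if s x ∈ O₁ then r₁ (s x) else s x with hr
  have hrV : ∀ x ∈ V, r x = s x := fun x hx => by
    simp only [hr]
    split_ifs with h
    · exact he₁ _ h (by rw [hsV x hx]; exact hm₂ x (hVO hx))
    · rfl
  refine ⟨s ⁻¹' O₁ ∪ V, r, (hO₁.preimage hsc).union hV, ?_, ?_, ?_, ?_⟩
  · rintro x (hx | hx)
    · left
      rw [Set.mem_preimage, hsS x (hS₁ hx)]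
      exact hKO₁ hx
    · exact Or.inr (hKV hx)
  · rintro x (hx | hx)
    · have h1 : ContinuousAt (fun x => r₁ (s x)) x :=
        ContinuousAt.comp (f := s) (hc₁.continuousAt (hO₁.mem_nhds hx)) hsc.continuousAt
      refine (h1.congr ?_).continuousWithinAt
      filter_upwards [(hO₁.preimage hsc).mem_nhds hx] with y hy
      exact (if_pos hy).symm
    · refine (hsc.continuousAt.congr ?_).continuousWithinAt
      filter_upwards [hV.mem_nhds hx] with y hy
      exact (hrV y hy).symm
  · rintro x (hx | hx)
    · simp only [hr, if_pos (Set.mem_preimage.1 hx)]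
      exact hm₁ _ hx
    · rw [hrV x hx, hsV x hx]
      exact hm₂ x (hVO hx)
  · rintro x - hx
    have h1 := hsS x hx
    simp only [hr, h1]
    split_ifs with h
    · exact he₁ x h hx
    · rfl

theorem HasNhdRetraction.of_isCompact {S K : Set E} (hS : IsClosed S) (hK : IsCompact K)
    (hKS : K ⊆ S) (h : ∀ x ∈ K, ∃ r R, IsLocalRetraction S r R x) : HasNhdRetraction S K := by
  have key : ∃ K', K ⊆ K' ∧ IsClosed K' ∧ K' ⊆ S ∧ HasNhdRetraction S K' := by
    refine hK.induction_on (p := fun s => ∃ K', s ⊆ K' ∧ IsClosed K' ∧ K' ⊆ S ∧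
      HasNhdRetraction S K') ?_ ?_ ?_ ?_
    · exact ⟨∅, subset_rfl, isClosed_empty, Set.empty_subset _, ∅, id, isOpen_empty, subset_rfl,
        continuousOn_id, by simp, by simp⟩
    · rintro s t hst ⟨K', h1, h2⟩
      exact ⟨K', hst.trans h1, h2⟩
    · rintro s t ⟨K₁, h1, h2, h3, h4⟩ ⟨K₂, k1, k2, k3, k4⟩
      exact ⟨K₁ ∪ K₂, Set.union_subset_union h1 k1, h2.union k2, Set.union_subset h3 k3,
        h4.union k4 h3 k2⟩
    · intro x hx
      obtain ⟨r, R, hr⟩ := h x hx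
      obtain ⟨ε, hε, H⟩ := Metric.eventually_nhds_iff.1
        (hr.continuousAt.and (hr.mem.and hr.eq_self))
      refine ⟨Metric.closedBall x (ε / 2) ∩ K,
        Filter.inter_mem (mem_nhdsWithin_of_mem_nhds (Metric.closedBall_mem_nhds x (by linarith)))
          self_mem_nhdsWithin, S ∩ Metric.closedBall x (ε / 2), ?_,
        hS.inter Metric.isClosed_closedBall, Set.inter_subset_left,
        Metric.ball x ε, r, Metric.isOpen_ball, ?_, ?_, ?_, ?_⟩
      · exact fun y hy => ⟨hKS hy.2, hy.1⟩
      · exact fun y hy => Metric.closedBall_subset_ball (by linarith) hy.2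
      · exact fun y hy => (H hy).1.continuousWithinAt
      · exact fun y hy => (H hy).2.1
      · exact fun y hy => (H hy).2.2
  obtain ⟨K', h1, -, -, h2⟩ := key
  exact h2.mono h1

end Gluing

/-! ### Critical values of a bihomogeneous distance function -/

section Algebra

open scoped IntermediateField.algebraAdjoinAdjoin TensorProduct in
/-- In characteristic zero, an element killed by all derivations is algebraic. -/
theorem isAlgebraic_of_forall_derivation_eq_zero {K L : Type*} [Field K] [Field L] [CharZero K]
    [Algebra K L] {g : L} (h : ∀ D : Derivation K L L, D g = 0) : IsAlgebraic K g := by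
  by_contra hg
  have hg' : AlgebraicIndepOn K id {g} :=
    (algebraicIndependent_singleton_iff (⟨g, rfl⟩ : ({g} : Set L))).2 hg
  obtain ⟨t, hgt, ht⟩ := exists_isTranscendenceBasis_superset hg'
  have hgt' : g ∈ t := hgt rfl
  set v : t → L := Subtype.val with hv
  let A := Algebra.adjoin K (Set.range v)
  let Q := IntermediateField.adjoin K (Set.range v)
  have : Algebra.FormallyEtale A Q := .of_isLocalization (nonZeroDivisors _)
  have : Algebra.IsAlgebraic Q L := ht.isAlgebraic_field
  have : Algebra.FormallyEtale Q L := Algebra.FormallyEtale.of_isSeparable _ L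
  have : Algebra.FormallyEtale A L := .comp _ Q _
  classical
  let e : MvPolynomial t K ≃ₐ[K] A := ht.1.aevalEquiv
  let δ : Derivation K A L := Derivation.mk'
    ((Algebra.linearMap A L).restrictScalars K ∘ₗ e.toLinearMap ∘ₗ
      (pderiv (⟨g, hgt'⟩ : t)).toLinearMap ∘ₗ e.symm.toLinearMap) (by
        intro a b
        simp [Algebra.smul_def])
  let gA : A := ⟨g, Algebra.subset_adjoin ⟨⟨g, hgt'⟩, rfl⟩⟩
  have heg : e (X ⟨g, hgt'⟩) = gA := by
    exact Subtype.ext (ht.1.algebraMap_aevalEquiv _ |>.trans (aeval_X _ _))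
  have hδ : δ gA = 1 := by
    have : δ gA = algebraMap A L (e (pderiv (⟨g, hgt'⟩ : t) (e.symm gA))) := rfl
    rw [this, ← heg, e.symm_apply_apply, pderiv_X_self, map_one, map_one]
  let T := (KaehlerDifferential.tensorKaehlerEquivOfFormallyEtale K A L).symm
  let ℓ : L ⊗[A] Ω[A⁄K] →ₗ[L] L := LinearMap.liftBaseChange L δ.liftKaehlerDifferential
  have h1 := h ((ℓ ∘ₗ T.toLinearMap).compDer (KaehlerDifferential.D K L))
  have h2 : T (KaehlerDifferential.D K L g) = 1 ⊗ₜ KaehlerDifferential.D K A gA :=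
    KaehlerDifferential.tensorKaehlerEquivOfFormallyEtale_symm_D_algebraMap K A L gA
  have h3 : ℓ (T (KaehlerDifferential.D K L g)) = 1 := by
    rw [h2]
    simp [ℓ, hδ]
  exact one_ne_zero (h3.symm.trans h1)

theorem Derivation.apply_aeval_mvPolynomial {K L σ : Type*} [Fintype σ] [CommRing K] [CommRing L]
    [Algebra K L] (D : Derivation K L L) (x : σ → L) (F : MvPolynomial σ K) :
    D (aeval x F) = ∑ i, aeval x (pderiv i F) * D (x i) := by
  classical
  induction F using MvPolynomial.induction_on with
  | C a => simp
  | add p q hp hq => simp [hp, hq, add_mul, Finset.sum_add_distrib]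
  | mul_X p j hp =>
    have h1 : ∀ i, aeval x (pderiv i (p * X j)) * D (x i) =
        aeval x p * (if i = j then D (x i) else 0) + x j * (aeval x (pderiv i p) * D (x i)) := by
      intro i
      by_cases hij : i = j
      · subst hij
        simp [Derivation.leibniz]
        ring
      · rw [Derivation.leibniz, pderiv_X_of_ne (Ne.symm hij)]
        simp [hij]
        ring
    simp only [h1, Finset.sum_add_distrib, ← Finset.mul_sum, ← hp]
    simp [Derivation.leibniz]

section CriticalValues

variable {R σ ι : Type*} [CommRing R] [Algebra ℂ R] [Fintype σ] [Fintype ι]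

theorem sum_mul_derivation_eq_zero {L : Type*} [Field L] [Algebra ℂ L] (ψ : R →ₐ[ℂ] L)
    (D : Derivation ℂ L L) (z : σ → R) (P : ι → MvPolynomial σ ℂ) (c : ι → R)
    (hP : ∀ j, aeval z (P j) = 0) :
    ∑ i, ψ (∑ j, c j * aeval z (pderiv i (P j))) * D (ψ (z i)) = 0 := by
  have hψ : ∀ P : MvPolynomial σ ℂ, ψ (aeval z P) = aeval (fun i => ψ (z i)) P :=
    fun P => by rw [← MvPolynomial.comp_aeval_apply]
  have hker : ∀ j, ∑ i, ψ (aeval z (pderiv i (P j))) * D (ψ (z i)) = 0 := by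
    intro j
    have h1 := D.apply_aeval_mvPolynomial (fun i => ψ (z i)) (P j)
    rw [← hψ, hP, map_zero, map_zero] at h1
    simpa only [hψ] using h1.symm
  simp only [map_sum, map_mul, Finset.sum_mul]
  rw [Finset.sum_comm]
  refine Finset.sum_eq_zero fun j _ => ?_
  simp only [mul_assoc, ← Finset.mul_sum, hker, mul_zero]

/-- The function `∑ (xᵢ - pᵢ) (yᵢ - qᵢ)` is algebraic at the points where `y - q` is a combination
of the differentials of equations satisfied by `x` and conversely. -/
theorem isAlgebraic_critical_value {L : Type*} [Field L] [Algebra ℂ L] (ψ : R →ₐ[ℂ] L)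
    (F G : ι → MvPolynomial σ ℂ) (p q : σ → ℂ) (x y : σ → R)
    (lam mu : ι → R) (hx : ∀ j, aeval x (F j) = 0) (hy : ∀ j, aeval y (G j) = 0)
    (hxy : ∀ i, y i - algebraMap ℂ R (q i) = ∑ j, lam j * aeval x (pderiv i (F j)))
    (hyx : ∀ i, x i - algebraMap ℂ R (p i) = ∑ j, mu j * aeval y (pderiv i (G j))) :
    IsAlgebraic ℂ
      (ψ (∑ i, (x i - algebraMap ℂ R (p i)) * (y i - algebraMap ℂ R (q i)))) := by
  apply isAlgebraic_of_forall_derivation_eq_zero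
  intro D
  have h1 := sum_mul_derivation_eq_zero ψ D x F lam hx
  have h2 := sum_mul_derivation_eq_zero ψ D y G mu hy
  simp only [← hxy] at h1
  simp only [← hyx] at h2
  rw [map_sum, map_sum]
  have h3 : ∀ i, D (ψ ((x i - algebraMap ℂ R (p i)) * (y i - algebraMap ℂ R (q i)))) =
      ψ (y i - algebraMap ℂ R (q i)) * D (ψ (x i)) +
      ψ (x i - algebraMap ℂ R (p i)) * D (ψ (y i)) := by
    intro i
    rw [map_mul, D.leibniz, map_sub ψ, map_sub ψ, AlgHom.commutes, AlgHom.commutes, map_sub,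
      map_sub, Derivation.map_algebraMap, Derivation.map_algebraMap]
    simp only [sub_zero, smul_eq_mul]
    ring
  simp only [h3, Finset.sum_add_distrib, h1, h2, add_zero]

/-- The function `∑ (xᵢ - pᵢ) (yᵢ - qᵢ)` takes only finitely many values at the points where
`y - q` is a combination of the differentials of equations satisfied by `x` and conversely. -/
theorem finite_range_critical_value [IsNoetherianRing R]
    (F G : ι → MvPolynomial σ ℂ) (p q : σ → ℂ) (x y : σ → R)
    (lam mu : ι → R) (hx : ∀ j, aeval x (F j) = 0) (hy : ∀ j, aeval y (G j) = 0)
    (hxy : ∀ i, y i - algebraMap ℂ R (q i) = ∑ j, lam j * aeval x (pderiv i (F j)))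
    (hyx : ∀ i, x i - algebraMap ℂ R (p i) = ∑ j, mu j * aeval y (pderiv i (G j))) :
    (Set.range fun φ : R →ₐ[ℂ] ℂ =>
      φ (∑ i, (x i - algebraMap ℂ R (p i)) * (y i - algebraMap ℂ R (q i)))).Finite := by
  set g := ∑ i, (x i - algebraMap ℂ R (p i)) * (y i - algebraMap ℂ R (q i)) with hg
  have key : ∀ Q : Ideal R, Q.IsPrime → ∃ c : ℂ, g - algebraMap ℂ R c ∈ Q := by
    intro Q hQ
    have halg := isAlgebraic_critical_value
      ((IsScalarTower.toAlgHom ℂ (R ⧸ Q) (FractionRing (R ⧸ Q))).comp (Ideal.Quotient.mkₐ ℂ Q))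
      F G p q x y lam mu hx hy hxy hyx
    obtain ⟨c, hc⟩ := minpoly.mem_range_of_degree_eq_one ℂ _
      (IsAlgClosed.degree_eq_one_of_irreducible ℂ (minpoly.irreducible halg.isIntegral))
    refine ⟨c, ?_⟩
    rw [← hg, AlgHom.comp_apply, IsScalarTower.coe_toAlgHom',
      IsScalarTower.algebraMap_apply ℂ (R ⧸ Q)] at hc
    have h1 := IsFractionRing.injective (R ⧸ Q) (FractionRing (R ⧸ Q)) hc
    rw [← Ideal.Quotient.eq, ← Ideal.Quotient.mkₐ_eq_mk ℂ, ← h1, AlgHom.commutes]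
  choose c hc using key
  have hfin := Ideal.finite_minimalPrimes_of_isNoetherianRing R ⊥
  have := hfin.to_subtype
  refine (Set.finite_range fun Q : (⊥ : Ideal R).minimalPrimes => c Q.1 Q.2.1.1).subset ?_
  rintro _ ⟨φ, rfl⟩
  have hp : (RingHom.ker φ).IsPrime := RingHom.ker_isPrime _
  obtain ⟨Q, hQ, hQφ⟩ := Ideal.exists_minimalPrimes_le (bot_le : (⊥ : Ideal R) ≤ RingHom.ker φ)
  refine ⟨⟨Q, hQ⟩, ?_⟩
  have h1 := hQφ (hc Q hQ.1.1)
  rw [RingHom.mem_ker, map_sub, AlgHom.commutes, sub_eq_zero] at h1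
  exact h1.symm

/-- Real version: `y` is the conjugate of `x`. -/
theorem finite_sq_dist_critical (F : ι → MvPolynomial σ ℂ) (p : σ → ℂ) :
    {c : ℂ | ∃ x : σ → ℂ, ∃ lam : ι → ℂ, (∀ j, eval x (F j) = 0) ∧
      (∀ i, star (x i - p i) = ∑ j, lam j * eval x (pderiv i (F j))) ∧
      c = ∑ i, (x i - p i) * star (x i - p i)}.Finite := by
  set G : ι → MvPolynomial σ ℂ := fun j => map (starRingEnd ℂ) (F j) with hG
  let τ := (σ ⊕ σ) ⊕ (ι ⊕ ι)
  let X₁ : σ → MvPolynomial τ ℂ := fun i => X (Sum.inl (Sum.inl i))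
  let Y₁ : σ → MvPolynomial τ ℂ := fun i => X (Sum.inl (Sum.inr i))
  let L₁ : ι → MvPolynomial τ ℂ := fun i => X (Sum.inr (Sum.inl i))
  let M₁ : ι → MvPolynomial τ ℂ := fun i => X (Sum.inr (Sum.inr i))
  let s : Set (MvPolynomial τ ℂ) := Set.range (fun j => aeval X₁ (F j)) ∪
    Set.range (fun j => aeval Y₁ (G j)) ∪
    Set.range (fun i => Y₁ i - algebraMap ℂ _ (star (p i)) -
      ∑ j, L₁ j * aeval X₁ (pderiv i (F j))) ∪
    Set.range (fun i => X₁ i - algebraMap ℂ _ (p i) - ∑ j, M₁ j * aeval Y₁ (pderiv i (G j)))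
  let I := Ideal.span s
  let π : MvPolynomial τ ℂ →ₐ[ℂ] MvPolynomial τ ℂ ⧸ I := Ideal.Quotient.mkₐ ℂ I
  have hπ : ∀ a ∈ s, π a = 0 := fun a ha =>
    Ideal.Quotient.eq_zero_iff_mem.2 (Ideal.subset_span ha)
  have hπa : ∀ (z : σ → MvPolynomial τ ℂ) (P : MvPolynomial σ ℂ),
      aeval (fun i => π (z i)) P = π (aeval z P) :=
    fun z P => by rw [← MvPolynomial.comp_aeval_apply]
  have hfin := finite_range_critical_value F G p (fun i => star (p i)) (fun i => π (X₁ i))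
    (fun i => π (Y₁ i)) (fun j => π (L₁ j)) (fun j => π (M₁ j))
    (fun j => by rw [hπa]; exact hπ _ (Or.inl (Or.inl (Or.inl ⟨j, rfl⟩))))
    (fun j => by rw [hπa]; exact hπ _ (Or.inl (Or.inl (Or.inr ⟨j, rfl⟩))))
    (fun i => by
      have := hπ _ (Or.inl (Or.inr ⟨i, rfl⟩))
      rw [map_sub, map_sub, AlgHom.commutes, sub_eq_zero, map_sum] at this
      simpa only [hπa, map_mul] using this)
    (fun i => by
      have := hπ _ (Or.inr ⟨i, rfl⟩)
      rw [map_sub, map_sub, AlgHom.commutes, sub_eq_zero, map_sum] at this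
      simpa only [hπa, map_mul] using this)
  refine hfin.subset ?_
  rintro _ ⟨x, lam, hx, hlam, rfl⟩
  have hstar : ∀ P : MvPolynomial σ ℂ,
      eval (fun i => star (x i)) (map (starRingEnd ℂ) P) = star (eval x P) := by
    intro P
    rw [eval_map]
    exact (eval₂_comp_left (starRingEnd ℂ) (RingHom.id ℂ) x P).symm
  let φ₀ : MvPolynomial τ ℂ →ₐ[ℂ] ℂ :=
    aeval (Sum.elim (Sum.elim x fun i => star (x i)) (Sum.elim lam fun j => star (lam j)))
  have hφX : ∀ P : MvPolynomial σ ℂ, φ₀ (aeval X₁ P) = eval x P := fun P => by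
    rw [MvPolynomial.comp_aeval_apply X₁ φ₀]
    simp [φ₀, X₁, aeval_eq_eval]
  have hφY : ∀ P : MvPolynomial σ ℂ, φ₀ (aeval Y₁ P) = eval (fun i => star (x i)) P := fun P => by
    rw [MvPolynomial.comp_aeval_apply Y₁ φ₀]
    simp [φ₀, Y₁, aeval_eq_eval]
  have hφ : ∀ a ∈ I, φ₀ a = 0 := by
    intro a ha
    have : I ≤ RingHom.ker φ₀ := by
      rw [Ideal.span_le]
      rintro _ (((⟨j, rfl⟩ | ⟨j, rfl⟩) | ⟨i, rfl⟩) | ⟨i, rfl⟩)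
      · exact (hφX _).trans (hx j)
      · refine (hφY _).trans ?_
        rw [hstar, hx, star_zero]
      · change φ₀ _ = 0
        rw [map_sub, map_sub, map_sum, AlgHom.commutes, sub_eq_zero]
        simp only [map_mul, hφX]
        simpa [φ₀, Y₁, L₁] using hlam i
      · change φ₀ _ = 0
        rw [map_sub, map_sub, map_sum, AlgHom.commutes, sub_eq_zero]
        simp only [map_mul, hφY, hG, pderiv_map, hstar]
        have := congrArg star (hlam i)
        simpa [φ₀, X₁, M₁] using this
    exact this ha
  refine ⟨Ideal.Quotient.liftₐ I φ₀ hφ, ?_⟩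
  simp only [map_sum, map_mul, map_sub, AlgHom.commutes]
  have h1 : ∀ a, Ideal.Quotient.liftₐ I φ₀ hφ (π a) = φ₀ a := fun a => rfl
  simp only [h1]
  simp [φ₀, X₁, Y₁]

end CriticalValues

end Algebra

/-! ### Contraction of a set near finitely many points -/

section Cone

variable {E : Type*} [NormedAddCommGroup E] [InnerProductSpace ℝ E]

/-- Near `y`, there is a local retraction onto `S` and a tangent vector approaching `p`. -/
def HasInwardVector (S : Set E) (p y : E) : Prop :=
  ∃ r R v, IsLocalRetraction S r R y ∧ r y = y ∧ R v = v ∧ inner ℝ (y - p) v < 0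

theorem HasInwardVector.localStep {D : Type*} [TopologicalSpace D] {S : Set E} {p y : E}
    (h : HasInwardVector S p y) (B β : ℝ) :
    LocalStep D S (fun x => ‖x - p‖ ^ 2) (fun x => ‖x - p‖ ^ 2) B β y := by
  obtain ⟨r, R, v, hr, hry, hRv, hv⟩ := h
  have h1 := (hasStrictFDerivAt_norm_sq (r y - p)).comp y (hr.hasStrictFDerivAt.sub_const p)
  rw [hry] at h1
  have h2 : ((2 • innerSL ℝ (y - p)).comp R) v < 0 := by
    rw [inner_sub_left] at hv
    have h3 : ((2 • innerSL ℝ (y - p)).comp R) v = 2 * (inner ℝ y v - inner ℝ p v) := by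
      simp [hRv]
    linarith
  change HasStrictFDerivAt ((fun x => ‖x - p‖ ^ 2) ∘ r) _ y at h1
  exact localStep_of_deriv_neg hr h1 h1 h2 h2 B β

/-- The mask used in the `j`-th step of the contraction. -/
noncomputable def coneMask (j : ℕ) (t : ℝ) : ℝ :=
  max 0 (min 1 (2 * 2 ^ j * (t - 1) + 2))

theorem coneMask_eq_zero {j : ℕ} {t : ℝ} (h : t ≤ 1 - (1 / 2) ^ j) : coneMask j t = 0 := by
  have h1 : (1 / 2 : ℝ) ^ j * 2 ^ j = 1 := by rw [← mul_pow]; norm_num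
  have h2 : (0 : ℝ) < 2 ^ j := by positivity
  refine max_eq_left ((min_le_right _ _).trans ?_)
  nlinarith

theorem coneMask_eq_one {j : ℕ} {t : ℝ} (h : 1 - (1 / 2) ^ (j + 1) ≤ t) : coneMask j t = 1 := by
  have h1 : (1 / 2 : ℝ) ^ j * 2 ^ j = 1 := by rw [← mul_pow]; norm_num
  have h2 : (0 : ℝ) < 2 ^ j := by positivity
  rw [pow_succ] at h
  rw [coneMask, min_eq_left (by nlinarith), max_eq_right zero_le_one]

variable [FiniteDimensional ℝ E] {S : Set E} {p : E} {ρ : ℝ}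

theorem exists_coneStep {D : Type*} [TopologicalSpace D] (hS : IsClosed S)
    (H : ∀ y ∈ S, y ≠ p → ‖y - p‖ ≤ ρ → HasInwardVector S p y) {κ : D → ℝ} (hκ : Continuous κ)
    (hκ01 : ∀ u, κ u ∈ Set.Icc (0 : ℝ) 1) {a : ℝ} (ha : 0 < a) (hρ : 0 ≤ ρ) (G : C(D, E))
    (hG : ∀ u, G u ∈ S ∧ ‖G u - p‖ ≤ ρ) :
    ∃ G' : C(D, E), (∀ u, G' u ∈ S ∧ ‖G' u - p‖ ≤ ρ) ∧ (∀ u, G u = p → G' u = p) ∧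
      (∀ u, κ u = 0 → G' u = G u) ∧ (∀ u, ‖G' u - p‖ ^ 2 ≤ ‖G u - p‖ ^ 2 + a) ∧
      ∀ u, κ u = 1 → ‖G' u - p‖ ^ 2 ≤ 2 * a := by
  set Θ : E → ℝ := fun x => ‖x - p‖ ^ 2 with hΘ
  have hΘc : Continuous Θ := by fun_prop
  have hle : ∀ x, Θ x ≤ ρ ^ 2 ↔ ‖x - p‖ ≤ ρ := fun x => by
    rw [hΘ, sq_le_sq₀ (norm_nonneg _) hρ]
  have hC : IsCompact {x | x ∈ S ∧ a ≤ Θ x ∧ Θ x ≤ ρ ^ 2} := by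
    refine (isCompact_closedBall p ρ).of_isClosed_subset (hS.inter
      ((isClosed_le continuous_const hΘc).inter (isClosed_le hΘc continuous_const))) ?_
    intro x hx
    rw [mem_closedBall_iff_norm]
    exact (hle x).1 hx.2.2
  have hCU : {x | x ∈ S ∧ a ≤ Θ x ∧ Θ x ≤ ρ ^ 2} ⊆ {x | a / 2 < Θ x} := fun x hx => by
    have : a ≤ Θ x := hx.2.1
    change a / 2 < Θ x
    linarith
  have hstep : ∀ x ∈ {x | x ∈ S ∧ a ≤ Θ x ∧ Θ x ≤ ρ ^ 2},
      LocalStep D S Θ Θ (ρ ^ 2 + a) (ρ ^ 2) x := by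
    intro x hx
    refine (H x hx.1 ?_ ((hle x).1 hx.2.2)).localStep _ _
    rintro rfl
    have h1 : a ≤ Θ x := hx.2.1
    simp [hΘ] at h1
    linarith
  obtain ⟨G', h1, h2, h3, h4, h5, h6⟩ := exists_push_below (b := ρ ^ 2) (δ := a)
    (isOpen_lt continuous_const hΘc) hC hCU hstep (fun x hx h1 _ h3 => ⟨hx, h1, h3⟩) ha le_rfl
    hκ hκ01 G (fun u => (hG u).1) (fun u => (hle _).2 (hG u).2) (fun u => (hle _).2 (hG u).2)
  refine ⟨G', fun u => ⟨h1 u, (hle _).1 (h6 u)⟩, fun u hu => ?_, h3, h4, fun u hu => ?_⟩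
  · rw [h2 u, hu]
    rw [hu]
    simp only [hΘ, Set.mem_ofPred_eq, sub_self, norm_zero]
    norm_num
    linarith
  · have := h5 u hu
    linarith

open unitInterval in
theorem exists_coneContraction (hS : IsClosed S) (hρ : 0 ≤ ρ)
    (H : ∀ y ∈ S, y ≠ p → ‖y - p‖ ≤ ρ → HasInwardVector S p y) (hp : p ∈ S) :
    ∃ F : C({y : S // ‖(y : E) - p‖ ≤ ρ} × I, E), (∀ u, F u ∈ S) ∧ (∀ y, F (y, 0) = y) ∧
      (∀ y, F (y, 1) = p) ∧ ∀ u, (u.1 : E) = p → F u = p := by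
  set D := {y : S // ‖(y : E) - p‖ ≤ ρ} × I with hD
  set c : ℕ → ℝ := fun j => (1 / 2) ^ j with hc
  have hc0 : ∀ j, 0 < c j := fun j => by positivity
  have hcanti : Antitone c := pow_right_anti₀ (by norm_num) (by norm_num)
  have hclim : Tendsto c atTop (𝓝 0) :=
    tendsto_pow_atTop_nhds_zero_of_lt_one (by norm_num) (by norm_num)
  have hsnd : Continuous fun w : D => (w.2 : ℝ) := continuous_subtype_val.comp continuous_snd
  let T := {G : C(D, E) // ∀ u, G u ∈ S ∧ ‖G u - p‖ ≤ ρ}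
  have step : ∀ (j : ℕ) (G : T), ∃ G' : T, (∀ u, G.1 u = p → G'.1 u = p) ∧
      (∀ u, (u.2 : ℝ) ≤ 1 - c j → G'.1 u = G.1 u) ∧
      (∀ u, ‖G'.1 u - p‖ ^ 2 ≤ ‖G.1 u - p‖ ^ 2 + c j) ∧
      ∀ u, 1 - c (j + 1) ≤ u.2 → ‖G'.1 u - p‖ ^ 2 ≤ 2 * c j := by
    intro j G
    obtain ⟨G', h1, h2, h3, h4, h5⟩ := exists_coneStep (D := D) (κ := fun u => coneMask j u.2) hS H
      (by
        have h2 : Continuous (coneMask j) := by unfold coneMask; fun_prop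
        exact h2.comp hsnd) (fun u => ⟨le_max_left _ _, max_le zero_le_one (min_le_left _ _)⟩)
      (hc0 j) hρ G.1 G.2
    exact ⟨⟨G', h1⟩, h2, fun u hu => h3 u (coneMask_eq_zero hu), h4,
      fun u hu => h5 u (coneMask_eq_one hu)⟩
  choose next n1 n2 n3 n4 using step
  let F₀ : T := ⟨⟨fun u => u.1.1.1,
    continuous_subtype_val.comp (continuous_subtype_val.comp continuous_fst)⟩,
    fun u => ⟨u.1.1.2, u.1.2⟩⟩
  let F : ℕ → T := fun j => Nat.rec F₀ next j
  have hF : ∀ j, F (j + 1) = next j (F j) := fun j => rfl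
  have hFp : ∀ j u, (u.1 : E) = p → (F j).1 u = p := by
    intro j u hu
    induction j with
    | zero => exact hu
    | succ j ih => rw [hF]; exact n1 j _ u ih
  have hFstab : ∀ m j, m ≤ j → ∀ u, (u.2 : ℝ) ≤ 1 - c m → (F j).1 u = (F m).1 u := by
    intro m j hmj u hu
    induction j, hmj using Nat.le_induction with
    | base => rfl
    | succ j hmj ih =>
      rw [hF, n2 j _ u (hu.trans (by linarith [hcanti hmj])), ih]
  have hFsmall : ∀ i j, j < i → ∀ u, 1 - c (j + 1) ≤ u.2 → ‖(F i).1 u - p‖ ^ 2 ≤ 3 * c j := by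
    intro i
    induction i with
    | zero => intro j hj; omega
    | succ i ih =>
      intro j hj u hu
      have := hc0 j
      rcases Nat.lt_succ_iff_lt_or_eq.1 hj with hji | rfl
      · rcases le_total (u.2 : ℝ) (1 - c i) with h | h
        · rw [hF, n2 i _ u h]
          exact ih j hji u hu
        · obtain ⟨i, rfl⟩ : ∃ i', i = i' + 1 := ⟨i - 1, by omega⟩
          have h1 := n4 i (F i) u h
          have h2 := n3 (i + 1) (F (i + 1)) u
          rw [hF (i + 1)]
          rw [← hF] at h1
          have h3 := hcanti (show j ≤ i by omega)
          have h4 := hcanti (show j ≤ i + 1 by omega)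
          linarith
      · rw [hF]
        have := n4 j (F j) u hu
        linarith
  have hex : ∀ t : ℝ, t < 1 → ∃ m, t < 1 - c m := fun t ht => by
    obtain ⟨m, hm⟩ := (hclim.eventually (gt_mem_nhds (show 0 < 1 - t by linarith))).exists
    exact ⟨m, by linarith⟩
  classical
  let Φ : D → E := fun u => if h : (u.2 : ℝ) < 1 then (F (hex u.2 h).choose).1 u else p
  have hΦ : ∀ m (u : D), (u.2 : ℝ) ≤ 1 - c m → Φ u = (F m).1 u := by
    intro m u hu
    have h1 : (u.2 : ℝ) < 1 := by linarith [hc0 m]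
    have h2 := (hex u.2 h1).choose_spec
    simp only [Φ, dif_pos h1]
    rcases le_total m (hex u.2 h1).choose with h | h
    · exact hFstab _ _ h u hu
    · exact (hFstab _ _ h u h2.le).symm
  have hΦ1 : ∀ u : D, u.2 = 1 → Φ u = p := fun u hu => by
    simp [Φ, hu]
  have hlt : ∀ u : D, u.2 ≠ 1 → (u.2 : ℝ) < 1 := fun u hu =>
    lt_of_le_of_ne u.2.2.2 fun h => hu (Subtype.ext h)
  have hΦc : Continuous Φ := by
    rw [continuous_iff_continuousAt]
    intro u
    by_cases hu : u.2 = 1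
    · rw [ContinuousAt, hΦ1 u hu, tendsto_iff_norm_sub_tendsto_zero]
      have hsq : Tendsto (fun w => ‖Φ w - p‖ ^ 2) (𝓝 u) (𝓝 0) := by
        rw [Metric.tendsto_nhds]
        intro ε hε
        obtain ⟨j, hj⟩ := (hclim.eventually (gt_mem_nhds (show 0 < ε / 3 by linarith))).exists
        have h1 : ∀ᶠ w : D in 𝓝 u, 1 - c (j + 1) < w.2 := by
          refine hsnd.continuousAt.eventually (lt_mem_nhds ?_)
          simp only [hu]
          simpa using hc0 (j + 1)
        filter_upwards [h1] with w hw
        rw [Real.dist_eq, sub_zero, abs_of_nonneg (by positivity)]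
        by_cases hw1 : w.2 = 1
        · rw [hΦ1 w hw1]
          simpa using hε
        · obtain ⟨m, hm⟩ := hex _ (hlt w hw1)
          have h2 : (w.2 : ℝ) ≤ 1 - c (max m (j + 1)) := by
            have := hcanti (le_max_left m (j + 1))
            linarith
          rw [hΦ _ w h2]
          have := hFsmall (max m (j + 1)) j (by omega) w hw.le
          linarith
      have h2 := (Real.continuous_sqrt.tendsto 0).comp hsq
      rw [Real.sqrt_zero] at h2
      exact h2.congr fun w => Real.sqrt_sq (norm_nonneg _)
    · obtain ⟨m, hm⟩ := hex _ (hlt u hu)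
      have h1 : ∀ᶠ w : D in 𝓝 u, (w.2 : ℝ) < 1 - c m := by
        exact hsnd.continuousAt.eventually (gt_mem_nhds hm)
      refine (F m).1.continuous.continuousAt.congr ?_
      filter_upwards [h1] with w hw
      exact (hΦ m w hw.le).symm
  refine ⟨⟨Φ, hΦc⟩, fun u => ?_, fun y => ?_, fun y => hΦ1 _ rfl, fun u hu => ?_⟩
  · change Φ u ∈ S
    by_cases hu : u.2 = 1
    · rwa [hΦ1 u hu]
    · obtain ⟨m, hm⟩ := hex _ (hlt u hu)
      rw [hΦ m u hm.le]
      exact ((F m).2 u).1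
  · exact hΦ 0 (y, 0) (by simp [hc])
  · change Φ u = p
    by_cases hu' : u.2 = 1
    · exact hΦ1 u hu'
    · obtain ⟨m, hm⟩ := hex _ (hlt u hu')
      rw [hΦ m u hm.le]
      exact hFp m u hu

open unitInterval in
/-- A homotopy of `S` fixing a finite set `Q` and contracting a neighbourhood of `p ∈ Q` to `p`. -/
theorem exists_contraction_near (hS : IsClosed S) (hρ : 0 < ρ)
    (H : ∀ y ∈ S, y ≠ p → ‖y - p‖ ≤ ρ → HasInwardVector S p y) (hp : p ∈ S) {Q : Set E}
    (hQ : ∀ q ∈ Q, q ≠ p → ρ < ‖q - p‖) :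
    ∃ K : C(S × I, S), (∀ y, K (y, 0) = y) ∧ (∀ y : S, (y : E) ∈ Q → ∀ t, K (y, t) = y) ∧
      ∀ y : S, ‖(y : E) - p‖ ≤ ρ / 2 → (K (y, 1) : E) = p := by
  obtain ⟨F, F1, F2, F3, F4⟩ := exists_coneContraction hS hρ.le H hp
  let τ : E → I := fun y => Set.projIcc 0 1 zero_le_one (2 - 2 * ‖y - p‖ / ρ)
  have hτ : Continuous τ := continuous_projIcc.comp (by fun_prop)
  have hτ0 : ∀ y, ‖y - p‖ = ρ → τ y = 0 := fun y hy =>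
    Set.projIcc_of_le_left _ (by rw [hy, mul_div_assoc, div_self hρ.ne']; norm_num)
  have hτ1 : ∀ y, ‖y - p‖ ≤ ρ / 2 → τ y = 1 := fun y hy =>
    Set.projIcc_of_right_le _ (by
      have : 2 * ‖y - p‖ / ρ ≤ 1 := by rw [div_le_one hρ]; linarith
      linarith)
  classical
  let g : S × I → E := fun u =>
    if h : ‖(u.1 : E) - p‖ ≤ ρ then F (⟨u.1, h⟩, u.2 * τ u.1) else p
  have hg : ContinuousOn g {u | ‖(u.1 : E) - p‖ ≤ ρ} := by
    rw [continuousOn_iff_continuous_domRestrict]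
    have h1 : Continuous fun u : {u : S × I | ‖(u.1 : E) - p‖ ≤ ρ} =>
        F (⟨u.1.1, u.2⟩, u.1.2 * τ u.1.1) := by fun_prop
    convert h1 using 1
    ext u
    exact dif_pos u.2
  let k : S × I → E := fun u => if ‖(u.1 : E) - p‖ ≤ ρ then g u else u.1
  have hgF : ∀ (u : S × I) (h : ‖(u.1 : E) - p‖ ≤ ρ), k u = F (⟨u.1, h⟩, u.2 * τ u.1) :=
    fun u h => (if_pos h).trans (dif_pos h)
  have hk : Continuous k := by
    refine continuous_if_le (by fun_prop) continuous_const hg (by fun_prop) fun u hu => ?_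
    have h1 := hgF u hu.le
    rw [hτ0 _ hu, mul_zero, F2] at h1
    rw [← h1]
    exact (if_pos hu.le).symm
  have hkS : ∀ u, k u ∈ S := fun u => by
    by_cases h : ‖(u.1 : E) - p‖ ≤ ρ
    · rw [hgF u h]; exact F1 _
    · simp [k, h]
  refine ⟨⟨fun u => ⟨k u, hkS u⟩, by fun_prop⟩, fun y => ?_, fun y hy t => ?_, fun y hy => ?_⟩
  · apply Subtype.ext
    change k (y, 0) = y
    by_cases h : ‖(y : E) - p‖ ≤ ρ
    · rw [hgF (y, 0) h, zero_mul, F2]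
    · simp [k, h]
  · apply Subtype.ext
    change k (y, t) = y
    by_cases h : ‖(y : E) - p‖ ≤ ρ
    · have : (y : E) = p := by
        by_contra h1
        exact (hQ y hy h1).not_ge h
      rw [hgF (y, t) h, F4 _ this, this]
    · simp [k, h]
  · change k (y, 1) = p
    have h : ‖(y : E) - p‖ ≤ ρ := by linarith
    have h1 : (1 : I) * τ y = 1 := by rw [one_mul, hτ1 _ hy]
    refine (hgF (y, 1) h).trans ?_
    change F (⟨y, h⟩, 1 * τ y) = p
    rw [h1, F3]

open unitInterval in
/-- A homotopy of `S` fixing a finite set and contracting a neighbourhood of each point of a given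
subset `P` to this point. -/
theorem exists_contraction (hS : IsClosed S) (P : Finset E) {Q : Set E} (hQ : Q.Finite)
    (hPQ : ∀ p ∈ P, p ∈ Q)
    (H : ∀ p ∈ P, p ∈ S ∧ ∃ ε > 0, ∀ y ∈ S, y ≠ p → ‖y - p‖ ≤ ε → HasInwardVector S p y) :
    ∃ K : C(S × I, S), (∀ y, K (y, 0) = y) ∧ (∀ y : S, (y : E) ∈ Q → ∀ t, K (y, t) = y) ∧
      ∃ δ > 0, ∀ p ∈ P, ∀ y : S, ‖(y : E) - p‖ < δ → (K (y, 1) : E) = p := by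
  classical
  induction P using Finset.induction_on with
  | empty =>
    exact ⟨⟨Prod.fst, by fun_prop⟩, fun _ => rfl, fun _ _ _ => rfl, 1, one_pos, by simp⟩
  | insert p P hpP ih =>
    obtain ⟨K, K0, KQ, δ, hδ, K1⟩ := ih (fun q hq => hPQ q (Finset.mem_insert_of_mem hq))
      fun q hq => H q (Finset.mem_insert_of_mem hq)
    obtain ⟨hpS, ε, hε, Hp⟩ := H p (Finset.mem_insert_self _ _)
    have hsep : ∃ ρ > 0, ρ ≤ ε ∧ ∀ q ∈ Q, q ≠ p → ρ < ‖q - p‖ := by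
      have h1 : (Q \ {p})ᶜ ∈ 𝓝 p :=
        (hQ.subset Set.sdiff_subset).isClosed.isOpen_compl.mem_nhds (by simp)
      obtain ⟨η, hη, h2⟩ := Metric.mem_nhds_iff.1 h1
      refine ⟨min ε (η / 2), by positivity, min_le_left _ _, fun q hq hqp => ?_⟩
      by_contra! h3
      refine h2 (?_ : q ∈ Metric.ball p η) ⟨hq, hqp⟩
      rw [mem_ball_iff_norm]
      linarith [min_le_right ε (η / 2)]
    obtain ⟨ρ, hρ, hρε, hsep⟩ := hsep
    obtain ⟨L, L0, LQ, L1⟩ := exists_contraction_near hS hρ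
      (fun y hy hyp h => Hp y hy hyp (h.trans hρε)) hpS hsep
    have hpQ := hPQ p (Finset.mem_insert_self _ _)
    have h1 : ∀ᶠ y : S in 𝓝 ⟨p, hpS⟩, ‖(K (y, 1) : E) - p‖ ≤ ρ / 2 := by
      have h2 : Continuous fun y : S => ‖(K (y, 1) : E) - p‖ := by fun_prop
      have h4 : ‖(K (⟨p, hpS⟩, 1) : E) - p‖ < ρ / 2 := by
        rw [KQ _ hpQ]
        simpa using hρ
      exact h2.continuousAt.eventually (ge_mem_nhds h4)
    obtain ⟨η, hη, h3⟩ := Metric.eventually_nhds_iff.1 h1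
    refine ⟨⟨fun u => L (K u, u.2), by fun_prop⟩, fun y => ?_, fun y hy t => ?_, min δ η,
      by positivity, fun q hq y hy => ?_⟩
    · change L (K (y, 0), 0) = y
      rw [L0, K0]
    · change L (K (y, t), t) = y
      rw [KQ y hy, LQ y hy]
    · change (L (K (y, 1), 1) : E) = q
      rcases Finset.mem_insert.1 hq with rfl | hq'
      · refine L1 _ (h3 ?_)
        rw [Subtype.dist_eq, dist_eq_norm]
        exact hy.trans_le (min_le_right _ _)
      · have h4 := K1 q hq' y (hy.trans_le (min_le_left _ _))
        rw [LQ _ (by rw [h4]; exact hPQ q hq), h4]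

end Cone

section ContractionExtension

variable {E : Type*} [NormedAddCommGroup E] [InnerProductSpace ℝ E] [FiniteDimensional ℝ E]

open unitInterval in
/-- If `S` is a neighbourhood retract away from finitely many points, near which it is conical, then
the final map of some self-homotopy of `S` extends to a neighbourhood of any compact subset. -/
theorem exists_homotopy_extension {S : Set E} (hS : IsClosed S) (P : Finset E) {Q : Set E}
    (hQ : Q.Finite) (hPQ : ∀ p ∈ P, p ∈ Q)
    (H : ∀ p ∈ P, p ∈ S ∧ ∃ ε > 0, ∀ y ∈ S, y ≠ p → ‖y - p‖ ≤ ε → HasInwardVector S p y)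
    (hr : ∀ y ∈ S, y ∉ P → ∃ r R, IsLocalRetraction S r R y) {C : Set E} (hC : IsCompact C)
    (hCS : C ⊆ S) :
    ∃ K : C(S × I, S), (∀ y, K (y, 0) = y) ∧ (∀ y : S, (y : E) ∈ Q → ∀ t, K (y, t) = y) ∧
      ∃ O e, IsOpen O ∧ C ⊆ O ∧ ContinuousOn e O ∧ (∀ x ∈ O, e x ∈ S) ∧
        ∀ x (hx : x ∈ S), x ∈ O → e x = K (⟨x, hx⟩, 1) := by
  obtain ⟨K, K0, KQ, δ, hδ, K1⟩ := exists_contraction hS P hQ hPQ H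
  refine ⟨K, K0, KQ, ?_⟩
  have hU : IsOpen (⋃ p ∈ P, Metric.ball p (δ / 2)) :=
    isOpen_biUnion fun p _ => Metric.isOpen_ball
  obtain ⟨O, r, hO, hCO, hrc, hrS, hre⟩ := HasNhdRetraction.of_isCompact hS (hC.diff hU)
    (Set.sdiff_subset.trans hCS) fun y hy => hr y (hCS hy.1) fun hyP =>
      hy.2 (Set.mem_biUnion hyP (Metric.mem_ball_self (half_pos hδ)))
  have hV : IsOpen (O ∩ {x | ‖r x - x‖ < δ / 2}) := by
    have h1 : ContinuousOn (fun x => ‖r x - x‖) O := (hrc.sub continuousOn_id).norm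
    exact h1.isOpen_inter_preimage hO isOpen_Iio
  classical
  let e : E → E := fun x => if h : ∃ p ∈ P, ‖x - p‖ < δ / 2 then h.choose else
    if h : r x ∈ S then K (⟨r x, h⟩, 1) else x
  have eP : ∀ p ∈ P, ∀ x, ‖x - p‖ < δ / 2 → e x = p := by
    intro p hp x hx
    have h : ∃ p ∈ P, ‖x - p‖ < δ / 2 := ⟨p, hp, hx⟩
    have h1 : e x = h.choose := dif_pos h
    obtain ⟨h2, h3⟩ := h.choose_spec
    rw [h1]
    have h4 : ‖h.choose - p‖ < δ := by
      rw [norm_sub_rev] at h3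
      have := norm_sub_le_norm_sub_add_norm_sub h.choose x p
      linarith
    rw [← K1 p hp ⟨_, (H _ h2).1⟩ h4, KQ _ (hPQ _ h2)]
  have er : ∀ x ∈ O ∩ {x | ‖r x - x‖ < δ / 2}, ∀ hx : r x ∈ S, e x = K (⟨r x, hx⟩, 1) := by
    rintro x ⟨hxO, hxr⟩ hx
    by_cases h : ∃ p ∈ P, ‖x - p‖ < δ / 2
    · obtain ⟨p, hp, hxp⟩ := h
      have h4 : ‖r x - p‖ < δ := by
        have := norm_sub_le_norm_sub_add_norm_sub (r x) x p
        have h5 : ‖r x - x‖ < δ / 2 := hxr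
        linarith
      rw [eP p hp x hxp, K1 p hp _ h4]
    · exact (dif_neg h).trans (dif_pos hx)
  refine ⟨(O ∩ {x | ‖r x - x‖ < δ / 2}) ∪ ⋃ p ∈ P, Metric.ball p (δ / 2), e, hV.union hU,
    fun x hx => ?_, ?_, ?_, ?_⟩
  · by_cases h : x ∈ ⋃ p ∈ P, Metric.ball p (δ / 2)
    · exact Or.inr h
    · have h1 := hCO ⟨hx, h⟩
      refine Or.inl ⟨h1, ?_⟩
      change ‖r x - x‖ < δ / 2
      rw [hre x h1 (hCS hx), sub_self, norm_zero]
      positivity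
  · refine ContinuousOn.union_of_isOpen ?_ ?_ hV hU
    · rw [continuousOn_iff_continuous_domRestrict]
      have h1 : Continuous fun x : ↥(O ∩ {x | ‖r x - x‖ < δ / 2}) => r x :=
        continuousOn_iff_continuous_domRestrict.1 (hrc.mono Set.inter_subset_left)
      have h2 : Continuous fun x : ↥(O ∩ {x | ‖r x - x‖ < δ / 2}) =>
          ((K (⟨r x, hrS x x.2.1⟩, 1) : S) : E) :=
        continuous_subtype_val.comp
          (K.continuous.comp ((h1.subtype_mk _).prodMk continuous_const))
      convert h2 using 1
      ext x
      exact er x x.2 _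
    · intro x hx
      simp only [Set.mem_iUnion] at hx
      obtain ⟨p, hp, hxp⟩ := hx
      refine ContinuousAt.continuousWithinAt ?_
      refine (continuousAt_const (y := p)).congr ?_
      filter_upwards [Metric.isOpen_ball.mem_nhds hxp] with z hz
      exact (eP p hp z (mem_ball_iff_norm.1 hz)).symm
  · rintro x (hx | hx)
    · rw [er x hx (hrS x hx.1)]
      exact Subtype.coe_prop _
    · simp only [Set.mem_iUnion] at hx
      obtain ⟨p, hp, hxp⟩ := hx
      rw [eP p hp x (mem_ball_iff_norm.1 hxp)]
      exact (H p hp).1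
  · rintro x hxS (hx | hx)
    · have h1 := hre x hx.1 hxS
      rw [er x hx (hrS x hx.1)]
      simp only [h1]
    · simp only [Set.mem_iUnion] at hx
      obtain ⟨p, hp, hxp⟩ := hx
      rw [eP p hp x (mem_ball_iff_norm.1 hxp), K1 p hp]
      have := mem_ball_iff_norm.1 hxp
      change ‖x - p‖ < δ
      linarith

end ContractionExtension

section ComplexMap

attribute [local instance] InnerProductSpace.complexToReal

variable {E F : Type*} [NormedAddCommGroup E] [InnerProductSpace ℂ E]
  [NormedAddCommGroup F] [NormedSpace ℂ F]

theorem exists_isLocalRetraction_of_complex [FiniteDimensional ℂ E] [FiniteDimensional ℂ F]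
    {Φ : E → F} {Φ' : E →L[ℂ] F} {y : E} (hΦ : HasStrictFDerivAt Φ Φ' y)
    (hs : Function.Surjective Φ') :
    ∃ (r : E → E) (R : E →L[ℝ] E), IsLocalRetraction {x | Φ x = Φ y} r R y ∧ r y = y ∧
      ∀ v, Φ' v = 0 → R v = v := by
  have := FiniteDimensional.complete ℂ E
  exact exists_isLocalRetraction_of_surjective (Φ' := Φ'.restrictScalars ℝ)
    (hΦ.restrictScalars ℝ) hs

theorem hasInwardVector_of_complex [FiniteDimensional ℂ E] [FiniteDimensional ℂ F]
    {Φ : E → F} {Φ' : E →L[ℂ] F} {p y v : E} (hΦ : HasStrictFDerivAt Φ Φ' y)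
    (hs : Function.Surjective Φ') (hv : Φ' v = 0) (hv' : inner ℂ (y - p) v ≠ 0) :
    HasInwardVector {x | Φ x = Φ y} p y := by
  obtain ⟨r, R, hr, hry, hR⟩ := exists_isLocalRetraction_of_complex hΦ hs
  refine ⟨r, R, -(starRingEnd ℂ (inner ℂ (y - p) v)) • v, hr, hry, hR _ (by simp [hv]), ?_⟩
  rw [real_inner_eq_re_inner ℂ, inner_smul_right, neg_mul, ← Complex.normSq_eq_conj_mul_self]
  simpa using hv'

end ComplexMap

section HomotopyPush

attribute [local instance] InnerProductSpace.complexToReal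

variable {E F : Type*} [NormedAddCommGroup E] [InnerProductSpace ℂ E]
  [NormedAddCommGroup F] [InnerProductSpace ℂ F]

open unitInterval in
/-- Compact families in `h = 1` can be pushed into `f = 0, h = 1`, moving the points already there
by a self-homotopy of this set. -/
theorem exists_homotopy_push [FiniteDimensional ℂ E]
    [FiniteDimensional ℂ F] {n : ℕ}
    (hdim : Module.finrank ℂ E = Module.finrank ℂ F + n + 1)
    {f : E → F} {h : E → ℂ} (hf : ContDiff ℂ 2 f) (hh : ContDiff ℂ 2 h) {d : ℕ} (hd : d ≠ 0)
    (hom : ∀ (c : ℂ) x, h (c • x) = c ^ d * h x) (hout : OuterDecrease f h)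
    (P : Finset E)
    (hreg : ∀ y, f y = 0 → h y = 1 → y ∉ P →
      Function.Surjective ((fderiv ℂ f y).prod (fderiv ℂ h y)))
    (hcone : ∀ p ∈ P, f p = 0 ∧ h p = 1 ∧ ∃ ε > 0, ∀ y, f y = 0 → h y = 1 → y ≠ p →
      ‖y - p‖ ≤ ε → y ∉ P ∧ ∃ v, fderiv ℂ f y v = 0 ∧ fderiv ℂ h y v = 0 ∧ inner ℂ (y - p) v ≠ 0)
    {Q : Set E} (hQ : Q.Finite) {D : Type*} [TopologicalSpace D] [CompactSpace D] [NormalSpace D]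
    (hD : AvoidsZero D (n + 1)) (G : C(D, E)) (hG : ∀ u, h (G u) = 1) :
    ∃ K : C({x | f x = 0 ∧ h x = 1} × I, {x | f x = 0 ∧ h x = 1}), (∀ y, K (y, 0) = y) ∧
      (∀ y, y.1 ∈ Q → ∀ t, K (y, t) = y) ∧ ∃ G' : C(D, {x | f x = 0 ∧ h x = 1}),
        ∀ u (hu : f (G u) = 0), G' u = K (⟨G u, hu, hG u⟩, 1) := by
  have : ProperSpace E := FiniteDimensional.proper ℂ E
  obtain ⟨ρ, hρ⟩ := exists_push_to_zero hD hdim hf hh hd hom hout G hG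
  set S := {x | f x = 0 ∧ h x = 1} with hSdef
  have hS : IsClosed S := (isClosed_eq hf.continuous continuous_const).inter
    (isClosed_eq hh.continuous continuous_const)
  have hΦ : ∀ y, HasStrictFDerivAt (fun x => (f x, h x))
      ((fderiv ℂ f y).prod (fderiv ℂ h y)) y := fun y =>
    (hf.contDiffAt.hasStrictFDerivAt two_ne_zero).prodMk
      (hh.contDiffAt.hasStrictFDerivAt two_ne_zero)
  have hSΦ : ∀ y ∈ S, {x | (f x, h x) = (f y, h y)} = S := by
    intro y hy
    ext x
    simp [hSdef, hy.1, hy.2]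
  have hC : IsCompact (S ∩ Metric.closedBall 0 ρ) := (isCompact_closedBall 0 ρ).inter_left hS
  obtain ⟨K, K0, KQ, O, e, hO, hCO, hec, heS, heK⟩ := exists_homotopy_extension hS P
    (hQ.union P.finite_toSet) (fun p hp => Or.inr hp) (fun p hp => by
      obtain ⟨h1, h2, ε, hε, h3⟩ := hcone p hp
      refine ⟨⟨h1, h2⟩, ε, hε, fun y hy hyp hyε => ?_⟩
      obtain ⟨hyP, v, hv1, hv2, hv⟩ := h3 y hy.1 hy.2 hyp hyε
      rw [← hSΦ y hy]
      exact hasInwardVector_of_complex (hΦ y) (hreg y hy.1 hy.2 hyP) (by simp [hv1, hv2]) hv)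
    (fun y hy hyP => by
      obtain ⟨r, R, hr, -⟩ := exists_isLocalRetraction_of_complex (hΦ y) (hreg y hy.1 hy.2 hyP)
      rw [hSΦ y hy] at hr
      exact ⟨r, R, hr⟩) hC Set.inter_subset_left
  have ha : ∃ a > 0, ∀ x, h x = 1 → ‖x‖ ≤ ρ → ‖f x‖ ≤ a → x ∈ O := by
    have hT : IsCompact ((Metric.closedBall 0 ρ ∩ {x | h x = 1}) \ O) :=
      ((isCompact_closedBall 0 ρ).inter_right (isClosed_eq hh.continuous continuous_const)).diff hO
    rcases Set.eq_empty_or_nonempty ((Metric.closedBall 0 ρ ∩ {x | h x = 1}) \ O) with h0 | hne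
    · refine ⟨1, one_pos, fun x h1 h2 _ => ?_⟩
      by_contra hx
      have : x ∈ (∅ : Set E) := h0 ▸ ⟨⟨mem_closedBall_zero_iff.2 h2, h1⟩, hx⟩
      exact this
    · obtain ⟨z, hz, hmin⟩ := hT.exists_isMinOn hne hf.continuous.norm.continuousOn
      have hz0 : 0 < ‖f z‖ := norm_pos_iff.2 fun h0 => hz.2 (hCO ⟨⟨h0, hz.1.2⟩, hz.1.1⟩)
      refine ⟨‖f z‖ / 2, half_pos hz0, fun x h1 h2 h3 => ?_⟩
      by_contra hx
      have : ‖f z‖ ≤ ‖f x‖ := hmin ⟨⟨mem_closedBall_zero_iff.2 h2, h1⟩, hx⟩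
      linarith
  obtain ⟨a, ha, haO⟩ := ha
  obtain ⟨G', hG'⟩ := hρ a ha
  have hG'O : ∀ u, G' u ∈ O := fun u => haO _ (hG' u).1 (hG' u).2.2.1 (hG' u).2.1
  refine ⟨K, K0, fun y hy => KQ y (Or.inl hy), ⟨fun u => ⟨e (G' u), heS _ (hG'O u)⟩, ?_⟩,
    fun u hu => Subtype.ext ?_⟩
  · exact (hec.comp_continuous G'.continuous hG'O).subtype_mk _
  · change e (G' u) = _
    have h1 := (hG' u).2.2.2 hu
    rw [h1]
    exact heK _ ⟨hu, hG u⟩ (h1 ▸ hG'O u)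

end HomotopyPush

section PolynomialMap

variable {σ ι : Type*} [Fintype σ] [Fintype ι]

theorem exists_forall_sum_mul_eq {g : ι → σ → ℂ} (hg : LinearIndependent ℂ g) (c : ι → ℂ) :
    ∃ v : σ → ℂ, ∀ j, ∑ i, v i * g j i = c j := by
  classical
  have h1 : (Matrix.of g).rank = Fintype.card ι := LinearIndependent.rank_matrix hg
  have h2 : LinearMap.range (Matrix.of g).mulVecLin = ⊤ := by
    apply Submodule.eq_top_of_finrank_eq
    rw [Module.finrank_fintype_fun_eq_card, ← h1, Matrix.rank]
  obtain ⟨v, hv⟩ := LinearMap.range_eq_top.1 h2 c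
  refine ⟨v, fun j => ?_⟩
  rw [← hv]
  exact Finset.sum_congr rfl fun i _ => mul_comm _ _

theorem exists_forall_eq_sum_mul {g : ι → σ → ℂ} {w : σ → ℂ}
    (h : ∀ v : σ → ℂ, (∀ j, ∑ i, v i * g j i = 0) → ∑ i, v i * w i = 0) :
    ∃ lam : ι → ℂ, ∀ i, w i = ∑ j, lam j * g j i := by
  classical
  let L : (σ → ℂ) → (σ → ℂ) →ₗ[ℂ] ℂ := fun g => ∑ i, g i • LinearMap.proj i
  have hL : ∀ g v, L g v = ∑ i, v i * g i := fun g v => by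
    simp [L, mul_comm]
  have h1 : L w ∈ Submodule.span ℂ (Set.range fun j => L (g j)) := by
    refine mem_span_of_iInf_ker_le_ker fun v hv => ?_
    rw [LinearMap.mem_ker, hL]
    refine h v fun j => ?_
    rw [← hL]
    exact (Submodule.mem_iInf _).1 hv j
  obtain ⟨lam, hlam⟩ := (Submodule.mem_span_range_iff_exists_fun ℂ).1 h1
  refine ⟨lam, fun i => ?_⟩
  have h2 := LinearMap.congr_fun hlam (Pi.single i 1)
  simpa [hL, Pi.single_apply] using h2.symm

/-- Near any point `p`, a common zero of polynomials has a tangent vector not orthogonal to its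
difference with `p`. -/
theorem exists_tangent_not_orthogonal (F : ι → MvPolynomial σ ℂ) (p : EuclideanSpace ℂ σ) :
    ∃ ε > 0, ∀ y : EuclideanSpace ℂ σ, (∀ j, eval y (F j) = 0) → y ≠ p → ‖y - p‖ ≤ ε →
      ∃ v : EuclideanSpace ℂ σ, (∀ j, ∑ i, v i * eval y (pderiv i (F j)) = 0) ∧
        inner ℂ (y - p) v ≠ 0 := by
  have hA := (finite_sq_dist_critical F p).subset (Set.sdiff_subset (t := {0}))
  obtain ⟨η, hη, h2⟩ := Metric.mem_nhds_iff.1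
    (hA.isClosed.isOpen_compl.mem_nhds (by simp : (0 : ℂ) ∈ _))
  refine ⟨min 1 (η / 2), by positivity, fun y hy hyp hyε => ?_⟩
  by_contra! hv
  have hsum : ∑ i, (y i - p i) * star (y i - p i) = ((‖y - p‖ ^ 2 : ℝ) : ℂ) := by
    rw [EuclideanSpace.norm_sq_eq]
    push_cast
    refine Finset.sum_congr rfl fun i _ => ?_
    rw [PiLp.sub_apply, Complex.star_def, Complex.mul_conj, Complex.normSq_eq_norm_sq]
    push_cast
    rfl
  obtain ⟨lam, hlam⟩ := exists_forall_eq_sum_mul (g := fun j i => eval y (pderiv i (F j)))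
    (w := fun i => star (y i - p i)) fun v h => by
      have h3 := hv (WithLp.toLp 2 v) h
      rw [PiLp.inner_apply] at h3
      simpa using h3
  have hpos : 0 < ‖y - p‖ := norm_pos_iff.2 (sub_ne_zero.2 hyp)
  refine h2 (?_ : ((‖y - p‖ ^ 2 : ℝ) : ℂ) ∈ Metric.ball 0 η) ⟨⟨y, lam, hy, hlam, hsum.symm⟩, ?_⟩
  · rw [mem_ball_zero_iff, Complex.norm_real, Real.norm_of_nonneg (by positivity)]
    nlinarith [min_le_left 1 (η / 2), min_le_right 1 (η / 2)]
  · rw [Set.mem_singleton_iff, Complex.ofReal_eq_zero]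
    positivity

theorem hasStrictFDerivAt_eval (p : MvPolynomial σ ℂ) (x : EuclideanSpace ℂ σ) :
    HasStrictFDerivAt (fun x : EuclideanSpace ℂ σ => eval x p)
      (∑ i, eval x (pderiv i p) • (EuclideanSpace.proj i : EuclideanSpace ℂ σ →L[ℂ] ℂ)) x := by
  classical
  induction p using MvPolynomial.induction_on with
  | C a =>
    simp only [eval_C]
    refine (hasStrictFDerivAt_const (𝕜 := ℂ) a x).congr_fderiv ?_
    ext v
    simp
  | add p q hp hq =>
    simp only [map_add]
    refine (hp.add hq).congr_fderiv ?_
    ext v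
    simp [add_mul, Finset.sum_add_distrib]
  | mul_X p i hp =>
    have h1 := hp.mul (EuclideanSpace.proj i : EuclideanSpace ℂ σ →L[ℂ] ℂ).hasStrictFDerivAt
    simp only [map_mul, eval_X]
    refine h1.congr_fderiv ?_
    ext v
    have h2 : ∀ j, eval x (if i = j then p else 0) = if i = j then eval x p else 0 := fun j => by
      split_ifs <;> simp
    simp [pderiv_X, Pi.single_apply, h2, Finset.sum_add_distrib, mul_add, Finset.mul_sum,
      mul_comm, mul_left_comm]

theorem contDiff_eval (p : MvPolynomial σ ℂ) {m : WithTop ℕ∞} :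
    ContDiff ℂ m fun x : EuclideanSpace ℂ σ => eval x p := by
  induction p using MvPolynomial.induction_on with
  | C a => simpa using contDiff_const
  | add p q hp hq => simpa using hp.add hq
  | mul_X p i hp =>
    simp only [map_mul, eval_X]
    exact hp.mul (EuclideanSpace.proj i : EuclideanSpace ℂ σ →L[ℂ] ℂ).contDiff

theorem fderiv_eval_apply (p : MvPolynomial σ ℂ) (x v : EuclideanSpace ℂ σ) :
    fderiv ℂ (fun x : EuclideanSpace ℂ σ => eval x p) x v = ∑ i, v i * eval x (pderiv i p) := by
  rw [(hasStrictFDerivAt_eval p x).hasFDerivAt.fderiv]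
  simp [mul_comm]

/-- The map between Euclidean spaces with given polynomial coordinates. -/
noncomputable def polynomialMap (F : ι → MvPolynomial σ ℂ) (x : EuclideanSpace ℂ σ) :
    EuclideanSpace ℂ ι :=
  WithLp.toLp 2 fun j => eval x (F j)

theorem contDiff_polynomialMap (F : ι → MvPolynomial σ ℂ) {m : WithTop ℕ∞} :
    ContDiff ℂ m (polynomialMap F) :=
  contDiff_euclidean.2 fun j => contDiff_eval (F j)

theorem fderiv_polynomialMap_apply (F : ι → MvPolynomial σ ℂ) (x v : EuclideanSpace ℂ σ) (j : ι) :
    fderiv ℂ (polynomialMap F) x v j = ∑ i, v i * eval x (pderiv i (F j)) := by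
  have h1 : DifferentiableAt ℂ (polynomialMap F) x :=
    ((contDiff_polynomialMap F (m := 1)).differentiable one_ne_zero) x
  rw [← fderiv_eval_apply]
  have h2 := ((EuclideanSpace.proj j : EuclideanSpace ℂ ι →L[ℂ] ℂ).hasFDerivAt.comp x
    h1.hasFDerivAt).fderiv
  exact (DFunLike.congr_fun h2 v).symm

theorem polynomialMap_eq_zero_iff {σ ι : Type*} {F : ι → MvPolynomial σ ℂ}
    {x : EuclideanSpace ℂ σ} :
    polynomialMap F x = 0 ↔ ∀ j, eval x (F j) = 0 :=
  ⟨fun h j => congrArg (fun y : EuclideanSpace ℂ ι => y j) h, fun h => by ext j; exact h j⟩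

theorem MvPolynomial.IsHomogeneous.eval_smul {p : MvPolynomial σ ℂ} {m : ℕ}
    (hp : p.IsHomogeneous m) (c : ℂ) (x : σ → ℂ) : eval (c • x) p = c ^ m * eval x p := by
  rw [eval_eq', eval_eq', Finset.mul_sum]
  refine Finset.sum_congr rfl fun e he => ?_
  have h1 : ∑ i, e i = m := by
    rw [← Finsupp.degree_eq_sum, Finsupp.degree_eq_weight_one]
    exact hp (mem_support_iff.1 he)
  simp only [Pi.smul_apply, smul_eq_mul, mul_pow, Finset.prod_mul_distrib,
    Finset.prod_pow_eq_pow_sum, h1]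
  ring

theorem MvPolynomial.IsHomogeneous.sum_mul_eval_pderiv {p : MvPolynomial σ ℂ} {m : ℕ}
    (hp : p.IsHomogeneous m) (x : σ → ℂ) : ∑ i, x i * eval x (pderiv i p) = m * eval x p := by
  have := congrArg (eval x) hp.sum_X_mul_pderiv
  simpa using this

end PolynomialMap

section PolynomialPush

/-- By Euler's identity, a smooth point of the common zeros of `f` with `h = 1` is a smooth point of
this intersection. -/
theorem surjective_fderiv_prod_of_homogeneous {σ ι : Type*} [Fintype σ] [Fintype ι]
    {f : ι → MvPolynomial σ ℂ} {h : MvPolynomial σ ℂ} {d : ℕ} {dd : ι → ℕ} (hd : d ≠ 0)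
    (hf : ∀ j, (f j).IsHomogeneous (dd j)) (hh : h.IsHomogeneous d) {x : EuclideanSpace ℂ σ}
    (hfx : ∀ j, eval x (f j) = 0) (hhx : eval x h = 1)
    (hx : LinearIndependent ℂ fun j i => eval x (pderiv i (f j))) :
    Function.Surjective ((fderiv ℂ (polynomialMap f) x).prod
      (fderiv ℂ (fun x : EuclideanSpace ℂ σ => eval x h) x)) := by
  rintro ⟨c, e⟩
  obtain ⟨v, hv⟩ := exists_forall_sum_mul_eq hx c
  have h1 : fderiv ℂ (polynomialMap f) x (WithLp.toLp 2 v) = c := by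
    ext j
    rw [fderiv_polynomialMap_apply]
    exact hv j
  have h2 : fderiv ℂ (polynomialMap f) x x = 0 := by
    ext j
    rw [fderiv_polynomialMap_apply, (hf j).sum_mul_eval_pderiv, hfx, mul_zero]
    rfl
  have h3 : fderiv ℂ (fun x : EuclideanSpace ℂ σ => eval x h) x x = d := by
    rw [fderiv_eval_apply, hh.sum_mul_eval_pderiv, hhx, mul_one]
  set h' := fderiv ℂ (fun x : EuclideanSpace ℂ σ => eval x h) x
  refine ⟨WithLp.toLp 2 v + ((e - h' (WithLp.toLp 2 v)) / d) • x, Prod.ext ?_ ?_⟩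
  · simp [h1, h2]
  · have : (d : ℂ) ≠ 0 := Nat.cast_ne_zero.2 hd
    change h' (WithLp.toLp 2 v + ((e - h' (WithLp.toLp 2 v)) / d) • x) = e
    rw [map_add, map_smul, h3, smul_eq_mul, div_mul_cancel₀ _ this, add_sub_cancel]

open unitInterval in
/-- Compact families in the Milnor fibre `h = 1` can be pushed into the complete intersection,
moving the points already there by a self-homotopy. -/
theorem exists_homotopy_push_polynomial {n k N : ℕ} (hN : N = n + k) {d : ℕ} {dd : Fin k → ℕ}
    (hd : 1 ≤ d) {f : Fin k → MvPolynomial (Fin (N + 1)) ℂ} {h : MvPolynomial (Fin (N + 1)) ℂ}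
    (hf : ∀ j, (f j).IsHomogeneous (dd j)) (hh : h.IsHomogeneous d) (hdeg : ∀ j, d < dd j)
    (hsm : ∀ x, x ≠ 0 → (∀ j, eval x (f j) = 0) → eval x h = 0 →
      LinearIndependent ℂ fun j i => eval x (pderiv i (f j)))
    (hfin : {x | (∀ j, eval x (f j) = 0) ∧ eval x h = 1 ∧
      ¬ LinearIndependent ℂ fun j i => eval x (pderiv i (f j))}.Finite)
    {Q : Set (Fin (N + 1) → ℂ)} (hQ : Q.Finite) {D : Type*} [TopologicalSpace D] [CompactSpace D]
    [NormalSpace D] (hD : AvoidsZero D (n + 1)) (G : C(D, {x // eval x h = 1})) :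
    ∃ K : C({x // (∀ j, eval x (f j) = 0) ∧ eval x h = 1} × I,
        {x // (∀ j, eval x (f j) = 0) ∧ eval x h = 1}),
      (∀ y, K (y, 0) = y) ∧ (∀ y, y.1 ∈ Q → ∀ t, K (y, t) = y) ∧
      ∃ G' : C(D, {x // (∀ j, eval x (f j) = 0) ∧ eval x h = 1}),
        ∀ u (hu : ∀ j, eval (G u).1 (f j) = 0), G' u = K (⟨G u, hu, (G u).2⟩, 1) := by
  have hd0 : d ≠ 0 := by omega
  let E := EuclideanSpace ℂ (Fin (N + 1))
  let hE : E → ℂ := fun x => eval x h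
  have hhE : ContDiff ℂ 2 hE := contDiff_eval h
  have hfE : ContDiff ℂ 2 (polynomialMap f) := contDiff_polynomialMap f
  have hom : ∀ (c : ℂ) (x : E), hE (c • x) = c ^ d * hE x := fun c x => hh.eval_smul c x
  have hout : OuterDecrease (polynomialMap f) hE := by
    refine outerDecrease_of_homogeneous hfE hhE hd0 hdeg
      (fun j c x => (hf j).eval_smul c x) hom fun x hx hfx hhx c => ?_
    obtain ⟨v, hv⟩ := exists_forall_sum_mul_eq (hsm x (fun h => hx (by ext i; exact congrFun h i))
      (polynomialMap_eq_zero_iff.1 hfx) hhx) c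
    refine ⟨WithLp.toLp 2 v, ?_⟩
    ext j
    rw [fderiv_polynomialMap_apply]
    exact hv j
  have hfin' : {x : E | (∀ j, eval x (f j) = 0) ∧ eval x h = 1 ∧
      ¬ LinearIndependent ℂ fun j i => eval x (pderiv i (f j))}.Finite :=
    hfin.preimage (WithLp.ofLp_injective 2).injOn
  let P := hfin'.toFinset
  have hreg : ∀ y : E, polynomialMap f y = 0 → hE y = 1 → y ∉ P →
      Function.Surjective ((fderiv ℂ (polynomialMap f) y).prod (fderiv ℂ hE y)) := by
    intro y hfy hhy hy
    rw [polynomialMap_eq_zero_iff] at hfy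
    refine surjective_fderiv_prod_of_homogeneous hd0 hf hh hfy hhy ?_
    by_contra hcon
    exact hy (hfin'.mem_toFinset.2 ⟨hfy, hhy, hcon⟩)
  have hcone : ∀ p ∈ P, polynomialMap f p = 0 ∧ hE p = 1 ∧ ∃ ε > 0, ∀ y, polynomialMap f y = 0 →
      hE y = 1 → y ≠ p → ‖y - p‖ ≤ ε → y ∉ P ∧ ∃ v, fderiv ℂ (polynomialMap f) y v = 0 ∧
        fderiv ℂ hE y v = 0 ∧ inner ℂ (y - p) v ≠ 0 := by
    intro p hp
    obtain ⟨h1, h2, -⟩ := hfin'.mem_toFinset.1 hp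
    refine ⟨polynomialMap_eq_zero_iff.2 h1, h2, ?_⟩
    let F : Option (Fin k) → MvPolynomial (Fin (N + 1)) ℂ := fun o => o.elim (h - 1) f
    obtain ⟨ε, hε, hF⟩ := exists_tangent_not_orthogonal F p
    obtain ⟨η, hη, h3⟩ := Metric.mem_nhds_iff.1
      ((hfin'.subset (Set.sdiff_subset (t := {p}))).isClosed.isOpen_compl.mem_nhds
        (by simp : p ∈ _))
    refine ⟨min ε (η / 2), by positivity, fun y hfy hhy hyp hyε => ⟨fun hyP => ?_, ?_⟩⟩
    · refine h3 (?_ : y ∈ Metric.ball p η) ⟨hfin'.mem_toFinset.1 hyP, hyp⟩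
      rw [mem_ball_iff_norm]
      linarith [min_le_right ε (η / 2)]
    · rw [polynomialMap_eq_zero_iff] at hfy
      obtain ⟨v, hv, hv'⟩ := hF y (fun o => by
        cases o with
        | none => simpa [F, sub_eq_zero] using hhy
        | some j => exact hfy j) hyp (hyε.trans (min_le_left _ _))
      refine ⟨v, ?_, ?_, hv'⟩
      · ext j
        rw [fderiv_polynomialMap_apply]
        exact hv (some j)
      · rw [fderiv_eval_apply]
        simpa [F] using hv none
  have hdim : Module.finrank ℂ E = Module.finrank ℂ (EuclideanSpace ℂ (Fin k)) + n + 1 := by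
    rw [finrank_euclideanSpace_fin, finrank_euclideanSpace_fin]
    omega
  have hQ' : {x : E | x.ofLp ∈ Q}.Finite := hQ.preimage (WithLp.ofLp_injective 2).injOn
  obtain ⟨K, K0, KQ, G', hG'⟩ := exists_homotopy_push hdim hfE hhE hd0 hom hout P hreg hcone hQ' hD
    ⟨fun u => WithLp.toLp 2 (G u).1, by fun_prop⟩ fun u => (G u).2
  let φ : C({x // (∀ j, eval x (f j) = 0) ∧ eval x h = 1},
      {x : E | polynomialMap f x = 0 ∧ hE x = 1}) :=
    ⟨fun x => ⟨WithLp.toLp 2 x.1, polynomialMap_eq_zero_iff.2 x.2.1, x.2.2⟩, by fun_prop⟩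
  let ψ : C({x : E | polynomialMap f x = 0 ∧ hE x = 1},
      {x // (∀ j, eval x (f j) = 0) ∧ eval x h = 1}) :=
    ⟨fun x => ⟨WithLp.ofLp x.1, polynomialMap_eq_zero_iff.1 x.2.1, x.2.2⟩,
      ((PiLp.continuous_ofLp 2 _).comp continuous_subtype_val).subtype_mk _⟩
  refine ⟨⟨fun u => ψ (K (φ u.1, u.2)), by fun_prop⟩, fun y => ?_, fun y hy t => ?_, ψ.comp G',
    fun u hu => ?_⟩
  · change ψ (K (φ y, 0)) = y
    rw [K0]
    rfl
  · change ψ (K (φ y, t)) = y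
    rw [KQ (φ y) hy]
    rfl
  · exact congrArg ψ (hG' u (polynomialMap_eq_zero_iff.2 hu))

end PolynomialPush

section PushConnectivity

open unitInterval

/-- Compact families in `X` of low dimension can be pushed into `Z` along `j : Z → X`, up to a
self-homotopy of `Z` fixing given points. -/
def HasPush {Z X : Type*} [TopologicalSpace Z] [TopologicalSpace X] (j : C(Z, X)) (m : ℕ) : Prop :=
  ∀ i < m, ∀ (Q : Set Z), Q.Finite → ∀ G : C(I × (Fin i → I), X),
    ∃ K : C(Z × I, Z), (∀ y, K (y, 0) = y) ∧ (∀ y ∈ Q, ∀ t, K (y, t) = y) ∧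
      ∃ G' : C(I × (Fin i → I), Z), ∀ u z, G u = j z → G' u = K (z, 1)

variable {Z X : Type*} [TopologicalSpace Z] [TopologicalSpace X] {j : C(Z, X)} {m : ℕ}

theorem HasPush.pathConnectedSpace [PathConnectedSpace X] (H : HasPush j m) (hm : 0 < m) :
    PathConnectedSpace Z := by
  obtain ⟨x⟩ := PathConnectedSpace.nonempty (X := X)
  refine ⟨?_, fun x y => ?_⟩
  · obtain ⟨-, -, -, G', -⟩ := H 0 hm ∅ Set.finite_empty (ContinuousMap.const _ x)
    exact ⟨G' (0, fun _ => 0)⟩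
  · let γ := PathConnectedSpace.somePath (j x) (j y)
    obtain ⟨K, -, KQ, G', hG'⟩ := H 0 hm {x, y} (by simp) ⟨fun u => γ u.1, by fun_prop⟩
    refine ⟨⟨⟨fun t => G' (t, fun _ => 0), by fun_prop⟩, ?_, ?_⟩⟩
    · change G' (0, fun _ => 0) = x
      rw [hG' (0, fun _ => 0) x γ.source, KQ x (by simp)]
    · change G' (1, fun _ => 0) = y
      rw [hG' (1, fun _ => 0) y γ.target, KQ y (by simp)]

theorem HasPush.subsingleton_homotopyGroup (H : HasPush j m) {i : ℕ} (hi : i < m) (z : Z)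
    [Subsingleton (HomotopyGroup (Fin i) X (j z))] : Subsingleton (HomotopyGroup (Fin i) Z z) := by
  suffices h : ∀ γ : GenLoop (Fin i) Z z, GenLoop.Homotopic γ GenLoop.const by
    refine ⟨fun a b => ?_⟩
    induction a using Quotient.inductionOn with | h a => ?_
    induction b using Quotient.inductionOn with | h b => ?_
    exact Quotient.sound ((h a).trans (h b).symm)
  intro γ
  let γ' : GenLoop (Fin i) X (j z) := ⟨j.comp γ.1, fun y hy => congrArg j (γ.2 y hy)⟩
  obtain ⟨F⟩ : GenLoop.Homotopic γ' GenLoop.const :=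
    Quotient.exact (s := GenLoop.Homotopic.setoid (Fin i) (j z))
      (Subsingleton.elim (α := HomotopyGroup (Fin i) X (j z)) _ _)
  obtain ⟨K, K0, KQ, G', hG'⟩ := H i hi {z} (by simp) F.toContinuousMap
  let δ : C(Fin i → I, Z) := ⟨fun y => K (γ.1 y, 1), by fun_prop⟩
  have h0 : γ.1.HomotopicRel δ (Cube.boundary (Fin i)) :=
    ⟨{ toFun := fun u => K (γ.1 u.2, u.1)
       continuous_toFun := by fun_prop
       map_zero_left := fun y => K0 _
       map_one_left := fun y => rfl
       prop' := fun t y hy => by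
         change K (γ.1 y, t) = γ.1 y
         exact KQ _ (γ.2 y hy) t }⟩
  have hδ : ∀ y ∈ Cube.boundary (Fin i), δ y = z := fun y hy => by
    change K (γ.1 y, 1) = z
    rw [γ.2 y hy, KQ z rfl]
  have h1 : δ.HomotopicRel (GenLoop.const : GenLoop (Fin i) Z z).1 (Cube.boundary (Fin i)) :=
    ⟨{ toFun := fun u => G' u
       continuous_toFun := by fun_prop
       map_zero_left := fun y => hG' (0, y) (γ.1 y) (F.map_zero_left y)
       map_one_left := fun y => by
         rw [hG' (1, y) z (F.map_one_left y), KQ z rfl]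
         rfl
       prop' := fun t y hy => by
         change G' (t, y) = δ y
         rw [hδ y hy, hG' (t, y) z ((F.eq_fst t hy).trans (γ'.2 y hy)), KQ z rfl] }⟩
  exact h0.trans h1

end PushConnectivity

section CoveringHomotopyGroups

open unitInterval

variable {Z M : Type*} [TopologicalSpace Z] [TopologicalSpace M] {p : Z → M}

theorem simplyConnectedSpace_of_subsingleton_homotopyGroup [PathConnectedSpace Z]
    (H : ∀ z : Z, Subsingleton (HomotopyGroup (Fin 1) Z z)) : SimplyConnectedSpace Z := by
  rw [simply_connected_iff_loops_nullhomotopic]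
  refine ⟨inferInstance, fun {z} γ => ?_⟩
  have := (HomotopyGroup.pi1EquivFundamentalGroup (X := Z) (x := z)).symm.injective.subsingleton
  exact Path.Homotopic.Quotient.exact
    (Subsingleton.elim (α := FundamentalGroup Z z) (.fromPath ⟦γ⟧) (.fromPath ⟦Path.refl z⟧))

/-- Two points of the fibre over `m` joined by a path in this fibre are equal. -/
theorem IsCoveringMap.eq_of_path (hp : IsCoveringMap p) {A : Type*} [TopologicalSpace A] {m : M}
    {Γ : C(A, Z)} {α : C(I, A)} (h : ∀ t, p (Γ (α t)) = m) : Γ (α 0) = Γ (α 1) :=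
  hp.const_of_comp (g := Γ ∘ α) (by fun_prop) (fun t t' => (h t).trans (h t').symm) 0 1

/-- A loop of dimension at least two lifts to a loop. -/
theorem IsCoveringMap.exists_lift_genLoop (hp : IsCoveringMap p) {i : ℕ} (hi : 2 ≤ i) (z : Z)
    (γ : GenLoop (Fin i) M (p z)) : ∃ Γ : GenLoop (Fin i) Z z, ∀ y, p (Γ y) = γ y := by
  have : Nontrivial (Fin i) := Fin.nontrivial_iff_two_le.2 hi
  let H : C(I × (Fin i → I), M) := ⟨fun u => γ fun c => u.1 * u.2 c, by fun_prop⟩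
  have h00 : γ (fun _ => 0) = p z := γ.2 _ ⟨⟨0, by omega⟩, Or.inl rfl⟩
  let L := hp.liftHomotopy H (ContinuousMap.const _ z) fun y => by simp [H, h00]
  have hL : ∀ u, p (L u) = H u := fun u => congrFun (hp.liftHomotopy_lifts _ _ _) u
  let Γ : C(Fin i → I, Z) := ⟨fun y => L (1, y), by fun_prop⟩
  have hΓ : ∀ y, p (Γ y) = γ y := fun y => (hL (1, y)).trans (by simp [H])
  have h0 : Γ (fun _ => 0) = z := by
    have h1 := hp.eq_of_path (Γ := L) (α := ⟨fun t => (t, fun _ => 0), by fun_prop⟩) (m := p z)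
      fun t => by simp [hL, H, h00]
    exact h1.symm.trans (hp.liftHomotopy_zero _ _ _ _)
  refine ⟨⟨Γ, ?_⟩, hΓ⟩
  rintro y ⟨a, ha⟩
  obtain ⟨b, hb⟩ := exists_ne a
  have h1 := hp.eq_of_path (Γ := Γ)
    (α := ⟨fun t => Function.update y b (t * y b), by fun_prop⟩) (m := p z) fun t => by
      rw [hΓ]
      refine γ.2 _ ⟨a, ?_⟩
      simpa [hb.symm] using ha
  have h2 := hp.eq_of_path (Γ := Γ)
    (α := ⟨fun t c => t * Function.update y b 0 c, by fun_prop⟩) (m := p z) fun t => by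
      rw [hΓ]
      exact γ.2 _ ⟨b, by simp⟩
  simp only [ContinuousMap.coe_mk, zero_mul, one_mul, Function.update_eq_self] at h1 h2
  rw [← h1, ← h2, h0]

theorem IsCoveringMap.subsingleton_homotopyGroup (hp : IsCoveringMap p) {i : ℕ} (hi : 2 ≤ i)
    (z : Z) [Subsingleton (HomotopyGroup (Fin i) Z z)] :
    Subsingleton (HomotopyGroup (Fin i) M (p z)) := by
  suffices h : ∀ γ : GenLoop (Fin i) M (p z), GenLoop.Homotopic γ GenLoop.const by
    refine ⟨fun a b => ?_⟩
    induction a using Quotient.inductionOn with | h a => ?_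
    induction b using Quotient.inductionOn with | h b => ?_
    exact Quotient.sound ((h a).trans (h b).symm)
  intro γ
  obtain ⟨Γ, hΓ⟩ := hp.exists_lift_genLoop hi z γ
  have h1 : GenLoop.Homotopic Γ GenLoop.const :=
    Quotient.exact (s := GenLoop.Homotopic.setoid (Fin i) z)
      (Subsingleton.elim (α := HomotopyGroup (Fin i) Z z) _ _)
  have h2 := h1.comp_continuousMap ⟨p, hp.continuous⟩
  have h3 : γ.1 = (ContinuousMap.mk p hp.continuous).comp Γ.1 := by
    ext y
    exact (hΓ y).symm
  change γ.1.HomotopicRel _ _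
  rw [h3]
  exact h2

end CoveringHomotopyGroups

section MilnorCovering

variable {n k d : ℕ} {dd : Fin k → ℕ} {f : Fin k → MvPolynomial (Fin n) ℂ}
  {h : MvPolynomial (Fin n) ℂ}

theorem nonempty_rootsOfUnity_mulEquiv (hd : d ≠ 0) :
    Nonempty ((rootsOfUnity d ℂ)ᵐᵒᵖ ≃* Multiplicative (ZMod d)) := by
  have : NeZero d := ⟨hd⟩
  have hc : Nat.card (rootsOfUnity d ℂ) = Nat.card (Multiplicative (ZMod d)) := by
    rw [Complex.card_rootsOfUnity]; simp
  exact ⟨(MulOpposite.opMulEquiv (M := rootsOfUnity d ℂ)).symm.trans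
    (mulEquivOfCyclicCardEq hc)⟩

/-- The action of the `d`-th roots of unity on `{f = 0, h = 1}` by scalar multiplication. -/
noncomputable abbrev rootsOfUnityMulAction (hf : ∀ j, (f j).IsHomogeneous (dd j))
    (hh : h.IsHomogeneous d) :
    MulAction (rootsOfUnity d ℂ) {x : Fin n → ℂ // (∀ j, eval x (f j) = 0) ∧ eval x h = 1} where
  smul g x := ⟨(g.1 : ℂ) • x.1, fun j => by rw [(hf j).eval_smul, x.2.1 j, mul_zero], by
    rw [hh.eval_smul, x.2.2, mul_one, ← Units.val_pow_eq_pow_val,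
      (mem_rootsOfUnity d g.1).1 g.2, Units.val_one]⟩
  one_smul x := Subtype.ext (one_smul ℂ x.1)
  mul_smul a b x := Subtype.ext (mul_smul (a.1 : ℂ) (b.1 : ℂ) x.1)

theorem MvPolynomial.IsHomogeneous.ne_zero_of_eval_ne_zero (hd : d ≠ 0) (hh : h.IsHomogeneous d)
    {x : Fin n → ℂ} (hx : eval x h ≠ 0) : x ≠ 0 := by
  rintro rfl
  apply hx
  have := hh.eval_smul 0 0
  rwa [zero_smul, zero_pow hd, zero_mul] at this

/-- The projection of `{f = 0, h = 1}` to the part of the projective variety `f = 0` where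
`h ≠ 0`. -/
noncomputable def milnorProjection (f : Fin k → MvPolynomial (Fin n) ℂ) (hd : d ≠ 0)
    (hh : h.IsHomogeneous d)
    (x : {x : Fin n → ℂ // (∀ j, eval x (f j) = 0) ∧ eval x h = 1}) :
    ({P | ∃ x, ∃ hx : x ≠ 0, P = Projectivization.mk ℂ x hx ∧
      (∀ j, eval x (f j) = 0) ∧ eval x h ≠ 0} : Set (Projectivization ℂ (Fin n → ℂ))) :=
  ⟨Projectivization.mk ℂ x.1 (hh.ne_zero_of_eval_ne_zero hd (by simp [x.2.2])),
    x.1, _, rfl, x.2.1, by simp [x.2.2]⟩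

theorem continuous_milnorProjection (hd : d ≠ 0) (hh : h.IsHomogeneous d) :
    Continuous (milnorProjection f hd hh) := by
  refine Continuous.subtype_mk ?_ _
  exact continuous_quot_mk.comp (continuous_subtype_val.subtype_mk
    fun x : {x : Fin n → ℂ // (∀ j, eval x (f j) = 0) ∧ eval x h = 1} =>
      hh.ne_zero_of_eval_ne_zero hd (by simp [x.2.2]))

theorem isOpenMap_projectivization_mk {m : ℕ} :
    IsOpenMap fun v : {v : Fin m → ℂ // v ≠ 0} => Projectivization.mk ℂ v.1 v.2 := by
  intro U hU
  refine isOpen_coinduced.2 ?_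
  have : (fun v : {v : Fin m → ℂ // v ≠ 0} => Projectivization.mk ℂ v.1 v.2) ⁻¹'
      ((fun v : {v : Fin m → ℂ // v ≠ 0} => Projectivization.mk ℂ v.1 v.2) '' U) =
      ⋃ c : ℂˣ, {v | (⟨(c : ℂ) • v.1, smul_ne_zero c.ne_zero v.2⟩ :
        {v : Fin m → ℂ // v ≠ 0}) ∈ U} := by
    ext v
    simp only [Set.mem_preimage, Set.mem_image, Set.mem_iUnion, Set.mem_ofPred_eq]
    constructor
    · rintro ⟨w, hw, hwv⟩
      obtain ⟨a, ha⟩ := (Projectivization.mk_eq_mk_iff ℂ _ _ w.2 v.2).1 hwv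
      refine ⟨a, ?_⟩
      have : (a : ℂ) • v.1 = w.1 := ha
      simpa only [this] using hw
    · rintro ⟨c, hc⟩
      exact ⟨_, hc, (Projectivization.mk_eq_mk_iff ℂ _ _ _ _).2 ⟨c, rfl⟩⟩
  change IsOpen ((fun v : {v : Fin m → ℂ // v ≠ 0} => Projectivization.mk ℂ v.1 v.2) ⁻¹' _)
  rw [this]
  exact isOpen_iUnion fun c => hU.preimage (by fun_prop)

/-- Near every point of the cone over the complement of `h = 0` there is a continuous map which
rescales to `h = 1`. -/
theorem exists_rescale (hd : d ≠ 0) (hf : ∀ j, (f j).IsHomogeneous (dd j))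
    (hh : h.IsHomogeneous d) (v₀ : {v : Fin n → ℂ // (∀ j, eval v (f j) = 0) ∧ eval v h ≠ 0}) :
    ∃ g : {v : Fin n → ℂ // (∀ j, eval v (f j) = 0) ∧ eval v h ≠ 0} →
        {x : Fin n → ℂ // (∀ j, eval x (f j) = 0) ∧ eval x h = 1},
      ContinuousAt g v₀ ∧ ∀ v, ∃ c : ℂ, c ≠ 0 ∧ (g v).1 = c • v.1 := by
  obtain ⟨c₀, hc₀⟩ := IsAlgClosed.exists_pow_nat_eq (eval v₀.1 h)⁻¹ (Nat.pos_of_ne_zero hd)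
  let r : {v : Fin n → ℂ // (∀ j, eval v (f j) = 0) ∧ eval v h ≠ 0} → ℂ := fun v =>
    c₀ * (eval v₀.1 h / eval v.1 h) ^ ((d : ℂ)⁻¹)
  have hr v : r v ^ d * eval v.1 h = 1 := by
    have h1 := v₀.2.2
    have h2 := v.2.2
    rw [mul_pow, hc₀, Complex.cpow_nat_inv_pow _ hd]
    field_simp
  have hcont : ContinuousAt r v₀ := by
    have h1 : ContinuousAt (fun v : {v : Fin n → ℂ // (∀ j, eval v (f j) = 0) ∧ eval v h ≠ 0} =>
        eval v₀.1 h / eval v.1 h) v₀ :=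
      continuousAt_const.div ((MvPolynomial.continuous_eval h).comp
        continuous_subtype_val).continuousAt v₀.2.2
    refine continuousAt_const.mul (h1.cpow continuousAt_const ?_)
    rw [div_self v₀.2.2]
    simp
  refine ⟨fun v => ⟨r v • v.1, fun j => by rw [(hf j).eval_smul, v.2.1 j, mul_zero], by
    rw [hh.eval_smul, hr]⟩, ?_, fun v => ⟨r v, ?_, rfl⟩⟩
  · refine Topology.IsInducing.subtypeVal.continuousAt_iff.2 ?_
    exact hcont.smul continuous_subtype_val.continuousAt
  · intro h0
    have := hr v
    rw [h0, zero_pow hd, zero_mul] at this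
    exact zero_ne_one this

theorem isQuotientMap_milnorProjection (hd : d ≠ 0) (hf : ∀ j, (f j).IsHomogeneous (dd j))
    (hh : h.IsHomogeneous d) : IsQuotientMap (milnorProjection f hd hh) := by
  have hsurj : Function.Surjective (milnorProjection f hd hh) := by
    rintro ⟨_, x, hx, rfl, hfx, hhx⟩
    obtain ⟨g, -, hg⟩ := exists_rescale hd hf hh ⟨x, hfx, hhx⟩
    obtain ⟨c, hc, hgc⟩ := hg ⟨x, hfx, hhx⟩
    exact ⟨g ⟨x, hfx, hhx⟩, Subtype.ext
      ((Projectivization.mk_eq_mk_iff ℂ _ _ _ _).2 ⟨Units.mk0 c hc, hgc.symm⟩)⟩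
  refine (isQuotientMap_iff _).2 ⟨?_, hsurj⟩
  refine isCoinducing_iff.2 fun U =>
    ⟨fun hU => ?_, fun hU => hU.preimage (continuous_milnorProjection hd hh)⟩
  rw [isOpen_iff_mem_nhds]
  rintro ⟨_, x, hx, rfl, hfx, hhx⟩ hxU
  obtain ⟨g, hgx, hg⟩ := exists_rescale hd hf hh ⟨x, hfx, hhx⟩
  have hpg v (w : {P : Projectivization ℂ (Fin n → ℂ) | ∃ x, ∃ hx : x ≠ 0,
      P = Projectivization.mk ℂ x hx ∧ (∀ j, eval x (f j) = 0) ∧ eval x h ≠ 0})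
      (hv : v.1 ≠ 0) (hw : Projectivization.mk ℂ v.1 hv = w.1) :
      milnorProjection f hd hh (g v) = w := by
    obtain ⟨c, hc, hgc⟩ := hg v
    refine Subtype.ext (Eq.trans ?_ hw)
    exact (Projectivization.mk_eq_mk_iff ℂ _ _ _ _).2 ⟨Units.mk0 c hc, hgc.symm⟩
  have h1 : g ⁻¹' (milnorProjection f hd hh ⁻¹' U) ∈ 𝓝 _ :=
    hgx.preimage_mem_nhds (hU.mem_nhds (by
      rw [Set.mem_preimage, hpg _ ⟨_, x, hx, rfl, hfx, hhx⟩ hx rfl]; exact hxU))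
  obtain ⟨u, hu, hug⟩ := (mem_nhds_subtype _ _ _).1 h1
  have h2 := isOpenMap_projectivization_mk.image_mem_nhds
    (x := ⟨x, hx⟩) (continuous_subtype_val.continuousAt.preimage_mem_nhds hu)
  refine (mem_nhds_subtype _ _ _).2 ⟨_, h2, ?_⟩
  rintro ⟨_, w, hw, rfl, hfw, hhw⟩ ⟨v, hv, hvw⟩
  obtain ⟨a, ha⟩ := (Projectivization.mk_eq_mk_iff ℂ _ _ _ _).1 hvw
  have ha' : (a : ℂ) • w = v.1 := ha
  have hfv : ∀ j, eval v.1 (f j) = 0 := fun j => by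
    rw [← ha', (hf j).eval_smul, hfw, mul_zero]
  have hhv : eval v.1 h ≠ 0 := by
    rw [← ha', hh.eval_smul]
    exact mul_ne_zero (pow_ne_zero _ a.ne_zero) hhw
  have h3 := hug (a := ⟨v.1, hfv, hhv⟩) hv
  rwa [Set.mem_preimage, Set.mem_preimage, hpg _ _ v.2 hvw] at h3

theorem isQuotientCoveringMap_milnorProjection (hd : d ≠ 0)
    (hf : ∀ j, (f j).IsHomogeneous (dd j)) (hh : h.IsHomogeneous d) :
    letI := rootsOfUnityMulAction hf hh
    IsQuotientCoveringMap (milnorProjection f hd hh) (rootsOfUnity d ℂ) := by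
  let := rootsOfUnityMulAction hf hh
  have : NeZero d := ⟨hd⟩
  have : LocallyCompactSpace {x : Fin n → ℂ // (∀ j, eval x (f j) = 0) ∧ eval x h = 1} := by
    have h1 : IsClosed {x : Fin n → ℂ | (∀ j, eval x (f j) = 0) ∧ eval x h = 1} := by
      rw [Set.ofPred_and, Set.ofPred_forall]
      exact (isClosed_iInter fun j => isClosed_eq (MvPolynomial.continuous_eval _)
        continuous_const).inter (isClosed_eq (MvPolynomial.continuous_eval _) continuous_const)
    exact h1.isClosedEmbedding_subtypeVal.locallyCompactSpace
  have : ContinuousConstSMul (rootsOfUnity d ℂ)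
      {x : Fin n → ℂ // (∀ j, eval x (f j) = 0) ∧ eval x h = 1} :=
    ⟨fun g => (continuous_subtype_val.const_smul (g.1 : ℂ)).subtype_mk _⟩
  have : IsCancelSMul (rootsOfUnity d ℂ)
      {x : Fin n → ℂ // (∀ j, eval x (f j) = 0) ∧ eval x h = 1} := by
    refine ⟨fun a b x hab => ?_⟩
    have h1 : (a.1 : ℂ) • x.1 = (b.1 : ℂ) • x.1 := congrArg Subtype.val hab
    have h2 : x.1 ≠ 0 := hh.ne_zero_of_eval_ne_zero hd (by simp [x.2.2])
    exact Subtype.ext (Units.ext (smul_left_injective ℂ h2 h1))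
  refine (isQuotientMap_milnorProjection hd hf hh).isQuotientCoveringMap_of_properlyDiscontinuousSMul
    (G := rootsOfUnity d ℂ) fun {x y} => ?_
  refine Subtype.ext_iff.trans ((Projectivization.mk_eq_mk_iff ℂ _ _ _ _).trans ⟨?_, ?_⟩)
  · rintro ⟨a, ha⟩
    have ha' : (a : ℂ) • y.1 = x.1 := ha
    refine ⟨⟨a, (mem_rootsOfUnity d a).2 (Units.ext ?_)⟩, Subtype.ext ha⟩
    have h1 := hh.eval_smul (a : ℂ) y.1
    rw [ha', x.2.2, y.2.2, mul_one] at h1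
    simpa using h1.symm
  · rintro ⟨g, hg⟩
    exact ⟨g.1, congrArg Subtype.val hg⟩

end MilnorCovering

section FiniteLifts

/-- Finitely many points of projective space have finitely many representatives on `h = 1`. -/
theorem finite_singular_of_finite_projective {m d : ℕ} {h : MvPolynomial (Fin m) ℂ} (hd : d ≠ 0)
    (hh : h.IsHomogeneous d) {P : (Fin m → ℂ) → Prop}
    (hP : {p | ∃ x, ∃ hx : x ≠ 0, p = Projectivization.mk ℂ x hx ∧ P x}.Finite) :
    {x | P x ∧ eval x h = 1}.Finite := by
  have hne {x : Fin m → ℂ} (hx : eval x h = 1) : x ≠ 0 :=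
    hh.ne_zero_of_eval_ne_zero hd (by simp [hx])
  have : Fact (0 < d) := ⟨Nat.pos_of_ne_zero hd⟩
  have hfib (p : Projectivization ℂ (Fin m → ℂ)) :
      {x | ∃ hx : eval x h = 1, Projectivization.mk ℂ x (hne hx) = p}.Finite := by
    rcases Set.eq_empty_or_nonempty
      {x | ∃ hx : eval x h = 1, Projectivization.mk ℂ x (hne hx) = p} with h0 | ⟨y, hy, rfl⟩
    · rw [h0]
      exact Set.finite_empty
    · have hroots : {c : ℂ | c ^ d = 1}.Finite := by
        refine (Polynomial.nthRootsFinset d (1 : ℂ)).finite_toSet.subset fun c hc => ?_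
        simpa [Polynomial.mem_nthRootsFinset (Nat.pos_of_ne_zero hd)] using hc
      refine (hroots.image fun c => c • y).subset ?_
      rintro x ⟨hx, hxy⟩
      obtain ⟨a, ha⟩ := (Projectivization.mk_eq_mk_iff ℂ _ _ _ _).1 hxy
      have ha' : (a : ℂ) • y = x := ha
      refine ⟨a, ?_, ha'⟩
      have h1 := hh.eval_smul (a : ℂ) y
      rw [ha', hx, hy, mul_one] at h1
      exact h1.symm
  refine (hP.biUnion fun p _ => hfib p).subset ?_
  rintro x ⟨hPx, hx⟩
  exact Set.mem_biUnion ⟨x, hne hx, rfl, hPx⟩ ⟨hx, rfl⟩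

end FiniteLifts

/-- **Corollary 2.**  Under the assumptions of Theorem 1, with `1 ≤ s ≤ n - 1` and `F_h`
`s`-connected, the complement `M = V ∖ W` is path-connected, has fundamental group cyclic of
order `d` (isomorphic to the group `μ_d` of `d`-th roots of unity), and trivial homotopy groups
`π_i(M)` for `2 ≤ i ≤ s`. -/
theorem complement_s_equivalence_eilenberg_maclane
    (n k N : ℕ) (hn : 1 ≤ n) (hk : 1 ≤ k) (hN : N = n + k)
    (d : ℕ) (dd : Fin k → ℕ) (hd : 1 ≤ d)
    (f : Fin k → MvPolynomial (Fin (N + 1)) ℂ)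
    (h : MvPolynomial (Fin (N + 1)) ℂ)
    (hf : ∀ j, (f j).IsHomogeneous (dd j))
    (hh : h.IsHomogeneous d)
    (Vsing Hset : Set (Projectivization ℂ (Fin (N + 1) → ℂ)))
    -- `Vsing` is the singular locus of `V`
    (hVsing : Vsing = {P | ∃ x, ∃ hx : x ≠ 0, P = Projectivization.mk ℂ x hx ∧
        (∀ j, eval x (f j) = 0) ∧
        ¬ LinearIndependent ℂ fun j => pgrad (f j) x})
    -- `Hset` is the hypersurface `H = {h = 0}`
    (hHset : Hset = {P | ∃ x, ∃ hx : x ≠ 0, P = Projectivization.mk ℂ x hx ∧ eval x h = 0})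
    -- `V_sing` is finite
    (hVsingFin : Vsing.Finite)
    -- `V_sing ∩ H = ∅`
    (hVH : Vsing ∩ Hset = ∅)
    -- `d < d_j` for all `j`
    (hdeg : ∀ j, d < dd j)
    (s : ℕ) (hs1 : 1 ≤ s) (hs : s ≤ n - 1)
    -- the global Milnor fiber `F_h = {h = 1}` is `s`-connected
    (hFh : Nonempty {x : Fin (N + 1) → ℂ // eval x h = 1} ∧
        PathConnectedSpace {x : Fin (N + 1) → ℂ // eval x h = 1} ∧
        ∀ i : ℕ, 1 ≤ i → i ≤ s → ∀ y : {x : Fin (N + 1) → ℂ // eval x h = 1},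
          Subsingleton (HomotopyGroup (Fin i) {x : Fin (N + 1) → ℂ // eval x h = 1} y))
    -- `M = V ∖ W = {[x] : f_1(x) = ⋯ = f_k(x) = 0, h(x) ≠ 0}`
    (M : Set (Projectivization ℂ (Fin (N + 1) → ℂ)))
    (hM : M = {P | ∃ x, ∃ hx : x ≠ 0, P = Projectivization.mk ℂ x hx ∧
        (∀ j, eval x (f j) = 0) ∧ eval x h ≠ 0}) :
    -- `M` is path-connected, `π_1(M) ≅ μ_d ≅ ℤ/dℤ`, and `π_i(M)` is trivial for `2 ≤ i ≤ s`
    PathConnectedSpace M ∧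
      (∀ m₀ : M, Nonempty (FundamentalGroup M m₀ ≃* Multiplicative (ZMod d))) ∧
      ∀ i : ℕ, 2 ≤ i → i ≤ s → ∀ m₀ : M, Subsingleton (HomotopyGroup (Fin i) M m₀) := by
  subst hM
  have hd0 : d ≠ 0 := by omega
  have hsm : ∀ x, x ≠ 0 → (∀ j, eval x (f j) = 0) → eval x h = 0 →
      LinearIndependent ℂ fun j => pgrad (f j) x := by
    intro x hx hfx hhx
    by_contra hli
    have : Projectivization.mk ℂ x hx ∈ Vsing ∩ Hset := by
      rw [hVsing, hHset]
      exact ⟨⟨x, hx, rfl, hfx, hli⟩, x, hx, rfl, hhx⟩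
    rwa [hVH] at this
  have hfin := finite_singular_of_finite_projective hd0 hh
    (P := fun x => (∀ j, eval x (f j) = 0) ∧ ¬ LinearIndependent ℂ fun j => pgrad (f j) x)
    (hVsing ▸ hVsingFin)
  let j : C({x : Fin (N + 1) → ℂ // (∀ j, eval x (f j) = 0) ∧ eval x h = 1},
      {x : Fin (N + 1) → ℂ // eval x h = 1}) :=
    ⟨fun z => ⟨z.1, z.2.2⟩, by fun_prop⟩
  have hpush : HasPush j n := by
    intro i hi Q hQ G
    obtain ⟨K, hK0, hKQ, G', hG'⟩ := exists_homotopy_push_polynomial hN hd hf hh hdeg hsm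
      (hfin.subset fun x hx => ⟨⟨hx.1, hx.2.2⟩, hx.2.1⟩) (hQ.image Subtype.val)
      (avoidsZero_interval_prod_cube (m := n + 1) (by omega)) G
    refine ⟨K, hK0, fun y hy => hKQ y ⟨y, hy, rfl⟩, G', fun u z huz => ?_⟩
    have huz' : (G u).1 = z.1 := congrArg Subtype.val huz
    rw [hG' u (by rw [huz']; exact z.2.1)]
    congr 2
    exact Subtype.ext huz'
  obtain ⟨-, hX, hXi⟩ := hFh
  have hZ := hpush.pathConnectedSpace (by omega)
  have hZi i (h1 : 1 ≤ i) (h2 : i ≤ s) z := 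
    have := hXi i h1 h2 (j z)
    hpush.subsingleton_homotopyGroup (i := i) (by omega) z
  have hZs := simplyConnectedSpace_of_subsingleton_homotopyGroup (hZi 1 le_rfl hs1)
  let := rootsOfUnityMulAction hf hh
  have hp := isQuotientCoveringMap_milnorProjection hd0 hf hh
  refine ⟨hp.surjective.pathConnectedSpace hp.continuous, fun m₀ => ?_, fun i hi his m₀ => ?_⟩
  · obtain ⟨z, hz⟩ := hp.surjective m₀
    obtain ⟨e⟩ := nonempty_rootsOfUnity_mulEquiv hd0
    exact ⟨(hp.fundamentalGroupEquiv ⟨z, hz⟩).trans e⟩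
  · obtain ⟨z, rfl⟩ := hp.surjective m₀
    have := hZi i (by omega) his z
    exact hp.isCoveringMap.subsingleton_homotopyGroup hi z
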